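/- Let (R,m) be a Noetherian local ring and let M be a finitely generated unmixed R-module of dimension s ≥ 2. Then M is a Buchsbaum R-module if and only if e_1(Q,M) is constant, independent of the choice of parameter ideal Q for M. In this case, e_1(Q,M) = −Σ_{i=1}^{s−1} C(s−2,i−1)·λ(H^i_m(M)) for every parameter ideal Q for M, where H^i_m(M) denotes the i-th local cohomology module of M with support in m. -/

import Mathlib

universe u

open Finset IsLocalRing CategoryTheory

/-- The length of an `R`-module `M`: the Krull dimension of its lattice of submodules,
i.e. the supremum of the lengths of chains of submodules of `M`. -/
noncomputable def moduleLength (R M : Type*) [CommRing R] [AddCommGroup M] [Module R M] :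
    WithBot ℕ∞ :=
  Order.krullDim (Submodule R M)

/-- `e 0, …, e s` are the Hilbert coefficients of a module `M` relative to an ideal `Q`
(`s` the dimension of `M`): for all large `n`,
`λ(M ⧸ Q^(n+1) M) = ∑_{i=0}^{s} (-1)^i (e i) C(n+s-i, s-i)`. -/
def HasHilbertCoeffsMod {R : Type*} (M : Type*) [CommRing R] [AddCommGroup M] [Module R M]
    (Q : Ideal R) (s : ℕ) (e : ℕ → ℤ) : Prop :=
  ∃ N : ℕ, ∀ n ≥ N, ∃ l : ℕ,
    moduleLength R (M ⧸ (Q ^ (n + 1) • ⊤ : Submodule R M)) = (l : WithBot ℕ∞) ∧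
    (l : ℤ) = ∑ i ∈ Finset.range (s + 1), (-1 : ℤ) ^ i * e i * ((n + s - i).choose (s - i))

/-- A parameter ideal for a module `M` of dimension `s`: an ideal generated by `s` elements
of the maximal ideal with `λ(M/QM) < ∞`. -/
def IsParameterIdealFor {R : Type*} [CommRing R] [IsLocalRing R]
    (M : Type*) [AddCommGroup M] [Module R M] (s : ℕ) (Q : Ideal R) : Prop :=
  (∃ x : Fin s → R, (∀ i, x i ∈ maximalIdeal R) ∧ Q = Ideal.span (Set.range x)) ∧
    ∃ l : ℕ, moduleLength R (M ⧸ (Q • ⊤ : Submodule R M)) = (l : WithBot ℕ∞)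

/-- A finitely generated module `M` of dimension `s` is unmixed if `dim(R̂/p) = s = dim M̂`
for every associated prime `p` of the `m`-adic completion `M̂` of `M` over `R̂`. -/
def IsUnmixedModule (R M : Type*) [CommRing R] [IsLocalRing R] [AddCommGroup M] [Module R M]
    (s : ℕ) : Prop :=
  ∀ p ∈ associatedPrimes (AdicCompletion (maximalIdeal R) R)
      (AdicCompletion (maximalIdeal R) M),
    ringKrullDim (AdicCompletion (maximalIdeal R) R ⧸ p) = (s : WithBot ℕ∞)

/-- A module `M` of dimension `s` is Cohen-Macaulay if its depth equals its dimension,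
equivalently, if there is an `M`-regular sequence of length `s` in the maximal ideal. -/
def IsCohenMacaulayModule (R M : Type*) [CommRing R] [IsLocalRing R] [AddCommGroup M]
    [Module R M] (s : ℕ) : Prop :=
  ∃ rs : List R, (∀ x ∈ rs, x ∈ maximalIdeal R) ∧
    RingTheory.Sequence.IsRegular M rs ∧ rs.length = s

/-- The length of the `i`-th local cohomology module `Hⁱ_m(M)`. -/
noncomputable def localCohomologyLength (R M : Type u) [CommRing R] [IsLocalRing R]
    [AddCommGroup M] [Module R M] (i : ℕ) : WithBot ℕ∞ :=
  moduleLength R ((localCohomology (maximalIdeal R) i).obj (ModuleCat.of R M))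

/-- A finitely generated module `M` of dimension `s` is Buchsbaum if
`λ(M/QM) - e₀(Q,M) = ∑_{i=0}^{s-1} C(s-1,i)·λ(Hⁱ_m(M))` for every parameter ideal `Q`. -/
def IsBuchsbaumModule (R M : Type u) [CommRing R] [IsLocalRing R] [AddCommGroup M]
    [Module R M] (s : ℕ) : Prop :=
  ∀ Q : Ideal R, IsParameterIdealFor M s Q →
    ∃ (e : ℕ → ℤ) (lQ : ℕ) (h : ℕ → ℕ),
      HasHilbertCoeffsMod M Q s e ∧
      moduleLength R (M ⧸ (Q • ⊤ : Submodule R M)) = (lQ : WithBot ℕ∞) ∧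
      (∀ i, i < s → localCohomologyLength R M i = (h i : WithBot ℕ∞)) ∧
      (lQ : ℤ) - e 0 = ∑ i ∈ Finset.range s, ((s - 1).choose i : ℤ) * h i

universe v

set_option linter.unusedSectionVars false
set_option linter.style.haveILetI false

namespace ChernBuchsbaum

section Length

variable {R : Type*} [CommRing R] {M N P : Type*} [AddCommGroup M] [Module R M]
  [AddCommGroup N] [Module R N] [AddCommGroup P] [Module R P]

/-- The length of `(A + B) / A`. -/
noncomputable def relLength (A B : Submodule R M) : ℕ∞ :=
  Module.length R (B.map A.mkQ)

lemma length_range_eq_of_ker_eq {g : M →ₗ[R] N} {g' : M →ₗ[R] P}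
    (h : LinearMap.ker g = LinearMap.ker g') :
    Module.length R (LinearMap.range g) = Module.length R (LinearMap.range g') :=
  (g.quotKerEquivRange.symm.trans
    ((Submodule.quotEquivOfEq _ _ h).trans g'.quotKerEquivRange)).length_eq

lemma relLength_eq_map {A B : Submodule R M} {A' : Submodule R N} (f : M →ₗ[R] N)
    (h : ∀ b ∈ B, b ∈ A ↔ f b ∈ A') : relLength A B = relLength A' (B.map f) := by
  have h1 : B.map A.mkQ = LinearMap.range (A.mkQ ∘ₗ B.subtype) := by
    rw [LinearMap.range_comp, Submodule.range_subtype]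
  have h2 : (B.map f).map A'.mkQ = LinearMap.range (A'.mkQ ∘ₗ f ∘ₗ B.subtype) := by
    rw [LinearMap.range_comp, LinearMap.range_comp, Submodule.range_subtype]
  unfold relLength
  rw [h1, h2]
  apply length_range_eq_of_ker_eq
  ext ⟨b, hb⟩
  simpa using h b hb

lemma relLength_congr {A A' B : Submodule R M} (h : ∀ b ∈ B, b ∈ A ↔ b ∈ A') :
    relLength A B = relLength A' B := by
  have := relLength_eq_map (A := A) (B := B) (A' := A') LinearMap.id (by simpa using h)
  simpa using this

lemma relLength_top (A : Submodule R M) : relLength A ⊤ = Module.length R (M ⧸ A) := by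
  unfold relLength
  rw [Submodule.map_top, Submodule.range_mkQ, Module.length_top]

lemma relLength_bot (A : Submodule R M) : relLength ⊥ A = Module.length R A := by
  have := (LinearEquiv.length_eq
    ((Submodule.equivMapOfInjective (⊥ : Submodule R M).mkQ
      (by rw [← LinearMap.ker_eq_bot, Submodule.ker_mkQ]) A)))
  exact this.symm

lemma relLength_add {A B C : Submodule R M} (hAB : A ≤ B) (hBC : B ≤ C) :
    relLength A C = relLength A B + relLength B C := by
  let i : B.map A.mkQ →ₗ[R] C.map A.mkQ := Submodule.inclusion (Submodule.map_mono hBC)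
  let q : (M ⧸ A) →ₗ[R] (M ⧸ B) := Submodule.factor hAB
  have hq : ∀ x ∈ C.map A.mkQ, q x ∈ C.map B.mkQ := by
    rintro _ ⟨c, hc, rfl⟩
    exact ⟨c, hc, rfl⟩
  let p : C.map A.mkQ →ₗ[R] C.map B.mkQ := q.restrict hq
  refine Module.length_eq_add_of_exact i p (Submodule.inclusion_injective _) ?_ ?_
  · rintro ⟨_, c, hc, rfl⟩
    exact ⟨⟨A.mkQ c, c, hc, rfl⟩, rfl⟩
  · rintro ⟨_, c, hc, rfl⟩
    constructor
    · intro h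
      have h' : q (A.mkQ c) = 0 := congrArg Subtype.val h
      have h2 : c ∈ B := by
        have : B.mkQ c = 0 := h'
        simpa using this
      exact ⟨⟨A.mkQ c, c, h2, rfl⟩, rfl⟩
    · rintro ⟨⟨_, b, hb, rfl⟩, h⟩
      have h' : A.mkQ b = A.mkQ c := congrArg Subtype.val h
      apply Subtype.ext
      change q (A.mkQ c) = 0
      rw [← h']
      change B.mkQ b = 0
      simpa using hb

lemma relLength_self_of_le {A B : Submodule R M} (h : B ≤ A) : relLength A B = 0 := by
  unfold relLength
  have : B.map A.mkQ = ⊥ := by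
    rw [Submodule.eq_bot_iff]
    rintro _ ⟨b, hb, rfl⟩
    simpa using h hb
  rw [this]
  exact Module.length_eq_zero

lemma le_of_relLength_eq_zero {A B : Submodule R M} (h : relLength A B = 0) : B ≤ A := by
  unfold relLength at h
  rw [Module.length_eq_zero_iff] at h
  intro b hb
  have := congrArg Subtype.val (h.elim ⟨A.mkQ b, b, hb, rfl⟩ 0)
  simpa using this

lemma relLength_mono_right {A B C : Submodule R M} (h : B ≤ C) :
    relLength A B ≤ relLength A C :=
  Module.length_le_of_injective (Submodule.inclusion (Submodule.map_mono h))
    (Submodule.inclusion_injective _)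

lemma relLength_anti_left {A B C : Submodule R M} (h : A ≤ B) :
    relLength B C ≤ relLength A C := by
  have hq : ∀ x ∈ C.map A.mkQ, (Submodule.factor h) x ∈ C.map B.mkQ := by
    rintro _ ⟨c, hc, rfl⟩
    exact ⟨c, hc, rfl⟩
  refine Module.length_le_of_surjective ((Submodule.factor h).restrict hq) ?_
  rintro ⟨_, c, hc, rfl⟩
  exact ⟨⟨A.mkQ c, c, hc, rfl⟩, rfl⟩

/-- The length of a module as a natural number (`0` if it is infinite). -/
noncomputable def len (R M : Type*) [CommRing R] [AddCommGroup M] [Module R M] : ℕ :=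
  (Module.length R M).toNat

/-- The length of `(A + B) / A` as a natural number (`0` if it is infinite). -/
noncomputable def relLen (A B : Submodule R M) : ℕ := (relLength A B).toNat

lemma relLen_add {A B C : Submodule R M} (hAB : A ≤ B) (hBC : B ≤ C) (h : relLength A C ≠ ⊤) :
    relLen A C = relLen A B + relLen B C := by
  have h1 := relLength_add hAB hBC
  have h2 : relLength A B ≠ ⊤ := fun h' => h (by rw [h1, h', top_add])
  have h3 : relLength B C ≠ ⊤ := fun h' => h (by rw [h1, h', add_top])
  unfold relLen
  rw [h1, ENat.toNat_add h2 h3]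

lemma len_eq_of_equiv (e : M ≃ₗ[R] N) : len R M = len R N := by
  unfold len
  rw [e.length_eq]

lemma coe_len (h : Module.length R M ≠ ⊤) : ((len R M : ℕ) : ℕ∞) = Module.length R M :=
  ENat.natCast_toNat h

lemma len_le_of_injective (f : M →ₗ[R] N) (hf : Function.Injective f)
    (h : Module.length R N ≠ ⊤) : len R M ≤ len R N :=
  ENat.toNat_le_toNat (Module.length_le_of_injective f hf) h

lemma length_ne_top_of_injective (f : M →ₗ[R] N) (hf : Function.Injective f)
    (h : Module.length R N ≠ ⊤) : Module.length R M ≠ ⊤ :=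
  ne_top_of_le_ne_top h (Module.length_le_of_injective f hf)

lemma length_ne_top_of_surjective (f : M →ₗ[R] N) (hf : Function.Surjective f)
    (h : Module.length R M ≠ ⊤) : Module.length R N ≠ ⊤ :=
  ne_top_of_le_ne_top h (Module.length_le_of_surjective f hf)

lemma len_add_of_exact (f : M →ₗ[R] N) (g : N →ₗ[R] P) (hf : Function.Injective f)
    (hg : Function.Surjective g) (hfg : Function.Exact f g) (h : Module.length R N ≠ ⊤) :
    len R N = len R M + len R P := by
  have h1 := Module.length_eq_add_of_exact f g hf hg hfg
  unfold len
  rw [h1, ENat.toNat_add (length_ne_top_of_injective f hf h) (length_ne_top_of_surjective g hg h)]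

end Length

section EventuallyPolynomial

/-- `f n = ∑_{i < s} c i * C(n + i, i)` for all large `n`. -/
def HasCoeff (s : ℕ) (f c : ℕ → ℤ) : Prop :=
  ∀ᶠ n in Filter.atTop, f n = ∑ i ∈ range s, c i * ((n + i).choose i : ℤ)

/-- The `s`-th backward difference of `f` vanishes for all large arguments. -/
def EvPoly : ℕ → (ℕ → ℤ) → Prop
  | 0, f => ∀ᶠ n in Filter.atTop, f n = 0
  | s + 1, f => EvPoly s (fun n => f n - f (n - 1))

lemma eventually_pred {p : ℕ → Prop} (h : ∀ᶠ n in Filter.atTop, p n) :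
    ∀ᶠ n in Filter.atTop, p (n - 1) := by
  rw [Filter.eventually_atTop] at h ⊢
  obtain ⟨N, hN⟩ := h
  exact ⟨N + 1, fun n hn => hN _ (by omega)⟩

lemma EvPoly.congr {s : ℕ} {f g : ℕ → ℤ} (hf : EvPoly s f)
    (h : ∀ᶠ n in Filter.atTop, f n = g n) : EvPoly s g := by
  induction s generalizing f g with
  | zero =>
    unfold EvPoly at hf ⊢
    filter_upwards [hf, h] with n h1 h2
    rw [← h2, h1]
  | succ s ih =>
    refine ih (f := fun n => f n - f (n - 1)) hf ?_
    filter_upwards [h, eventually_pred h] with n h1 h2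
    rw [h1, h2]

lemma EvPoly.sub {s : ℕ} {f g : ℕ → ℤ} (hf : EvPoly s f) (hg : EvPoly s g) :
    EvPoly s (fun n => f n - g n) := by
  induction s generalizing f g with
  | zero =>
    unfold EvPoly at hf hg ⊢
    filter_upwards [hf, hg] with n h1 h2
    rw [h1, h2, sub_zero]
  | succ s ih =>
    have := ih (f := fun n => f n - f (n - 1)) (g := fun n => g n - g (n - 1)) hf hg
    exact this.congr (Filter.Eventually.of_forall fun n => by ring)

lemma EvPoly.pred {s : ℕ} {f : ℕ → ℤ} (hf : EvPoly s f) : EvPoly s (fun n => f (n - 1)) := by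
  induction s generalizing f with
  | zero => exact eventually_pred hf
  | succ s ih => exact ih (f := fun n => f n - f (n - 1)) hf

lemma HasCoeff.congr {s : ℕ} {f g c : ℕ → ℤ} (hf : HasCoeff s f c)
    (h : ∀ᶠ n in Filter.atTop, f n = g n) : HasCoeff s g c := by
  unfold HasCoeff at *
  filter_upwards [hf, h] with n h1 h2
  rw [← h2, h1]

lemma HasCoeff.sub {s : ℕ} {f g c d : ℕ → ℤ} (hf : HasCoeff s f c) (hg : HasCoeff s g d) :
    HasCoeff s (fun n => f n - g n) (fun i => c i - d i) := by
  unfold HasCoeff at *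
  filter_upwards [hf, hg] with n h1 h2
  rw [h1, h2, ← sum_sub_distrib]
  exact sum_congr rfl fun i _ => by ring

lemma choose_sub_choose_pred {n i : ℕ} (hn : 1 ≤ n) :
    (((n + (i + 1)).choose (i + 1) : ℕ) : ℤ) - ((n - 1 + (i + 1)).choose (i + 1) : ℕ) =
      ((n + i).choose i : ℕ) := by
  obtain ⟨m, rfl⟩ : ∃ m, n = m + 1 := ⟨n - 1, by omega⟩
  rw [show m + 1 + (i + 1) = (m + 1 + i) + 1 by ring, Nat.choose_succ_succ,
    show m + 1 - 1 + (i + 1) = m + 1 + i by omega]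
  push_cast
  ring

lemma HasCoeff.backwardDiff {s : ℕ} {f c : ℕ → ℤ} (hf : HasCoeff (s + 1) f c) :
    HasCoeff s (fun n => f n - f (n - 1)) (fun i => c (i + 1)) := by
  unfold HasCoeff at *
  filter_upwards [hf, eventually_pred hf, Filter.eventually_ge_atTop 1] with n h1 h2 hn
  rw [h1, h2, ← sum_sub_distrib, sum_range_succ']
  simp only [Nat.choose_zero_right, sub_self, add_zero]
  refine sum_congr rfl fun i _ => ?_
  linear_combination c (i + 1) * choose_sub_choose_pred (i := i) hn

lemma HasCoeff.eq_zero {s : ℕ} {f c : ℕ → ℤ} (h : HasCoeff s f c)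
    (hf : ∀ᶠ n in Filter.atTop, f n = 0) : ∀ i < s, c i = 0 := by
  induction s generalizing f c with
  | zero => intro i hi; omega
  | succ s ih =>
    have h1 := ih h.backwardDiff (by
      filter_upwards [hf, eventually_pred hf] with n h1 h2
      rw [h1, h2, sub_zero])
    intro i hi
    rcases i with _ | i
    · obtain ⟨n, hn, hn'⟩ := (h.and hf).exists
      rw [hn', sum_range_succ', sum_eq_zero] at hn
      · simpa using hn.symm
      · intro i hi
        rw [h1 i (mem_range.mp hi), zero_mul]
    · exact h1 i (by omega)

lemma HasCoeff.unique {s : ℕ} {f c d : ℕ → ℤ} (hc : HasCoeff s f c) (hd : HasCoeff s f d) :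
    ∀ i < s, c i = d i := by
  intro i hi
  have := (hc.sub hd).eq_zero (Filter.Eventually.of_forall fun n => sub_self _) i hi
  linarith

lemma EvPoly.exists_coeff {s : ℕ} {f : ℕ → ℤ} (hf : EvPoly s f) : ∃ c, HasCoeff s f c := by
  induction s generalizing f with
  | zero =>
    refine ⟨0, ?_⟩
    unfold HasCoeff
    unfold EvPoly at hf
    simpa only [range_zero, sum_empty] using hf
  | succ s ih =>
    obtain ⟨d, hd⟩ := ih (f := fun n => f n - f (n - 1)) hf
    obtain ⟨N, hN⟩ := Filter.eventually_atTop.mp hd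
    let g : ℕ → ℤ := fun n => f n - ∑ i ∈ range s, d i * ((n + (i + 1)).choose (i + 1) : ℕ)
    have hg : ∀ n ≥ N, g (n + 1) = g n := by
      intro n hn
      have h1 := hN (n + 1) (by omega)
      have h2 : ∑ i ∈ range s, d i * ((n + 1 + i).choose i : ℤ) =
          ∑ i ∈ range s, d i * ((n + 1 + (i + 1)).choose (i + 1) : ℕ) -
            ∑ i ∈ range s, d i * ((n + (i + 1)).choose (i + 1) : ℕ) := by
        rw [← sum_sub_distrib]
        refine sum_congr rfl fun i _ => ?_
        rw [← choose_sub_choose_pred (n := n + 1) (by omega)]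
        simp only [Nat.add_sub_cancel]
        ring
      simp only [Nat.add_sub_cancel] at h1
      simp only [g]
      linarith
    have hg' : ∀ n ≥ N, g n = g N := by
      intro n hn
      induction n, hn using Nat.le_induction with
      | base => rfl
      | succ n hn ih => rw [hg n hn, ih]
    refine ⟨fun i => Nat.casesOn i (g N) d, ?_⟩
    unfold HasCoeff
    filter_upwards [Filter.eventually_ge_atTop N] with n hn
    rw [sum_range_succ']
    have := hg' n hn
    simp only [g] at this ⊢
    simp only [Nat.choose_zero_right, Nat.cast_one, mul_one]
    rw [← this]
    exact (add_sub_cancel _ _).symm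

lemma HasCoeff.top_eq_zero {s : ℕ} {f c : ℕ → ℤ} (h : HasCoeff (s + 1) f c) (hf : EvPoly s f) :
    c s = 0 := by
  induction s generalizing f c with
  | zero => exact h.eq_zero hf 0 (by omega)
  | succ s ih => exact ih h.backwardDiff hf

lemma HasCoeff.of_top_eq_zero {s : ℕ} {f c : ℕ → ℤ} (h : HasCoeff (s + 1) f c) (hc : c s = 0) :
    HasCoeff s f c := by
  unfold HasCoeff at *
  filter_upwards [h] with n hn
  rw [hn, sum_range_succ, hc, zero_mul, add_zero]

lemma HasCoeff.eventually_neg {s : ℕ} {f c : ℕ → ℤ} (h : HasCoeff (s + 1) f c) (hc : c s < 0) :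
    ∀ᶠ n in Filter.atTop, f n < 0 := by
  induction s generalizing f c with
  | zero =>
    filter_upwards [h] with n hn
    rw [hn]
    simpa using hc
  | succ s ih =>
    obtain ⟨N, hN⟩ := Filter.eventually_atTop.mp (ih h.backwardDiff hc)
    have h2 : ∀ k : ℕ, f (N + k) ≤ f N - k := by
      intro k
      induction k with
      | zero => simp
      | succ k ihk =>
        have := hN (N + k + 1) (by omega)
        simp only [Nat.add_sub_cancel] at this
        push_cast
        rw [← add_assoc]
        linarith
    rw [Filter.eventually_atTop]
    refine ⟨N + (f N).toNat + 1, fun n hn => ?_⟩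
    obtain ⟨k, rfl⟩ := Nat.exists_eq_add_of_le (show N ≤ n by omega)
    have := h2 k
    have h3 := Int.self_le_toNat (f N)
    omega

/-- The leading coefficient of an eventually nonnegative function is nonnegative. -/
lemma HasCoeff.top_nonneg {s : ℕ} {f c : ℕ → ℤ} (h : HasCoeff (s + 1) f c)
    (hf : ∀ᶠ n in Filter.atTop, 0 ≤ f n) : 0 ≤ c s := by
  by_contra! hneg
  obtain ⟨n, h1, h2⟩ := ((h.eventually_neg hneg).and hf).exists
  omega

end EventuallyPolynomial

section Filtration

variable {R : Type*} [CommRing R] {M : Type*} [AddCommGroup M] [Module R M] {I : Ideal R}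

lemma relLength_sup (A B : Submodule R M) : relLength A (A ⊔ B) = relLength A B := by
  unfold relLength
  have : A.map A.mkQ = ⊥ := by
    rw [Submodule.eq_bot_iff]
    rintro _ ⟨b, hb, rfl⟩
    simpa using hb
  rw [Submodule.map_sup, this, bot_sup_eq]

/-- The filtration `n ↦ {u ∈ F n | y u ∈ F' (n + 1)}`. -/
def colonFiltration (F F' : I.Filtration M) (y : R) : I.Filtration M where
  N n := F.N n ⊓ (F'.N (n + 1)).comap (LinearMap.lsmul R M y)
  mono n := inf_le_inf (F.mono n) (Submodule.comap_mono (F'.mono (n + 1)))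
  smul_le n := by
    refine le_inf ((smul_mono_right _ inf_le_left).trans (F.smul_le n)) ?_
    rw [Submodule.smul_le]
    intro r hr u hu
    have h := F'.smul_le (n + 1) (Submodule.smul_mem_smul hr hu.2)
    simpa [smul_comm r y u] using h

/-- The filtration `n ↦ F' n + y F (n - 1)`. -/
def sumFiltration (F F' : I.Filtration M) (y : R) : I.Filtration M where
  N n := F'.N n ⊔ (F.N (n - 1)).map (LinearMap.lsmul R M y)
  mono n := sup_le_sup (F'.mono _) (Submodule.map_mono (F.antitone (by omega)))
  smul_le n := by
    rw [Submodule.smul_sup, ← Submodule.map_smul'']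
    refine sup_le_sup (F'.smul_le _) (Submodule.map_mono ?_)
    rcases n with _ | n
    · exact Submodule.smul_le_right
    · exact F.smul_le n

/-- Hilbert's theorem for the quotients of two stable filtrations: if `J` and `l` generate `I` and
`J F n ≤ F' (n + 1)`, then the length of `F n / F' n` is eventually polynomial
of degree less than the number of elements of `l`. -/
theorem evPoly_relLen_filtration [IsNoetherianRing R] [Module.Finite R M] (l : List R) :
    ∀ (J : Ideal R) (F F' : I.Filtration M), F.Stable → F' ≤ F → (∀ y ∈ l, y ∈ I) →
      I ≤ J ⊔ Ideal.ofList l → (∀ n, J • F.N n ≤ F'.N (n + 1)) →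
      (∀ n, relLength (F'.N n) (F.N n) ≠ ⊤) →
      EvPoly l.length (fun n => (relLen (F'.N n) (F.N n) : ℤ)) := by
  induction l with
  | nil =>
    intro J F F' hF hle _ hI hJ _
    obtain ⟨n₀, h₀⟩ := hF
    refine Filter.eventually_atTop.mpr ⟨n₀ + 1, fun n hn => ?_⟩
    obtain ⟨k, rfl⟩ : ∃ k, n = k + 1 := ⟨n - 1, by omega⟩
    have h1 : F.N (k + 1) ≤ F'.N (k + 1) := by
      rw [← h₀ k (by omega)]
      refine (Submodule.smul_mono_left ?_).trans (hJ k)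
      simpa using hI
    simp [relLen, relLength_self_of_le h1]
  | cons y l ih =>
    intro J F F' hF hle hl hI hJ hfin
    have hy : y ∈ I := hl y (by simp)
    have hl' : ∀ z ∈ l, z ∈ I := fun z hz => hl z (by simp [hz])
    have hFle : ∀ n, F'.N n ≤ F.N n := hle
    have hyF : ∀ n, (F.N n).map (LinearMap.lsmul R M y) ≤ F.N (n + 1) := by
      rintro n _ ⟨u, hu, rfl⟩
      exact F.smul_le n (Submodule.smul_mem_smul hy hu)
    have hyF' : ∀ n, (F.N (n - 1)).map (LinearMap.lsmul R M y) ≤ F.N n := by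
      rintro (_ | n)
      · exact (hyF 0).trans (F.mono 0)
      · exact hyF n
    have hI' : I ≤ (J ⊔ Ideal.span {y}) ⊔ Ideal.ofList l := by
      rw [sup_assoc, ← Ideal.ofList_cons]
      exact hI
    let K := colonFiltration F F' y
    let S := sumFiltration F F' y
    have hKF : K ≤ F := fun n => inf_le_left
    have hF'K : F' ≤ K := fun n => le_inf (hFle n) (by
      intro u hu
      exact F'.smul_le n (Submodule.smul_mem_smul hy hu))
    have hF'S : F' ≤ S := fun n => le_sup_left
    have hSF : S ≤ F := fun n => sup_le (hFle n) (hyF' n)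
    have hdead : ∀ (G G' : I.Filtration M), (∀ n, J • G.N n ≤ G'.N (n + 1)) →
        (∀ n, (G.N n).map (LinearMap.lsmul R M y) ≤ G'.N (n + 1)) →
        ∀ n, (J ⊔ Ideal.span {y}) • G.N n ≤ G'.N (n + 1) := by
      intro G G' h1 h2 n
      rw [Submodule.sup_smul]
      refine sup_le (h1 n) ?_
      rw [Submodule.ideal_span_singleton_smul]
      exact h2 n
    have finK : ∀ n, relLength (F'.N n) (K.N n) ≠ ⊤ := fun n =>
      ne_top_of_le_ne_top (hfin n) (relLength_mono_right (hKF n))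
    have finS : ∀ n, relLength (S.N n) (F.N n) ≠ ⊤ := fun n =>
      ne_top_of_le_ne_top (hfin n) (relLength_anti_left (hF'S n))
    have e1 := ih (J ⊔ Ideal.span {y}) K F' (hF.of_le hKF) hF'K hl' hI'
      (hdead K F' (fun n => (smul_mono_right _ (hKF n)).trans (hJ n)) (by
        rintro n _ ⟨u, hu, rfl⟩
        exact hu.2)) finK
    have e2 := ih (J ⊔ Ideal.span {y}) F S hF hSF hl' hI'
      (hdead F S (fun n => (hJ n).trans (hF'S (n + 1))) (fun n => le_sup_right)) finS
    have e3 := EvPoly.pred (f := fun n => (relLen (F'.N n) (K.N n) : ℤ)) e1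
    have e4 := EvPoly.sub (f := fun n => (relLen (S.N n) (F.N n) : ℤ))
      (g := fun n => (relLen (F'.N (n - 1)) (K.N (n - 1)) : ℤ)) e2 e3
    refine EvPoly.congr (s := l.length) e4 ?_
    filter_upwards [Filter.eventually_ge_atTop 1] with n hn
    obtain ⟨n, rfl⟩ : ∃ k, n = k + 1 := ⟨n - 1, by omega⟩
    simp only [Nat.add_sub_cancel]
    have h1 := relLen_add (hF'S (n + 1)) (hSF (n + 1)) (hfin (n + 1))
    have h2 := relLen_add (hF'K n) (hKF n) (hfin n)
    have h3 : relLen (K.N n) (F.N n) = relLen (F'.N (n + 1)) (S.N (n + 1)) := by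
      unfold relLen
      congr 1
      change _ = relLength (F'.N (n + 1)) (F'.N (n + 1) ⊔ (F.N n).map (LinearMap.lsmul R M y))
      rw [relLength_sup]
      apply relLength_eq_map
      intro b hb
      exact ⟨fun h => h.2, fun h => ⟨hb, h⟩⟩
    rw [h1, h2, h3]
    push_cast
    ring

end Filtration

section HilbertFunction

variable {R : Type*} [CommRing R] {M N : Type*} [AddCommGroup M] [Module R M]
  [AddCommGroup N] [Module R N]

lemma length_quotient_smul_of_surjective (Q : Ideal R) (f : M →ₗ[R] N)
    (hf : Function.Surjective f) :
    Module.length R (N ⧸ (Q • ⊤ : Submodule R N)) =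
      Module.length R (M ⧸ ((Q • ⊤ : Submodule R M) ⊔ LinearMap.ker f)) := by
  rw [← relLength_top, ← relLength_top]
  have h1 : (⊤ : Submodule R M).map f = ⊤ := by
    rw [Submodule.map_top, LinearMap.range_eq_top.mpr hf]
  have h2 : (Q • ⊤ : Submodule R M) ⊔ LinearMap.ker f = (Q • ⊤ : Submodule R N).comap f := by
    rw [← Submodule.comap_map_eq, Submodule.map_smul'', h1]
  have := relLength_eq_map (A := (Q • ⊤ : Submodule R M) ⊔ LinearMap.ker f) (B := ⊤)
    (A' := (Q • ⊤ : Submodule R N)) f (by intro b _; rw [h2]; rfl)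
  rw [this, h1]

lemma length_ne_top_of_pow_smul_top_eq_bot [IsNoetherianRing R] [IsLocalRing R]
    [Module.Finite R M] {k : ℕ}
    (h : (maximalIdeal R ^ k • ⊤ : Submodule R M) = ⊥) : Module.length R M ≠ ⊤ := by
  have key : ∀ k, Module.length R (M ⧸ (maximalIdeal R ^ k • ⊤ : Submodule R M)) ≠ ⊤ := by
    intro k
    induction k with
    | zero =>
      have : Subsingleton (M ⧸ (maximalIdeal R ^ 0 • ⊤ : Submodule R M)) := by
        rw [Submodule.Quotient.subsingleton_iff]
        simp
      rw [Module.length_eq_zero]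
      simp
    | succ k ih =>
      have hle : (maximalIdeal R ^ (k + 1) • ⊤ : Submodule R M) ≤ maximalIdeal R ^ k • ⊤ :=
        Submodule.smul_mono_left (Ideal.pow_le_pow_right (Nat.le_succ k))
      rw [← relLength_top, relLength_add hle le_top, relLength_top]
      refine WithTop.add_ne_top.mpr ⟨?_, ih⟩
      set B := (maximalIdeal R ^ k • ⊤ : Submodule R M)
      set V := B.map (Submodule.mkQ (maximalIdeal R ^ (k + 1) • ⊤ : Submodule R M))
      have hV : Module.IsTorsionBySet R V (maximalIdeal R) := by
        rintro ⟨_, b, hb, rfl⟩ ⟨r, hr⟩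
        apply Subtype.ext
        change r • Submodule.mkQ _ b = 0
        rw [← map_smul]
        simp only [Submodule.mkQ_apply, Submodule.Quotient.mk_eq_zero]
        rw [pow_succ', Submodule.mul_smul]
        exact Submodule.smul_mem_smul hr hb
      let _ : Module (R ⧸ maximalIdeal R) V := hV.module
      have : IsScalarTower R (R ⧸ maximalIdeal R) V := hV.isScalarTower
      let _ : Field (R ⧸ maximalIdeal R) := Ideal.Quotient.field _
      have : Module.Finite (R ⧸ maximalIdeal R) V := Module.Finite.of_restrictScalars_finite R _ _
      have hfin : IsArtinian R V := by
        have : IsArtinian (R ⧸ maximalIdeal R) V := inferInstance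
        let g : V →ₛₗ[Ideal.Quotient.mk (maximalIdeal R)] V :=
          { toFun := id
            map_add' := fun _ _ => rfl
            map_smul' := fun _ _ => rfl }
        exact (LinearMap.isArtinian_iff_of_bijective g Function.bijective_id).mpr this
      change Module.length R V ≠ ⊤
      exact Module.length_ne_top_iff.mpr (isFiniteLength_iff_isNoetherian_isArtinian.mpr
        ⟨inferInstance, hfin⟩)
  have := key k
  rw [h] at this
  rwa [(Submodule.quotEquivOfEqBot (⊥ : Submodule R M) rfl).length_eq] at this

lemma exists_pow_smul_top_eq_bot [IsNoetherianRing R] [IsLocalRing R]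
    (h : Module.length R M ≠ ⊤) : ∃ k, (maximalIdeal R ^ k • ⊤ : Submodule R M) = ⊥ := by
  obtain ⟨h1, h2⟩ := isFiniteLength_iff_isNoetherian_isArtinian.mp (Module.length_ne_top_iff.mp h)
  obtain ⟨k, hk⟩ := IsArtinian.monotone_stabilizes (R := R) (M := M)
    ⟨fun k => OrderDual.toDual (maximalIdeal R ^ k • ⊤ : Submodule R M), fun a b hab =>
      Submodule.smul_mono_left (Ideal.pow_le_pow_right hab)⟩
  refine ⟨k, ?_⟩
  have h3 := hk (k + 1) (Nat.le_succ k)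
  change (maximalIdeal R ^ k • ⊤ : Submodule R M) = maximalIdeal R ^ (k + 1) • ⊤ at h3
  refine Submodule.eq_bot_of_le_smul_of_le_jacobson_bot (maximalIdeal R) _ (IsNoetherian.noetherian _)
    ?_ (IsLocalRing.maximalIdeal_le_jacobson _)
  rw [← Submodule.mul_smul, ← pow_succ']
  exact h3.le

end HilbertFunction

section Parameter

variable {R : Type*} [CommRing R] [IsLocalRing R] {M N : Type*} [AddCommGroup M] [Module R M]
  [AddCommGroup N] [Module R N]

/-- `Q` acts on `M` as an ideal generated by `s` elements of `Q`, and `M ⧸ Q M` is killed by a power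
of the maximal ideal. -/
structure Par (s : ℕ) (Q : Ideal R) (M : Type*) [AddCommGroup M] [Module R M] : Prop where
  le : Q ≤ maximalIdeal R
  pow : ∃ a, (maximalIdeal R ^ a • ⊤ : Submodule R M) ≤ Q • ⊤
  gen : ∃ l : List R, l.length = s ∧ (∀ y ∈ l, y ∈ Q) ∧
    (Q • ⊤ : Submodule R M) ≤ Ideal.ofList l • ⊤

/-- The function `n ↦ λ(M ⧸ Q ^ (n + 1) M)`. -/
noncomputable def hilb (Q : Ideal R) (M : Type*) [AddCommGroup M] [Module R M] (n : ℕ) : ℤ :=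
  len R (M ⧸ (Q ^ (n + 1) • ⊤ : Submodule R M))

open Classical in
/-- The coefficients of the Hilbert polynomial of `M` with respect to `Q` in the basis of the
binomials `C(n+i, i)`. -/
noncomputable def coeff (s : ℕ) (Q : Ideal R) (M : Type*) [AddCommGroup M] [Module R M] : ℕ → ℤ :=
  if h : ∃ c, HasCoeff (s + 1) (hilb Q M) c then h.choose else 0

lemma smul_top_mono {I J : Ideal R} (h : I ≤ J) : (I • ⊤ : Submodule R M) ≤ J • ⊤ :=
  Submodule.smul_mono_left h

lemma ofList_le {l : List R} {Q : Ideal R} (h : ∀ y ∈ l, y ∈ Q) : Ideal.ofList l ≤ Q :=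
  Ideal.span_le.mpr h

lemma pow_smul_top_le {I Q : Ideal R} (h : (Q • ⊤ : Submodule R M) ≤ I • ⊤) (n : ℕ) :
    (Q ^ n • ⊤ : Submodule R M) ≤ I ^ n • ⊤ := by
  induction n with
  | zero => simp
  | succ n ih =>
    rw [pow_succ', Submodule.mul_smul, pow_succ, Submodule.mul_smul]
    calc Q • (Q ^ n • ⊤ : Submodule R M) ≤ Q • (I ^ n • ⊤ : Submodule R M) :=
          smul_mono_right _ ih
      _ = I ^ n • (Q • ⊤ : Submodule R M) := by
        rw [← Submodule.mul_smul, mul_comm, Submodule.mul_smul]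
      _ ≤ I ^ n • (I • ⊤ : Submodule R M) := smul_mono_right _ h

lemma pow_smul_top_eq {I Q : Ideal R} (h : (Q • ⊤ : Submodule R M) = I • ⊤) (n : ℕ) :
    (Q ^ n • ⊤ : Submodule R M) = I ^ n • ⊤ :=
  le_antisymm (pow_smul_top_le h.le n) (pow_smul_top_le h.ge n)

lemma map_smul_top_of_surjective (Q : Ideal R) (f : M →ₗ[R] N) (hf : Function.Surjective f) :
    (Q • ⊤ : Submodule R M).map f = Q • ⊤ := by
  rw [Submodule.map_smul'', Submodule.map_top, LinearMap.range_eq_top.mpr hf]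

lemma comap_smul_top_of_surjective (Q : Ideal R) (f : M →ₗ[R] N) (hf : Function.Surjective f) :
    (Q • ⊤ : Submodule R N).comap f = Q • ⊤ ⊔ LinearMap.ker f := by
  rw [← map_smul_top_of_surjective Q f hf, Submodule.comap_map_eq]

lemma smul_top_le_of_surjective {I J : Ideal R} (f : M →ₗ[R] N) (hf : Function.Surjective f)
    (h : (I • ⊤ : Submodule R M) ≤ J • ⊤) : (I • ⊤ : Submodule R N) ≤ J • ⊤ := by
  rw [← map_smul_top_of_surjective I f hf, ← map_smul_top_of_surjective J f hf]
  exact Submodule.map_mono h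

lemma Par.of_surjective {s : ℕ} {Q : Ideal R} (h : Par s Q M) (f : M →ₗ[R] N)
    (hf : Function.Surjective f) : Par s Q N := by
  obtain ⟨h1, ⟨a, ha⟩, l, hl, hlQ, hle⟩ := h
  exact ⟨h1, ⟨a, smul_top_le_of_surjective f hf ha⟩, l, hl, hlQ,
    smul_top_le_of_surjective f hf hle⟩

/-- If `M ⧸ x M` has parameter ideal `Q` with `s` generators and `x ∈ Q`, then `M` has parameter
ideal `Q` with `s + 1` generators. -/
lemma Par.of_quotient {s : ℕ} {Q : Ideal R} {x : R} (hx : x ∈ Q) (f : M →ₗ[R] N)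
    (hf : Function.Surjective f) (hker : LinearMap.ker f = LinearMap.range (LinearMap.lsmul R M x))
    (h : Par s Q N) : Par (s + 1) Q M := by
  obtain ⟨h1, ⟨a, ha⟩, l, hl, hlQ, hle⟩ := h
  have hk : LinearMap.ker f ≤ (Ideal.span {x} • ⊤ : Submodule R M) := by
    rw [hker, Submodule.ideal_span_singleton_smul]
    rintro _ ⟨u, rfl⟩
    exact ⟨u, trivial, rfl⟩
  refine ⟨h1, ⟨a, ?_⟩, x :: l, by simp [hl], by simpa [hx] using hlQ, ?_⟩
  · have := Submodule.comap_mono (f := f) ha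
    rw [comap_smul_top_of_surjective _ f hf, comap_smul_top_of_surjective _ f hf] at this
    refine (le_sup_left.trans this).trans (sup_le le_rfl (hk.trans (smul_top_mono ?_)))
    simpa [Ideal.span_le] using hx
  · have := Submodule.comap_mono (f := f) hle
    rw [comap_smul_top_of_surjective _ f hf, comap_smul_top_of_surjective _ f hf] at this
    rw [Ideal.ofList_cons, Submodule.sup_smul]
    exact (le_sup_left.trans this).trans (sup_le le_sup_right (hk.trans le_sup_left))

variable [IsNoetherianRing R] [Module.Finite R M] [Module.Finite R N]

lemma Par.length_ne_top {s : ℕ} {Q : Ideal R} (h : Par s Q M) (n : ℕ) :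
    Module.length R (M ⧸ (Q ^ n • ⊤ : Submodule R M)) ≠ ⊤ := by
  obtain ⟨a, ha⟩ := h.pow
  apply length_ne_top_of_pow_smul_top_eq_bot (k := a * n)
  rw [← map_smul_top_of_surjective _ (Submodule.mkQ _) (Submodule.mkQ_surjective _),
    eq_bot_iff, Submodule.map_le_iff_le_comap]
  rw [pow_mul]
  refine (pow_smul_top_le ha n).trans fun u hu => ?_
  simpa using hu

lemma Par.relLength_ne_top {s : ℕ} {Q : Ideal R} (h : Par s Q M) (n : ℕ) {A B : Submodule R M}
    (hA : (Q ^ n • ⊤ : Submodule R M) ≤ A) : relLength A B ≠ ⊤ := by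
  refine ne_top_of_le_ne_top (h.length_ne_top n) ?_
  rw [← relLength_top]
  exact (relLength_anti_left hA).trans (relLength_mono_right le_top)

lemma len_quotient_eq_relLen (A : Submodule R M) : len R (M ⧸ A) = relLen A ⊤ := by
  unfold len relLen
  rw [relLength_top]

lemma Par.relLen_eq_sub {s : ℕ} {Q : Ideal R} (h : Par s Q M) (n : ℕ) {A B : Submodule R M}
    (hA : (Q ^ n • ⊤ : Submodule R M) ≤ A) (hB : A ≤ B) :
    (relLen A B : ℤ) = len R (M ⧸ A) - len R (M ⧸ B) := by
  have h1 := relLen_add hB le_top (h.relLength_ne_top n hA)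
  rw [len_quotient_eq_relLen, len_quotient_eq_relLen, h1]
  push_cast
  ring

lemma Par.hasCoeff_coeff {s : ℕ} {Q : Ideal R} (h : Par s Q M) :
    HasCoeff (s + 1) (hilb Q M) (coeff s Q M) := by
  have hex : ∃ c, HasCoeff (s + 1) (hilb Q M) c := by
    obtain ⟨l, hl, hlQ, hle⟩ := h.gen
    set I := Ideal.ofList l with hI
    have hpow : ∀ n, (I ^ n • ⊤ : Submodule R M) = Q ^ n • ⊤ :=
      pow_smul_top_eq (le_antisymm (smul_top_mono (ofList_le hlQ)) hle)
    let F := I.stableFiltration (⊤ : Submodule R M)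
    let F' := I.stableFiltration (I • ⊤ : Submodule R M)
    have hF' : ∀ n, F'.N n = Q ^ (n + 1) • ⊤ := by
      intro n
      rw [← hpow, pow_succ, Submodule.mul_smul]
      rfl
    have hF : ∀ n, F.N n = Q ^ n • ⊤ := fun n => (hpow n)
    have key := evPoly_relLen_filtration l ⊥ F F' (I.stableFiltration_stable ⊤)
      (fun n => smul_mono_right _ le_top) (fun y hy => Ideal.subset_span hy) (by simp [hI])
      (by simp) (fun n => h.relLength_ne_top (n + 1) (hF' n).ge)
    rw [hl] at key
    refine EvPoly.exists_coeff ?_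
    refine EvPoly.congr (s := s) key ?_
    filter_upwards [Filter.eventually_ge_atTop 1] with n hn
    rw [h.relLen_eq_sub (n + 1) (hF' n).ge (B := F.N n) (smul_mono_right _ le_top), hF', hF]
    unfold hilb
    rw [show n - 1 + 1 = n by omega]
  unfold coeff
  rw [dif_pos hex]
  exact hex.choose_spec

end Parameter

section Comparison

variable {R : Type*} [CommRing R] [IsLocalRing R] [IsNoetherianRing R]
  {M N : Type*} [AddCommGroup M] [Module R M]
  [AddCommGroup N] [Module R N] [Module.Finite R M] [Module.Finite R N]

lemma len_quotient_of_surjective (Q : Ideal R) (f : M →ₗ[R] N) (hf : Function.Surjective f) :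
    len R (N ⧸ (Q • ⊤ : Submodule R N)) =
      len R (M ⧸ ((Q • ⊤ : Submodule R M) ⊔ LinearMap.ker f)) := by
  unfold len
  rw [length_quotient_smul_of_surjective Q f hf]

lemma exists_pow_smul_eq_bot_of_length_ne_top {T : Submodule R M} (h : Module.length R T ≠ ⊤) :
    ∃ k, maximalIdeal R ^ k • T = ⊥ := by
  obtain ⟨k, hk⟩ := exists_pow_smul_top_eq_bot h
  refine ⟨k, ?_⟩
  have := congrArg (Submodule.map T.subtype) hk
  rwa [Submodule.map_smul'', Submodule.map_top, Submodule.range_subtype, Submodule.map_bot] at this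

lemma eventually_pow_smul_top_inf_eq_bot {T : Submodule R M} (h : Module.length R T ≠ ⊤)
    {Q : Ideal R} (hQ : Q ≤ maximalIdeal R) :
    ∀ᶠ n in Filter.atTop, (Q ^ n • ⊤ : Submodule R M) ⊓ T = ⊥ := by
  obtain ⟨k, hk⟩ := exists_pow_smul_eq_bot_of_length_ne_top h
  obtain ⟨c, hc⟩ := Ideal.exists_pow_inf_eq_pow_smul Q T
  filter_upwards [Filter.eventually_ge_atTop (c + k)] with n hn
  rw [hc n (by omega), eq_bot_iff, ← hk]
  calc Q ^ (n - c) • ((Q ^ c • ⊤ : Submodule R M) ⊓ T) ≤ Q ^ (n - c) • T :=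
        smul_mono_right _ inf_le_right
    _ ≤ maximalIdeal R ^ k • T := Submodule.smul_mono_left
        ((Ideal.pow_right_mono hQ _).trans (Ideal.pow_le_pow_right (by omega)))

/-- Dividing out a submodule of finite length only changes the constant coefficient of the Hilbert
polynomial. -/
lemma Par.coeff_of_ker {s : ℕ} {Q : Ideal R} (h : Par s Q M) (f : M →ₗ[R] N)
    (hf : Function.Surjective f) (hT : Module.length R (LinearMap.ker f) ≠ ⊤) :
    ∀ j ≤ s, coeff s Q M j = coeff s Q N j + if j = 0 then (len R (LinearMap.ker f) : ℤ) else 0 := by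
  have hN := (h.of_surjective f hf).hasCoeff_coeff
  have key : ∀ᶠ n in Filter.atTop, hilb Q N n = hilb Q M n - len R (LinearMap.ker f) := by
    filter_upwards [(Filter.tendsto_add_atTop_nat 1).eventually
      (eventually_pow_smul_top_inf_eq_bot hT h.le)] with n hdis
    unfold hilb
    have h1 := h.relLen_eq_sub (n + 1) le_rfl
      (le_sup_left (a := (Q ^ (n + 1) • ⊤ : Submodule R M)) (b := LinearMap.ker f))
    have h2 : relLen (Q ^ (n + 1) • ⊤ : Submodule R M)
        ((Q ^ (n + 1) • ⊤ : Submodule R M) ⊔ LinearMap.ker f) = len R (LinearMap.ker f) := by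
      unfold relLen len
      rw [relLength_sup, ← relLength_bot]
      congr 1
      apply relLength_congr
      intro b hb
      have : b ∈ (Q ^ (n + 1) • ⊤ : Submodule R M) ⊓ LinearMap.ker f ↔ b ∈ (⊥ : Submodule R M) := by
        rw [hdis]
      simpa [hb] using this
    rw [len_quotient_of_surjective _ f hf, ← h2, h1]
    ring
  have hc : HasCoeff (s + 1) (fun _ => (len R (LinearMap.ker f) : ℤ))
      (fun j => if j = 0 then (len R (LinearMap.ker f) : ℤ) else 0) := by
    refine Filter.Eventually.of_forall fun n => ?_
    simp
  have h3 := (h.hasCoeff_coeff.sub hc).congr (key.mono fun n hn => hn.symm)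
  intro j hj
  have := h3.unique hN j (by omega)
  linarith

/-- The length of `(Q ^ (n + 1) M : x) / Q ^ n M`. -/
noncomputable def colonLen (Q : Ideal R) (M : Type*) [AddCommGroup M] [Module R M] (x : R) (n : ℕ) :
    ℕ :=
  relLen (Q ^ n • ⊤ : Submodule R M)
    ((Q ^ (n + 1) • ⊤ : Submodule R M).comap (LinearMap.lsmul R M x))

lemma le_comap_lsmul {Q : Ideal R} {x : R} (hx : x ∈ Q) (n : ℕ) :
    (Q ^ n • ⊤ : Submodule R M) ≤
      (Q ^ (n + 1) • ⊤ : Submodule R M).comap (LinearMap.lsmul R M x) := by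
  intro u hu
  rw [pow_succ', Submodule.mul_smul]
  exact Submodule.smul_mem_smul hx hu

lemma colonLen_eq {s : ℕ} {Q : Ideal R} {x : R} (hx : x ∈ Q) (f : M →ₗ[R] N)
    (hf : Function.Surjective f) (hker : LinearMap.ker f = LinearMap.range (LinearMap.lsmul R M x))
    (h : Par s Q N) {n : ℕ} (hn : 1 ≤ n) :
    (colonLen Q M x n : ℤ) = hilb Q N n - (hilb Q M n - hilb Q M (n - 1)) := by
  have hM := h.of_quotient hx f hf hker
  have h1 := hM.relLen_eq_sub n le_rfl (le_comap_lsmul hx n)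
  have h2 := hM.relLen_eq_sub (n + 1) le_rfl
    (le_sup_left (a := (Q ^ (n + 1) • ⊤ : Submodule R M)) (b := LinearMap.ker f))
  have h3 : relLen (Q ^ (n + 1) • ⊤ : Submodule R M)
      ((Q ^ (n + 1) • ⊤ : Submodule R M) ⊔ LinearMap.ker f) =
      len R (M ⧸ (Q ^ (n + 1) • ⊤ : Submodule R M).comap (LinearMap.lsmul R M x)) := by
    rw [len_quotient_eq_relLen]
    unfold relLen
    rw [relLength_sup, hker, ← Submodule.map_top]
    congr 1
    exact (relLength_eq_map _ fun b _ => Iff.rfl).symm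
  unfold colonLen hilb
  rw [h1, ← h3, h2, len_quotient_of_surjective _ f hf, show n - 1 + 1 = n by omega]
  ring

lemma evPoly_colonLen {s : ℕ} {Q : Ideal R} {x : R} (hx : x ∈ Q) (f : M →ₗ[R] N)
    (hf : Function.Surjective f) (hker : LinearMap.ker f = LinearMap.range (LinearMap.lsmul R M x))
    (hreg : ∀ u : M, x • u = 0 → u = 0) (h : Par s Q N) :
    EvPoly s (fun n => (colonLen Q M x n : ℤ)) := by
  have hM := h.of_quotient hx f hf hker
  obtain ⟨l, hl, hlQ, hle⟩ := h.gen
  set I := Ideal.span {x} ⊔ Ideal.ofList l with hI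
  have hIQ : I ≤ Q := sup_le (by simpa [Ideal.span_le] using hx) (ofList_le hlQ)
  have hQI : (Q • ⊤ : Submodule R M) ≤ I • ⊤ := by
    have := Submodule.comap_mono (f := f) hle
    rw [comap_smul_top_of_surjective _ f hf, comap_smul_top_of_surjective _ f hf] at this
    rw [hI, Submodule.sup_smul]
    refine (le_sup_left.trans this).trans (sup_le le_sup_right (le_trans ?_ le_sup_left))
    rw [hker, Submodule.ideal_span_singleton_smul]
    rintro _ ⟨u, rfl⟩
    exact ⟨u, trivial, rfl⟩
  have hpow : ∀ n, (I ^ n • ⊤ : Submodule R M) = Q ^ n • ⊤ :=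
    pow_smul_top_eq (le_antisymm (smul_top_mono hIQ) hQI)
  have hxI : x ∈ I := hI ▸ Ideal.mem_sup_left (Ideal.mem_span_singleton_self x)
  obtain ⟨c, hc⟩ := Ideal.exists_pow_inf_eq_pow_smul I (LinearMap.range (LinearMap.lsmul R M x))
  have hAR : ∀ n, c ≤ n + 1 → (I ^ (n + 1) • ⊤ : Submodule R M).comap (LinearMap.lsmul R M x) ≤
      I ^ (n + 1 - c) • ⊤ := by
    intro n hn u hu
    have h1 : x • u ∈ (I ^ (n + 1) • ⊤ : Submodule R M) ⊓
        LinearMap.range (LinearMap.lsmul R M x) := ⟨hu, u, rfl⟩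
    rw [hc _ hn] at h1
    have h2 : x • u ∈ I ^ (n + 1 - c) • LinearMap.range (LinearMap.lsmul R M x) :=
      (Submodule.smul_mono le_rfl inf_le_right : _ ≤ _) h1
    rw [← Submodule.map_top, ← Submodule.map_smul''] at h2
    obtain ⟨v, hv, hvu⟩ := h2
    have : v = u := by
      have h3 : x • (v - u) = 0 := by
        rw [smul_sub]
        exact sub_eq_zero.mpr hvu
      exact sub_eq_zero.mp (hreg _ h3)
    exact this ▸ hv
  let F' := I.stableFiltration (⊤ : Submodule R M)
  let G : I.Filtration M :=
    { N := fun n => I ^ (n - c) • ⊤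
      mono := fun n => Submodule.smul_mono_left (Ideal.pow_le_pow_right (by omega))
      smul_le := fun n => by
        rw [← Submodule.mul_smul, ← pow_succ']
        exact Submodule.smul_mono_left (Ideal.pow_le_pow_right (by omega)) }
  have hG : G.Stable := by
    refine ⟨c, fun n hn => ?_⟩
    change I • (I ^ (n - c) • ⊤ : Submodule R M) = I ^ (n + 1 - c) • ⊤
    rw [← Submodule.mul_smul, ← pow_succ', show n - c + 1 = n + 1 - c by omega]
  let F : I.Filtration M := colonFiltration G F' x
  have hF'F : F' ≤ F := by
    intro n
    refine le_inf (Submodule.smul_mono_left (Ideal.pow_le_pow_right (by omega))) ?_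
    exact le_comap_lsmul hxI n
  have key := evPoly_relLen_filtration l (Ideal.span {x}) F F' (hG.of_le fun n => inf_le_left) hF'F
    (fun y hy => hI ▸ Ideal.mem_sup_right (Ideal.subset_span hy)) hI.le (fun n => by
      rw [Submodule.ideal_span_singleton_smul]
      rintro _ ⟨u, hu, rfl⟩
      exact hu.2) (fun n => hM.relLength_ne_top n (hpow n).ge)
  rw [hl] at key
  refine EvPoly.congr key ?_
  filter_upwards [Filter.eventually_ge_atTop c] with n hn
  have h1 : F.N n = (Q ^ (n + 1) • ⊤ : Submodule R M).comap (LinearMap.lsmul R M x) := by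
    change (I ^ (n - c) • ⊤ : Submodule R M) ⊓
      (I ^ (n + 1) • ⊤ : Submodule R M).comap (LinearMap.lsmul R M x) = _
    rw [← hpow, inf_eq_right]
    exact (hAR n (by omega)).trans
      (Submodule.smul_mono_left (Ideal.pow_le_pow_right (by omega)))
  have h2 : F'.N n = (Q ^ n • ⊤ : Submodule R M) := hpow n
  rw [h1, h2]
  rfl

lemma hasCoeff_colonLen {s : ℕ} {Q : Ideal R} {x : R} (hx : x ∈ Q) (f : M →ₗ[R] N)
    (hf : Function.Surjective f) (hker : LinearMap.ker f = LinearMap.range (LinearMap.lsmul R M x))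
    (h : Par s Q N) :
    HasCoeff (s + 1) (fun n => (colonLen Q M x n : ℤ))
      (fun j => coeff s Q N j - coeff (s + 1) Q M (j + 1)) := by
  have hM := h.of_quotient hx f hf hker
  refine (h.hasCoeff_coeff.sub hM.hasCoeff_coeff.backwardDiff).congr ?_
  filter_upwards [Filter.eventually_ge_atTop 1] with n hn
  rw [colonLen_eq hx f hf hker h hn]

/-- The multiplicity of `M` with respect to `Q` does not change modulo a regular element of `Q`. -/
lemma mult_eq_of_regular {s : ℕ} {Q : Ideal R} {x : R} (hx : x ∈ Q) (f : M →ₗ[R] N)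
    (hf : Function.Surjective f) (hker : LinearMap.ker f = LinearMap.range (LinearMap.lsmul R M x))
    (hreg : ∀ u : M, x • u = 0 → u = 0) (h : Par s Q N) :
    coeff (s + 1) Q M (s + 1) = coeff s Q N s := by
  have := (hasCoeff_colonLen hx f hf hker h).top_eq_zero (evPoly_colonLen hx f hf hker hreg h)
  linarith

lemma chern_le_of_regular {s : ℕ} {Q : Ideal R} {x : R} (hx : x ∈ Q) (f : M →ₗ[R] N)
    (hf : Function.Surjective f) (hker : LinearMap.ker f = LinearMap.range (LinearMap.lsmul R M x))
    (hreg : ∀ u : M, x • u = 0 → u = 0) (h : Par (s + 1) Q N) :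
    coeff (s + 2) Q M (s + 1) ≤ coeff (s + 1) Q N s := by
  have h1 := hasCoeff_colonLen hx f hf hker h
  have h2 := h1.of_top_eq_zero (h1.top_eq_zero (evPoly_colonLen hx f hf hker hreg h))
  have := h2.top_nonneg (Filter.Eventually.of_forall fun n => by positivity)
  linarith

lemma chern_eq_of_regular {s : ℕ} {Q : Ideal R} {x : R} (hx : x ∈ Q) (f : M →ₗ[R] N)
    (hf : Function.Surjective f) (hker : LinearMap.ker f = LinearMap.range (LinearMap.lsmul R M x))
    (h : Par (s + 1) Q N) (hD : ∀ n, (Q ^ (n + 1) • ⊤ : Submodule R M).comap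
      (LinearMap.lsmul R M x) ≤ Q ^ n • ⊤) :
    coeff (s + 2) Q M (s + 1) = coeff (s + 1) Q N s := by
  have h1 := hasCoeff_colonLen hx f hf hker h
  have := h1.eq_zero (Filter.Eventually.of_forall fun n => by
    simp [colonLen, relLen, relLength_self_of_le (hD n)]) s (by omega)
  linarith

end Comparison

section Saturation

variable {R : Type v} [CommRing R] [IsLocalRing R]
  {M N : Type u} [AddCommGroup M] [Module R M]
  [AddCommGroup N] [Module R N]

/-- The saturation of `P` with respect to the maximal ideal. -/
def sat (P : Submodule R M) : Submodule R M where
  carrier := {u | ∃ k, ∀ a ∈ maximalIdeal R ^ k, a • u ∈ P}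
  zero_mem' := ⟨0, fun a _ => by simp⟩
  add_mem' := by
    rintro u v ⟨k, hk⟩ ⟨l, hl⟩
    refine ⟨max k l, fun a ha => ?_⟩
    rw [smul_add]
    exact add_mem (hk a (Ideal.pow_le_pow_right (le_max_left k l) ha))
      (hl a (Ideal.pow_le_pow_right (le_max_right k l) ha))
  smul_mem' := by
    rintro r u ⟨k, hk⟩
    refine ⟨k, fun a ha => ?_⟩
    rw [smul_comm]
    exact P.smul_mem r (hk a ha)

lemma mem_sat {P : Submodule R M} {u : M} :
    u ∈ sat P ↔ ∃ k, ∀ a ∈ maximalIdeal R ^ k, a • u ∈ P := Iff.rfl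

lemma le_sat (P : Submodule R M) : P ≤ sat P := fun _ hu => ⟨0, fun a _ => P.smul_mem a hu⟩

/-- No nonzero element is killed by the maximal ideal. -/
def TorsionFree (R : Type v) [CommRing R] [IsLocalRing R] (M : Type u) [AddCommGroup M]
    [Module R M] : Prop :=
  ∀ u : M, (∀ a ∈ maximalIdeal R, a • u = 0) → u = 0

lemma TorsionFree.eq_zero_of_pow (h : TorsionFree R M) (k : ℕ) :
    ∀ u : M, (∀ a ∈ maximalIdeal R ^ k, a • u = 0) → u = 0 := by
  induction k with
  | zero => intro u hu; simpa using hu 1 (by simp)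
  | succ k ih =>
    intro u hu
    refine h u fun a ha => ih _ fun b hb => ?_
    rw [smul_smul]
    exact hu _ (by rw [pow_succ]; exact Ideal.mul_mem_mul hb ha)

lemma TorsionFree.of_injective (h : TorsionFree R N) (f : M →ₗ[R] N) (hf : Function.Injective f) :
    TorsionFree R M := fun u hu => hf (by
  rw [map_zero]
  exact h _ fun a ha => by rw [← map_smul, hu a ha, map_zero])

section Noetherian
variable [IsNoetherianRing R] [Module.Finite R M] [Module.Finite R N]

lemma exists_pow_smul_sat_le (P : Submodule R M) : ∃ k, maximalIdeal R ^ k • sat P ≤ P := by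
  obtain ⟨S, hS⟩ := (IsNoetherian.noetherian (sat P))
  have hmem : ∀ u ∈ S, ∃ k, ∀ a ∈ maximalIdeal R ^ k, a • u ∈ P := fun u hu => by
    rw [← mem_sat, ← hS]
    exact Submodule.subset_span hu
  choose! k hk using hmem
  refine ⟨S.sup k, ?_⟩
  rw [← hS, Submodule.smul_le]
  intro r hr u hu
  induction hu using Submodule.span_induction with
  | mem u hu => exact hk u hu r (Ideal.pow_le_pow_right (Finset.le_sup hu) hr)
  | zero => simp
  | add u v _ _ hu hv => rw [smul_add]; exact add_mem hu hv
  | smul a u _ hu => rw [smul_comm]; exact P.smul_mem a hu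

lemma torsionFree_quotient_sat (P : Submodule R M) : TorsionFree R (M ⧸ sat P) := by
  intro u hu
  obtain ⟨u, rfl⟩ := Submodule.mkQ_surjective _ u
  obtain ⟨k, hk⟩ := exists_pow_smul_sat_le P
  simp only [Submodule.mkQ_apply, Submodule.Quotient.mk_eq_zero]
  refine ⟨k + 1, fun a ha => ?_⟩
  rw [pow_succ] at ha
  refine Submodule.mul_induction_on ha (fun b hb c hc => ?_) fun b c hb hc => ?_
  · rw [mul_smul]
    refine hk (Submodule.smul_mem_smul hb ?_)
    have := hu c hc
    rwa [← map_smul, Submodule.mkQ_apply, Submodule.Quotient.mk_eq_zero] at this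
  · rw [add_smul]
    exact add_mem hb hc

lemma relLength_ne_top_of_pow_smul_le {A B : Submodule R M} {k : ℕ}
    (h : maximalIdeal R ^ k • B ≤ A) : relLength A B ≠ ⊤ := by
  apply length_ne_top_of_pow_smul_top_eq_bot (k := k)
  rw [eq_bot_iff, Submodule.smul_le]
  rintro r hr ⟨_, b, hb, rfl⟩ -
  simp only [Submodule.mem_bot]
  apply Subtype.ext
  change r • Submodule.mkQ A b = 0
  rw [← map_smul, Submodule.mkQ_apply, Submodule.Quotient.mk_eq_zero]
  exact h (Submodule.smul_mem_smul hr hb)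

lemma relLength_sat_ne_top (P : Submodule R M) : relLength P (sat P) ≠ ⊤ := by
  obtain ⟨k, hk⟩ := exists_pow_smul_sat_le P
  exact relLength_ne_top_of_pow_smul_le hk

end Noetherian

/-- The submodule `x M`. -/
abbrev mulRange (x : R) (M : Type u) [AddCommGroup M] [Module R M] : Submodule R M :=
  LinearMap.range (LinearMap.lsmul R M x)

/-- The saturation of `x M`. -/
abbrev satMul (x : R) (M : Type u) [AddCommGroup M] [Module R M] : Submodule R M :=
  sat (mulRange x M)

/-- `x` is a nonzerodivisor on `M`. -/
def RegularOn (x : R) (M : Type u) [AddCommGroup M] [Module R M] : Prop :=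
  ∀ u : M, x • u = 0 → u = 0

lemma RegularOn.smul_left_cancel {x : R} (h : RegularOn x M) {u v : M} (huv : x • u = x • v) :
    u = v := by
  rw [← sub_eq_zero] at huv ⊢
  exact h _ (by rwa [smul_sub])

/-- `Q` contains a sequence of elements `x` such that successively dividing out the saturation of
`x M` exhausts `M`, with `Q M` meeting the saturation of `x M` only in `x M`. -/
def DSeq : ℕ → Ideal R → ∀ (M : Type u) [AddCommGroup M] [Module R M], Prop
  | 0, Q, M, _, _ => (Q • ⊤ : Submodule R M) = ⊥
  | s + 1, Q, M, _, _ => ∃ x ∈ Q, RegularOn x M ∧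
      satMul x M ⊓ Q • ⊤ ≤ mulRange x M ∧ DSeq s Q (M ⧸ satMul x M)

lemma DSeq.mono {s : ℕ} {Q Q' : Ideal R} (h : DSeq s Q M) (hle : Q ≤ Q')
    (heq : (Q' • ⊤ : Submodule R M) ≤ Q • ⊤) : DSeq s Q' M := by
  induction s generalizing M with
  | zero =>
    unfold DSeq at h ⊢
    rw [eq_bot_iff, ← h]
    exact heq
  | succ s ih =>
    obtain ⟨x, hx, hreg, h1, h2⟩ := h
    exact ⟨x, hle hx, hreg, (inf_le_inf le_rfl heq).trans h1,
      ih h2 (smul_top_le_of_surjective _ (Submodule.mkQ_surjective _) heq)⟩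

lemma DSeq.ker_inf_pow_le {s : ℕ} {Q : Ideal R} (hN : DSeq s Q N) :
    ∀ {M : Type u} [AddCommGroup M] [Module R M] (f : M →ₗ[R] N), Function.Surjective f →
    ∀ {I : Ideal R}, I ≤ Q → (I • ⊤ : Submodule R M) ≤ LinearMap.ker f →
    LinearMap.ker f ⊓ Q • ⊤ ≤ I • ⊤ →
    ∀ n, LinearMap.ker f ⊓ Q ^ (n + 1) • ⊤ ≤ I • (Q ^ n • ⊤ : Submodule R M) := by
  induction s generalizing N with
  | zero =>
    intro M _ _ f hf I hIQ hIf hfQ n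
    unfold DSeq at hN
    have h1 : (Q • ⊤ : Submodule R M) ≤ LinearMap.ker f := by
      rw [LinearMap.ker, ← hN, comap_smul_top_of_surjective Q f hf]
      exact le_sup_left
    have h2 : (Q • ⊤ : Submodule R M) ≤ I • ⊤ := (le_inf h1 le_rfl).trans hfQ
    refine inf_le_right.trans ?_
    rw [pow_succ, Submodule.mul_smul, ← Submodule.mul_smul I, mul_comm, Submodule.mul_smul]
    exact smul_mono_right _ h2
  | succ s ih =>
    intro M _ _ f hf I hIQ hIf hfQ
    obtain ⟨x, hx, hreg, h1, h2⟩ := hN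
    have key := ih h2 ((satMul x N).mkQ ∘ₗ f) ((Submodule.mkQ_surjective _).comp hf)
      (I := I ⊔ Ideal.span {x}) (sup_le hIQ (by simpa [Ideal.span_le] using hx)) ?_ ?_
    · intro n
      induction n with
      | zero => simpa using hfQ
      | succ n ihn =>
        rintro w ⟨hw1, hw2⟩
        have hw := key (n + 1) ⟨by
          have : f w = 0 := hw1
          simp [this], hw2⟩
        rw [Submodule.sup_smul, Submodule.ideal_span_singleton_smul] at hw
        obtain ⟨a, ha, _, ⟨v, hv, rfl⟩, rfl⟩ := Submodule.mem_sup.mp hw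
        have ha' : f a = 0 := hIf ((Submodule.smul_mono le_rfl le_top : _ ≤ _) ha)
        have hv' : f v = 0 := by
          apply hreg
          have : f (a + x • v) = 0 := hw1
          rwa [map_add, ha', zero_add, map_smul] at this
        refine add_mem ha ?_
        have h3 := ihn ⟨hv', hv⟩
        have h4 : x • v ∈ Q • I • (Q ^ n • ⊤ : Submodule R M) := Submodule.smul_mem_smul hx h3
        rwa [← Submodule.mul_smul, ← Submodule.mul_smul, mul_comm Q I, mul_assoc, ← pow_succ',
          Submodule.mul_smul] at h4
    · rw [Submodule.sup_smul, Submodule.ideal_span_singleton_smul]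
      refine sup_le (fun u hu => ?_) ?_
      · have : f u = 0 := hIf hu
        simp [this]
      · rintro _ ⟨u, -, rfl⟩
        simp only [LinearMap.mem_ker, LinearMap.comp_apply, Submodule.mkQ_apply,
          Submodule.Quotient.mk_eq_zero]
        exact le_sat _ ⟨f u, by simp⟩
    · rintro w ⟨hw1, hw2⟩
      replace hw1 : f w ∈ satMul x N := (Submodule.Quotient.mk_eq_zero _).mp hw1
      obtain ⟨v, hv⟩ := h1 ⟨hw1, by
        rw [← map_smul_top_of_surjective Q f hf]
        exact ⟨w, hw2, rfl⟩⟩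
      obtain ⟨v, rfl⟩ := hf v
      have h3 : w - x • v ∈ LinearMap.ker f ⊓ Q • ⊤ := by
        refine ⟨?_, sub_mem hw2 (Submodule.smul_mem_smul hx trivial)⟩
        change f (w - x • v) = 0
        rw [map_sub, map_smul, sub_eq_zero]
        exact hv.symm
      have h4 := hfQ h3
      rw [Submodule.sup_smul, Submodule.ideal_span_singleton_smul]
      exact Submodule.mem_sup.mpr ⟨_, h4, x • v, ⟨v, trivial, rfl⟩, by abel⟩

lemma DSeq.comap_le {s : ℕ} {Q : Ideal R} {x : R} (hx : x ∈ Q) (hreg : RegularOn x M)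
    (h1 : satMul x M ⊓ Q • ⊤ ≤ mulRange x M) (h2 : DSeq s Q (M ⧸ satMul x M)) (n : ℕ) :
    (Q ^ (n + 1) • ⊤ : Submodule R M).comap (LinearMap.lsmul R M x) ≤ Q ^ n • ⊤ := by
  intro u hu
  have hspan : (Ideal.span {x} • ⊤ : Submodule R M) = mulRange x M := by
    rw [Submodule.ideal_span_singleton_smul]
    ext v
    constructor
    · rintro ⟨u, -, rfl⟩; exact ⟨u, rfl⟩
    · rintro ⟨u, rfl⟩; exact ⟨u, trivial, rfl⟩
  have := h2.ker_inf_pow_le (satMul x M).mkQ (Submodule.mkQ_surjective _) (I := Ideal.span {x})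
    (by simpa [Ideal.span_le] using hx) (by rw [hspan, Submodule.ker_mkQ]; exact le_sat _)
    (by rw [hspan, Submodule.ker_mkQ]; exact h1) n
  have hmem := this (x := x • u) ⟨by rw [Submodule.ker_mkQ]; exact le_sat _ ⟨u, rfl⟩, hu⟩
  rw [Submodule.ideal_span_singleton_smul] at hmem
  obtain ⟨v, hv, hvu⟩ := hmem
  have : v = u := hreg.smul_left_cancel hvu
  exact this ▸ hv

end Saturation

section Reduction

variable {R : Type v} [CommRing R] [IsLocalRing R] [IsNoetherianRing R]
  {M : Type u} [AddCommGroup M] [Module R M] [Module.Finite R M]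

/-- The length of the torsion of `M ⧸ x M`. -/
noncomputable def satLen (x : R) (M : Type u) [AddCommGroup M] [Module R M] : ℕ :=
  relLen (mulRange x M) (satMul x M)

/-- The difference `λ(M ⧸ Q M) - e₀(Q, M)`. -/
noncomputable def defect (s : ℕ) (Q : Ideal R) (M : Type u) [AddCommGroup M] [Module R M] : ℤ :=
  len R (M ⧸ (Q • ⊤ : Submodule R M)) - coeff s Q M s

lemma ker_factor_satMul (x : R) : LinearMap.ker (Submodule.factor (le_sat (mulRange x M))) =
    (satMul x M).map (mulRange x M).mkQ := by
  ext v
  obtain ⟨v, rfl⟩ := Submodule.mkQ_surjective _ v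
  constructor
  · intro h
    refine ⟨v, ?_, rfl⟩
    exact (Submodule.Quotient.mk_eq_zero _).mp h
  · rintro ⟨w, hw, hwv⟩
    rw [← hwv]
    exact (Submodule.Quotient.mk_eq_zero _).mpr hw

lemma length_ker_factor_satMul (x : R) :
    Module.length R (LinearMap.ker (Submodule.factor (le_sat (mulRange x M)))) =
      relLength (mulRange x M) (satMul x M) := by
  rw [ker_factor_satMul]
  rfl

lemma coeff_quotient_satMul {s : ℕ} {Q : Ideal R} {x : R} (h : Par s Q (M ⧸ mulRange x M)) {j : ℕ}
    (hj : j ≤ s) : coeff s Q (M ⧸ mulRange x M) j =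
      coeff s Q (M ⧸ satMul x M) j + if j = 0 then (satLen x M : ℤ) else 0 := by
  have := h.coeff_of_ker (Submodule.factor (le_sat (mulRange x M)))
    (Submodule.factor_surjective _) (by
      rw [length_ker_factor_satMul]
      exact relLength_sat_ne_top _) j hj
  rw [this]
  unfold satLen relLen len
  rw [length_ker_factor_satMul]

lemma Par.satMul {s : ℕ} {Q : Ideal R} {x : R} (h : Par s Q (M ⧸ mulRange x M)) :
    Par s Q (M ⧸ satMul x M) :=
  h.of_surjective _ (Submodule.factor_surjective (le_sat (mulRange x M)))

lemma Par.of_mulRange {s : ℕ} {Q : Ideal R} {x : R} (hx : x ∈ Q)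
    (h : Par s Q (M ⧸ mulRange x M)) : Par (s + 1) Q M :=
  h.of_quotient hx _ (Submodule.mkQ_surjective _) (Submodule.ker_mkQ _)

lemma mult_step {s : ℕ} {Q : Ideal R} {x : R} (hx : x ∈ Q) (hreg : RegularOn x M)
    (h : Par (s + 1) Q (M ⧸ mulRange x M)) :
    coeff (s + 2) Q M (s + 2) = coeff (s + 1) Q (M ⧸ satMul x M) (s + 1) := by
  rw [mult_eq_of_regular hx _ (Submodule.mkQ_surjective _) (Submodule.ker_mkQ _) hreg h,
    coeff_quotient_satMul h le_rfl]
  simp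

lemma chern_step_le {s : ℕ} {Q : Ideal R} {x : R} (hx : x ∈ Q) (hreg : RegularOn x M)
    (h : Par (s + 1) Q (M ⧸ mulRange x M)) :
    coeff (s + 2) Q M (s + 1) ≤
      coeff (s + 1) Q (M ⧸ satMul x M) s + if s = 0 then (satLen x M : ℤ) else 0 := by
  rw [← coeff_quotient_satMul h (by omega)]
  exact chern_le_of_regular hx _ (Submodule.mkQ_surjective _) (Submodule.ker_mkQ _) hreg h

lemma chern_step_eq {s : ℕ} {Q : Ideal R} {x : R} (hx : x ∈ Q) (hreg : RegularOn x M)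
    (h : Par (s + 1) Q (M ⧸ mulRange x M)) (h1 : satMul x M ⊓ Q • ⊤ ≤ mulRange x M)
    (h2 : DSeq (s + 1) Q (M ⧸ satMul x M)) :
    coeff (s + 2) Q M (s + 1) =
      coeff (s + 1) Q (M ⧸ satMul x M) s + if s = 0 then (satLen x M : ℤ) else 0 := by
  rw [← coeff_quotient_satMul h (by omega)]
  exact chern_eq_of_regular hx _ (Submodule.mkQ_surjective _) (Submodule.ker_mkQ _) h
    (DSeq.comap_le hx hreg h1 h2)

lemma defect_step {s : ℕ} {Q : Ideal R} {x : R} (hx : x ∈ Q) (hreg : RegularOn x M)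
    (h : Par (s + 1) Q (M ⧸ mulRange x M)) :
    defect (s + 2) Q M = defect (s + 1) Q (M ⧸ satMul x M) +
      relLen (Q • ⊤ : Submodule R M) (Q • ⊤ ⊔ satMul x M) := by
  unfold defect
  have h1 := (h.of_mulRange hx).relLen_eq_sub 1 (A := Q • ⊤) (B := Q • ⊤ ⊔ satMul x M)
    (by simp) le_sup_left
  rw [mult_step hx hreg h, h1,
    len_quotient_of_surjective Q (satMul x M).mkQ (Submodule.mkQ_surjective _), Submodule.ker_mkQ]
  ring

lemma mulRange_le_smul_top {Q : Ideal R} {x : R} (hx : x ∈ Q) :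
    mulRange x M ≤ (Q • ⊤ : Submodule R M) := by
  rintro _ ⟨u, rfl⟩
  exact Submodule.smul_mem_smul hx trivial

lemma relLength_smul_sup_satMul_le {Q : Ideal R} {x : R} (hx : x ∈ Q) :
    relLength (Q • ⊤ : Submodule R M) (Q • ⊤ ⊔ satMul x M) ≤
      relLength (mulRange x M) (satMul x M) := by
  rw [relLength_sup]
  exact relLength_anti_left (mulRange_le_smul_top hx)

lemma relLen_smul_sup_satMul_le {Q : Ideal R} {x : R} (hx : x ∈ Q) :
    relLen (Q • ⊤ : Submodule R M) (Q • ⊤ ⊔ satMul x M) ≤ satLen x M :=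
  ENat.toNat_le_toNat (relLength_smul_sup_satMul_le hx) (relLength_sat_ne_top _)

lemma relLen_smul_sup_satMul_eq {Q : Ideal R} {x : R} (hx : x ∈ Q)
    (h : satMul x M ⊓ Q • ⊤ ≤ mulRange x M) :
    relLen (Q • ⊤ : Submodule R M) (Q • ⊤ ⊔ satMul x M) = satLen x M := by
  unfold satLen relLen
  rw [relLength_sup]
  congr 1
  apply relLength_congr
  intro b hb
  exact ⟨fun h' => h ⟨hb, h'⟩, fun h' => mulRange_le_smul_top hx h'⟩

lemma satMul_inf_le_of_relLen_eq {Q : Ideal R} {x : R} (hx : x ∈ Q)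
    (h : relLen (Q • ⊤ : Submodule R M) (Q • ⊤ ⊔ satMul x M) = satLen x M) :
    satMul x M ⊓ Q • ⊤ ≤ mulRange x M := by
  have h1 : relLength (mulRange x M) (satMul x M) ≠ ⊤ := relLength_sat_ne_top _
  have hle : mulRange x M ≤ satMul x M ⊓ Q • ⊤ := le_inf (le_sat _) (mulRange_le_smul_top hx)
  have h2 := relLen_add hle inf_le_left h1
  have h3 : relLen (Q • ⊤ : Submodule R M) (Q • ⊤ ⊔ satMul x M) =
      relLen (satMul x M ⊓ Q • ⊤) (satMul x M) := by
    unfold relLen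
    rw [relLength_sup]
    congr 1
    apply relLength_congr
    intro b hb
    exact ⟨fun h' => ⟨hb, h'⟩, fun h' => h'.2⟩
  have h4 : relLen (mulRange x M) (satMul x M ⊓ Q • ⊤) = 0 := by
    have : satLen x M = relLen (mulRange x M) (satMul x M) := rfl
    omega
  apply le_of_relLength_eq_zero
  have h5 : relLength (mulRange x M) (satMul x M ⊓ Q • ⊤) ≠ ⊤ :=
    ne_top_of_le_ne_top h1 (relLength_mono_right inf_le_left)
  unfold relLen at h4
  rw [ENat.toNat_eq_zero] at h4
  exact h4.resolve_right h5

/-- An element `y` such that `M ⧸ y M` has finite length is regular on a torsion free module `M`. -/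
lemma TorsionFree.regularOn_of_pow_le (hM : TorsionFree R M) {y : R} {a : ℕ}
    (h : (maximalIdeal R ^ a • ⊤ : Submodule R M) ≤ mulRange y M) : RegularOn y M := by
  have hmono : Monotone fun n => LinearMap.ker (LinearMap.lsmul R M (y ^ n)) := by
    intro m n hmn u hu
    have h1 : y ^ m • u = 0 := hu
    change y ^ n • u = 0
    rw [← Nat.sub_add_cancel hmn, pow_add, mul_smul, h1, smul_zero]
  obtain ⟨k, hk⟩ := monotone_stabilizes_iff_noetherian.mpr (inferInstance : IsNoetherian R M)
    ⟨_, hmono⟩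
  have hpow : ∀ n, (maximalIdeal R ^ (a * n) • ⊤ : Submodule R M) ≤ mulRange (y ^ n) M := by
    have hspan : ∀ z : R, (Ideal.span {z} • ⊤ : Submodule R M) = mulRange z M := by
      intro z
      rw [Submodule.ideal_span_singleton_smul]
      ext v
      constructor
      · rintro ⟨u, -, rfl⟩; exact ⟨u, rfl⟩
      · rintro ⟨u, rfl⟩; exact ⟨u, trivial, rfl⟩
    intro n
    rw [pow_mul, ← hspan, ← Ideal.span_singleton_pow]
    refine pow_smul_top_le ?_ n
    rwa [hspan]
  intro u hu
  apply hM.eq_zero_of_pow (a * k)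
  intro b hb
  obtain ⟨w, hw⟩ := hpow k (Submodule.smul_mem_smul hb (Submodule.mem_top (x := u)))
  have h1 : w ∈ LinearMap.ker (LinearMap.lsmul R M (y ^ (k + 1))) := by
    change y ^ (k + 1) • w = 0
    rw [pow_succ', mul_smul]
    change y • LinearMap.lsmul R M (y ^ k) w = 0
    rw [hw, smul_comm, hu, smul_zero]
  have h2 := hk (k + 1) (Nat.le_succ k)
  change LinearMap.ker (LinearMap.lsmul R M (y ^ k)) =
    LinearMap.ker (LinearMap.lsmul R M (y ^ (k + 1))) at h2
  rw [← h2] at h1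
  rw [← hw]
  exact h1

lemma mulRange_eq_span_smul (x : R) : mulRange x M = (Ideal.span {x} • ⊤ : Submodule R M) := by
  rw [Submodule.ideal_span_singleton_smul]
  ext v
  constructor
  · rintro ⟨u, rfl⟩; exact ⟨u, trivial, rfl⟩
  · rintro ⟨u, -, rfl⟩; exact ⟨u, rfl⟩

/-- Over a torsion free module of dimension one, a parameter ideal acts as a regular element. -/
lemma Par.exists_regular_of_one {Q : Ideal R} (h : Par 1 Q M) (hM : TorsionFree R M) :
    ∃ y ∈ Q, RegularOn y M ∧ (Q • ⊤ : Submodule R M) = mulRange y M := by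
  obtain ⟨l, hl, hlQ, hle⟩ := h.gen
  obtain ⟨y, rfl⟩ := List.length_eq_one_iff.mp hl
  have hy : y ∈ Q := hlQ y (by simp)
  have heq : (Q • ⊤ : Submodule R M) = mulRange y M := by
    refine le_antisymm (hle.trans ?_) (mulRange_le_smul_top hy)
    rw [mulRange_eq_span_smul, Ideal.ofList_singleton]
  obtain ⟨a, ha⟩ := h.pow
  exact ⟨y, hy, hM.regularOn_of_pow_le (ha.trans heq.le), heq⟩

lemma Par.dSeq_of_one {Q : Ideal R} (h : Par 1 Q M) (hM : TorsionFree R M) : DSeq 1 Q M := by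
  obtain ⟨y, hy, hreg, heq⟩ := h.exists_regular_of_one hM
  refine ⟨y, hy, hreg, heq ▸ inf_le_right, ?_⟩
  unfold DSeq
  rw [← map_smul_top_of_surjective Q _ (Submodule.mkQ_surjective _), heq, eq_bot_iff]
  rintro _ ⟨u, hu, rfl⟩
  simpa using le_sat _ hu

lemma coeff_one {Q : Ideal R} (h : Par 1 Q M) (hM : TorsionFree R M) :
    coeff 1 Q M 0 = 0 ∧ coeff 1 Q M 1 = len R (M ⧸ (Q • ⊤ : Submodule R M)) := by
  obtain ⟨y, hy, hreg, heq⟩ := h.exists_regular_of_one hM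
  set a := len R (M ⧸ (Q • ⊤ : Submodule R M)) with ha
  have hQ0 : (Q • ⊤ : Submodule R (M ⧸ mulRange y M)) = ⊥ := by
    rw [← map_smul_top_of_surjective Q _ (Submodule.mkQ_surjective _), heq, eq_bot_iff]
    rintro _ ⟨u, hu, rfl⟩
    simpa using hu
  have hpar : Par 0 Q (M ⧸ mulRange y M) := by
    refine ⟨h.le, ?_, [], rfl, by simp, by simp [hQ0]⟩
    obtain ⟨a, ha⟩ := h.pow
    exact ⟨a, smul_top_le_of_surjective _ (Submodule.mkQ_surjective _) ha⟩
  have hpow : ∀ n, (Q ^ n • ⊤ : Submodule R M) = mulRange (y ^ n) M := by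
    intro n
    rw [mulRange_eq_span_smul, ← Ideal.span_singleton_pow]
    apply pow_smul_top_eq
    rw [heq, mulRange_eq_span_smul]
  have hcolon : ∀ n, colonLen Q M y n = 0 := by
    intro n
    unfold colonLen relLen
    rw [relLength_self_of_le, ENat.toNat_zero]
    intro u hu
    rw [hpow] at hu ⊢
    obtain ⟨v, hv⟩ := hu
    refine ⟨v, hreg.smul_left_cancel ?_⟩
    change y • y ^ n • v = _
    rw [smul_smul, ← pow_succ']
    exact hv
  have hhilb : ∀ n, hilb Q M n = (n + 1) * a := by
    intro n
    induction n with
    | zero => unfold hilb; rw [zero_add, pow_one, ← ha]; simp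
    | succ n ih =>
      have h1 := colonLen_eq hy _ (Submodule.mkQ_surjective _) (Submodule.ker_mkQ _) hpar
        (n := n + 1) (by omega)
      have h2 : hilb Q (M ⧸ mulRange y M) (n + 1) = a := by
        unfold hilb
        rw [pow_succ, Submodule.mul_smul, hQ0, Submodule.smul_bot,
          len_eq_of_equiv (Submodule.quotEquivOfEqBot (⊥ : Submodule R (M ⧸ mulRange y M)) rfl),
          ha, heq]
      rw [hcolon, h2] at h1
      simp only [Nat.add_sub_cancel, ih] at h1
      push_cast at h1 ⊢
      linarith
  have hc : HasCoeff 2 (hilb Q M) (fun j => if j = 1 then (a : ℤ) else 0) := by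
    refine Filter.Eventually.of_forall fun n => ?_
    rw [hhilb]
    simp
    ring
  have := h.hasCoeff_coeff.unique hc
  exact ⟨by simpa using this 0 (by omega), by simpa using this 1 (by omega)⟩

lemma defect_one {Q : Ideal R} (h : Par 1 Q M) (hM : TorsionFree R M) : defect 1 Q M = 0 := by
  unfold defect
  rw [(coeff_one h hM).2, sub_self]

end Reduction

section LocalCohomologyConstruction

open Abelian

variable {R : Type u} [CommRing R]

/-- Precomposition with a morphism on extension groups. -/
noncomputable def extPre {X Y : ModuleCat.{u} R} (f : X ⟶ Y) (M : ModuleCat.{u} R) (i : ℕ) :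
    Ext Y M i →ₗ[R] Ext X M i :=
  Ext.bilinearCompOfLinear R X Y M 0 i i (zero_add i) (Ext.mk₀ f)

@[simp] lemma extPre_apply {X Y : ModuleCat.{u} R} (f : X ⟶ Y) (M : ModuleCat.{u} R) (i : ℕ)
    (x : Ext Y M i) : extPre f M i x = (Ext.mk₀ f).comp x (zero_add i) := rfl

/-- The projection `R ⧸ J ^ t ⟶ R ⧸ J ^ s` for `s ≤ t`. -/
noncomputable def powProj (J : Ideal R) {s t : ℕ} (h : s ≤ t) :
    ModuleCat.of R (R ⧸ J ^ t) ⟶ ModuleCat.of R (R ⧸ J ^ s) :=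
  ModuleCat.ofHom (Submodule.factor (Ideal.pow_le_pow_right h))

lemma powProj_comp (J : Ideal R) {a b c : ℕ} (h : a ≤ b) (h' : b ≤ c) :
    powProj J h' ≫ powProj J h = powProj J (h.trans h') := by
  ext
  rfl

/-- The transition maps of the direct system defining local cohomology. -/
noncomputable def lcTrans (J : Ideal R) (i : ℕ) (M : ModuleCat.{u} R) (s t : ℕ) (h : s ≤ t) :
    Ext (ModuleCat.of R (R ⧸ J ^ s)) M i →ₗ[R] Ext (ModuleCat.of R (R ⧸ J ^ t)) M i :=
  extPre (powProj J h) M i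

instance (J : Ideal R) (i : ℕ) (M : ModuleCat.{u} R) :
    DirectedSystem (fun t : ℕ => Ext (ModuleCat.of R (R ⧸ J ^ t)) M i)
      (fun s t h => lcTrans J i M s t h) where
  map_self s x := by
    have : powProj J (le_refl s) = 𝟙 _ := by
      ext; rfl
    simp [lcTrans, this]
  map_map a b c h h' x := by
    simp only [lcTrans, extPre_apply]
    rw [Ext.mk₀_comp_mk₀_assoc, powProj_comp]

/-- Local cohomology as a direct limit of extension modules. -/
noncomputable def LC (J : Ideal R) (i : ℕ) (M : ModuleCat.{u} R) : Type u :=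
  Module.DirectLimit (fun t : ℕ => Ext (ModuleCat.of R (R ⧸ J ^ t)) M i) (lcTrans J i M)

noncomputable instance (J : Ideal R) (i : ℕ) (M : ModuleCat.{u} R) : AddCommGroup (LC J i M) :=
  inferInstanceAs (AddCommGroup (Module.DirectLimit _ (lcTrans J i M)))

noncomputable instance (J : Ideal R) (i : ℕ) (M : ModuleCat.{u} R) : Module R (LC J i M) :=
  inferInstanceAs (Module R (Module.DirectLimit _ (lcTrans J i M)))

/-- The canonical map into local cohomology. -/
noncomputable def LC.of (J : Ideal R) (i : ℕ) (M : ModuleCat.{u} R) (t : ℕ) :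
    Ext (ModuleCat.of R (R ⧸ J ^ t)) M i →ₗ[R] LC J i M :=
  Module.DirectLimit.of R ℕ _ (lcTrans J i M) t

lemma LC.exists_of {J : Ideal R} {i : ℕ} {M : ModuleCat.{u} R} (z : LC J i M) :
    ∃ t x, LC.of J i M t x = z := Module.DirectLimit.exists_of z

lemma LC.of_trans (J : Ideal R) (i : ℕ) (M : ModuleCat.{u} R) {s t : ℕ} (h : s ≤ t)
    (x : Ext (ModuleCat.of R (R ⧸ J ^ s)) M i) :
    LC.of J i M t ((Ext.mk₀ (powProj J h)).comp x (zero_add i)) = LC.of J i M s x :=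
  Module.DirectLimit.of_f (f := lcTrans J i M) (hij := h)

lemma LC.of_eq_zero {J : Ideal R} {i : ℕ} {M : ModuleCat.{u} R} {s : ℕ}
    {x : Ext (ModuleCat.of R (R ⧸ J ^ s)) M i} (h : LC.of J i M s x = 0) :
    ∃ t, ∃ hst : s ≤ t, (Ext.mk₀ (powProj J hst)).comp x (zero_add i) = 0 :=
  Module.DirectLimit.of.zero_exact (f := lcTrans J i M) h

/-- Postcomposition with an extension class on local cohomology. -/
noncomputable def LC.map (J : Ideal R) {M N : ModuleCat.{u} R} {k : ℕ} (γ : Ext M N k) {i j : ℕ}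
    (h : i + k = j) : LC J i M →ₗ[R] LC J j N :=
  Module.DirectLimit.map (f := lcTrans J i M) (f' := lcTrans J j N)
    (fun t => (Ext.bilinearCompOfLinear R (ModuleCat.of R (R ⧸ J ^ t)) M N i k j h).flip γ)
    (by
      intro a b hab
      ext x
      change ((Ext.mk₀ (powProj J hab)).comp x (zero_add i)).comp γ h =
        (Ext.mk₀ (powProj J hab)).comp (x.comp γ h) (zero_add j)
      rw [Ext.comp_assoc _ _ _ _ _ (by lia)])

@[simp] lemma LC.map_of (J : Ideal R) {M N : ModuleCat.{u} R} {k : ℕ} (γ : Ext M N k) {i j : ℕ}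
    (h : i + k = j) (t : ℕ) (x : Ext (ModuleCat.of R (R ⧸ J ^ t)) M i) :
    LC.map J γ h (LC.of J i M t x) = LC.of J j N t (x.comp γ h) :=
  Module.DirectLimit.map_apply_of _ _ _

lemma LC.exact (J : Ideal R) {M N P : ModuleCat.{u} R} {k l : ℕ} (γ : Ext M N k) (δ : Ext N P l)
    {i j n : ℕ} (h : i + k = j) (h' : j + l = n)
    (hex : ∀ (X : ModuleCat.{u} R) (x : Ext X N j),
      x.comp δ h' = 0 ↔ ∃ y : Ext X M i, y.comp γ h = x) :
    Function.Exact (LC.map J γ h) (LC.map J δ h') := by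
  intro z
  constructor
  · intro hz
    obtain ⟨t, x, rfl⟩ := LC.exists_of z
    rw [LC.map_of] at hz
    obtain ⟨t', ht, h0⟩ := LC.of_eq_zero hz
    have h0' : ((Ext.mk₀ (powProj J ht)).comp x (zero_add j)).comp δ h' = 0 := by
      rw [← h0, Ext.comp_assoc _ _ _ _ _ (by lia)]
    obtain ⟨y, hy⟩ := (hex _ _).1 h0'
    refine ⟨LC.of J i M t' y, ?_⟩
    rw [LC.map_of, hy, LC.of_trans]
  · rintro ⟨w, rfl⟩
    obtain ⟨t, y, rfl⟩ := LC.exists_of w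
    rw [LC.map_of, LC.map_of, (hex _ _).2 ⟨y, rfl⟩, map_zero]

lemma LC.map_smul_id (J : Ideal R) {M : ModuleCat.{u} R} (r : R) (i : ℕ) (z : LC J i M) :
    LC.map J (Ext.mk₀ (r • 𝟙 M)) (add_zero i) z = r • z := by
  obtain ⟨t, x, rfl⟩ := LC.exists_of z
  rw [LC.map_of, ← Ext.smul_eq_comp_mk₀, map_smul]

lemma LC.exists_pow_smul (J : Ideal R) {M : ModuleCat.{u} R} (i : ℕ) (z : LC J i M) :
    ∃ t, ∀ a ∈ J ^ t, a • z = 0 := by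
  obtain ⟨t, x, rfl⟩ := LC.exists_of z
  refine ⟨t, fun a ha => ?_⟩
  have h0 : (a • 𝟙 (ModuleCat.of R (R ⧸ J ^ t))) = 0 := by
    ext
    change a • (Ideal.Quotient.mk (J ^ t) 1 : R ⧸ J ^ t) = 0
    rw [Algebra.smul_def, map_one, mul_one]
    exact Ideal.Quotient.eq_zero_iff_mem.2 ha
  have : a • x = 0 := by
    have := Ext.mk₀_id_comp (a • x)
    rw [← this, Ext.comp_smul, ← Ext.smul_comp, ← Ext.mk₀_smul, h0]
    simp
  rw [← map_smul, this, map_zero]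

end LocalCohomologyConstruction

section LocalCohomologyVanishing

open Abelian

variable {R : Type u} [CommRing R]

lemma ext_restrict_eq_zero {F X F' X' : Type u} [AddCommGroup F] [Module R F] [AddCommGroup X]
    [Module R X] [AddCommGroup F'] [Module R F'] [AddCommGroup X']
    [Module R X'] {f : F →ₗ[R] X} {f' : F' →ₗ[R] X'} (hf : Function.Surjective f)
    (hf' : Function.Surjective f') (φ : F' →ₗ[R] F) (ψ : X' →ₗ[R] X)
    (hφ : ∀ u, ψ (f' u) = f (φ u)) (B : Submodule R (LinearMap.ker f))
    (hB : ∀ u (hu : f' u = 0), (⟨φ u, by rw [LinearMap.mem_ker, ← hφ, hu, map_zero]⟩ :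
      LinearMap.ker f) ∈ B) {N : ModuleCat.{u} R} {i j : ℕ} (hij : 1 + i = j)
    (ξ : Ext (ModuleCat.of R (LinearMap.ker f)) N i)
    (hξ : (Ext.mk₀ (ModuleCat.ofHom B.subtype)).comp ξ (zero_add i) = 0) :
    (Ext.mk₀ (ModuleCat.ofHom ψ)).comp
      ((LinearMap.shortExact_shortComplexKer hf).extClass.comp ξ hij) (zero_add j) = 0 := by
  let k : LinearMap.ker f' →ₗ[R] B :=
    { toFun := fun u => ⟨_, hB u.1 u.2⟩
      map_add' := fun a b => by ext; simp
      map_smul' := fun a b => by ext; simp }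
  let Φ : f'.shortComplexKer ⟶ f.shortComplexKer :=
    { τ₁ := ModuleCat.ofHom k ≫ ModuleCat.ofHom B.subtype
      τ₂ := ModuleCat.ofHom φ
      τ₃ := ModuleCat.ofHom ψ
      comm₁₂ := by ext u; rfl
      comm₂₃ := by ext u; exact (hφ u).symm }
  have h := ShortComplex.ShortExact.extClass_naturality
    (LinearMap.shortExact_shortComplexKer hf') (LinearMap.shortExact_shortComplexKer hf) Φ
  have h1 : (Ext.mk₀ Φ.τ₁).comp ξ (zero_add i) = 0 := by
    change (Ext.mk₀ (ModuleCat.ofHom k ≫ ModuleCat.ofHom B.subtype)).comp ξ (zero_add i) = 0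
    rw [← Ext.mk₀_comp_mk₀_assoc, hξ, Ext.comp_zero]
  change (Ext.mk₀ Φ.τ₃).comp _ _ = 0
  rw [← Ext.comp_assoc (Ext.mk₀ Φ.τ₃) _ _ (zero_add 1) hij (by lia), ← h,
    Ext.comp_assoc _ _ _ (add_zero 1) (zero_add i) (by lia), h1, Ext.comp_zero]

variable [IsNoetherianRing R]

/-- Every element of the module is killed by a power of the ideal. -/
def PowTorsion (J : Ideal R) (N : Type*) [AddCommGroup N] [Module R N] : Prop :=
  ∀ u : N, ∃ k : ℕ, ∀ a ∈ J ^ k, a • u = 0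

lemma PowTorsion.exists_pow_of_finite {J : Ideal R} {N X : Type*} [AddCommGroup N] [Module R N]
    [AddCommGroup X] [Module R X] [Module.Finite R X] (hN : PowTorsion J N) (f : X →ₗ[R] N) :
    ∃ k : ℕ, ∀ a ∈ J ^ k, ∀ u, a • f u = 0 := by
  obtain ⟨S, hS⟩ := Module.Finite.fg_top (R := R) (M := X)
  choose k hk using hN
  refine ⟨∑ u ∈ S, k (f u), fun a ha u => ?_⟩
  have : u ∈ Submodule.span R (S : Set X) := hS ▸ Submodule.mem_top
  induction this using Submodule.span_induction with
  | mem x hx =>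
    exact hk _ a (Ideal.pow_le_pow_right
      (Finset.single_le_sum (f := fun u => k (f u)) (fun _ _ => Nat.zero_le _) hx) ha)
  | zero => simp
  | add x y _ _ h1 h2 => rw [map_add, smul_add, h1, h2, add_zero]
  | smul r x _ h => rw [map_smul, smul_comm, h, smul_zero]

lemma exists_ext_restrict_eq_zero (J : Ideal R) {N : ModuleCat.{u} R} (hN : PowTorsion J N)
    (i : ℕ) : ∀ (X : Type u) [AddCommGroup X] [Module R X] [Module.Finite R X]
    (ξ : Ext (ModuleCat.of R X) N i), ∃ n : ℕ,
      (Ext.mk₀ (ModuleCat.ofHom (J ^ n • ⊤ : Submodule R X).subtype)).comp ξ (zero_add i) = 0 := by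
  induction i with
  | zero =>
    intro X _ _ _ ξ
    obtain ⟨φ, rfl⟩ := Ext.homEquiv₀.symm.surjective ξ
    obtain ⟨k, hk⟩ := hN.exists_pow_of_finite φ.hom
    refine ⟨k, ?_⟩
    change (Ext.mk₀ _).comp (Ext.mk₀ φ) _ = 0
    rw [Ext.mk₀_comp_mk₀]
    have : ModuleCat.ofHom (J ^ k • ⊤ : Submodule R X).subtype ≫ φ = 0 := by
      ext ⟨u, hu⟩
      change φ.hom u = 0
      induction hu using Submodule.smul_induction_on' with
      | smul r hr x _ => rw [map_smul]; exact hk r hr x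
      | add x _ y _ h1 h2 => rw [map_add, h1, h2, add_zero]
    rw [this, Ext.mk₀_zero]
  | succ i ih =>
    intro X _ _ _ ξ
    obtain ⟨m, f, hf⟩ := Module.Finite.exists_fin' R X
    have hS := LinearMap.shortExact_shortComplexKer hf
    haveI : Projective (ModuleCat.of R (Fin m → R)) :=
      (IsProjective.iff_projective (R := R) (Fin m → R)).1 inferInstance
    have hij : 1 + i = i + 1 := add_comm 1 i
    obtain ⟨ξ', rfl⟩ := Ext.contravariant_sequence_exact₃ hS N ξ
      (Ext.eq_zero_of_projective (P := ModuleCat.of R (Fin m → R)) _) hij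
    obtain ⟨n, hn⟩ := ih (LinearMap.ker f) ξ'
    obtain ⟨c, hc⟩ := Ideal.exists_pow_inf_eq_pow_smul J (LinearMap.ker f)
    let f' : (J ^ (n + c) • ⊤ : Submodule R (Fin m → R)) →ₗ[R] (J ^ (n + c) • ⊤ : Submodule R X) :=
      f.restrict fun u hu => by
        have := Submodule.mem_map_of_mem (f := f) hu
        rw [Submodule.map_smul''] at this
        exact (Submodule.smul_mono le_rfl le_top : _ ≤ (J ^ (n + c) • ⊤ : Submodule R X)) this
    refine ⟨n + c, ext_restrict_eq_zero (f' := f') hf ?_ (Submodule.subtype _)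
      (Submodule.subtype _) (fun u => rfl) (J ^ n • ⊤) ?_ hij ξ' hn⟩
    · rintro ⟨u, hu⟩
      have : u ∈ (J ^ (n + c) • ⊤ : Submodule R (Fin m → R)).map f := by
        rw [Submodule.map_smul'', Submodule.map_top, LinearMap.range_eq_top.2 hf]
        exact hu
      obtain ⟨w, hw, rfl⟩ := this
      exact ⟨⟨w, hw⟩, rfl⟩
    · rintro ⟨u, hu⟩ hfu
      have hfu' : f u = 0 := congrArg Subtype.val hfu
      have h1 : u ∈ (J ^ n • (⊤ : Submodule R (LinearMap.ker f))).map
          (LinearMap.ker f).subtype := by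
        rw [Submodule.map_smul'', Submodule.map_top, Submodule.range_subtype]
        have h2 : u ∈ J ^ (n + c) • ⊤ ⊓ LinearMap.ker f := ⟨hu, hfu'⟩
        rw [hc (n + c) (by lia), Nat.add_sub_cancel] at h2
        exact (Submodule.smul_mono le_rfl inf_le_right : _ ≤ J ^ n • LinearMap.ker f) h2
      obtain ⟨w, hw, hwu⟩ := h1
      have : (⟨u, hfu'⟩ : LinearMap.ker f) = w := Subtype.ext hwu.symm
      change (⟨u, hfu'⟩ : LinearMap.ker f) ∈ _
      rw [this]
      exact hw

lemma LC.eq_zero_of_powTorsion (J : Ideal R) {N : ModuleCat.{u} R} (hN : PowTorsion J N)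
    (i : ℕ) (z : LC J (i + 1) N) : z = 0 := by
  obtain ⟨t, x, rfl⟩ := LC.exists_of z
  have hf : Function.Surjective (J ^ t).mkQ := (J ^ t).mkQ_surjective
  have hS := LinearMap.shortExact_shortComplexKer hf
  haveI : Projective (ModuleCat.of R R) :=
    (IsProjective.iff_projective (R := R) R).1 inferInstance
  have hij : 1 + i = i + 1 := add_comm 1 i
  obtain ⟨ξ', rfl⟩ := Ext.contravariant_sequence_exact₃ hS N x
    (Ext.eq_zero_of_projective (P := ModuleCat.of R R) _) hij
  obtain ⟨n, hn⟩ := exists_ext_restrict_eq_zero J hN i _ ξ'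
  have hf' : Function.Surjective (J ^ (n + t)).mkQ := (J ^ (n + t)).mkQ_surjective
  rw [← LC.of_trans J _ N (Nat.le_add_left t n)]
  have := ext_restrict_eq_zero (f' := (J ^ (n + t)).mkQ) hf hf' LinearMap.id
    (Submodule.factor (Ideal.pow_le_pow_right (Nat.le_add_left t n))) (fun u => rfl)
    (J ^ n • ⊤) (by
      intro u hu
      have hu' : u ∈ J ^ (n + t) := (Submodule.Quotient.mk_eq_zero _).mp hu
      have h1 : u ∈ (J ^ n • (⊤ : Submodule R (LinearMap.ker (J ^ t).mkQ))).map
          (LinearMap.ker (J ^ t).mkQ).subtype := by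
        rw [Submodule.map_smul'', Submodule.map_top, Submodule.range_subtype,
          Submodule.ker_mkQ, smul_eq_mul, ← pow_add]
        exact hu'
      obtain ⟨w, hw, hwu⟩ := h1
      have hk : u ∈ LinearMap.ker (J ^ t).mkQ := by
        rw [Submodule.ker_mkQ]
        exact Ideal.pow_le_pow_right (Nat.le_add_left t n) hu'
      have h2 : (⟨u, hk⟩ : LinearMap.ker (J ^ t).mkQ) = w := Subtype.ext hwu.symm
      change (⟨u, hk⟩ : LinearMap.ker (J ^ t).mkQ) ∈ _
      rw [h2]
      exact hw) hij ξ' hn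
  exact (congrArg _ this).trans (map_zero _)

/-- The submodule of elements killed by a power of an ideal. -/
def powTorsionSub (J : Ideal R) (N : Type*) [AddCommGroup N] [Module R N] : Submodule R N where
  carrier := {u | ∃ k : ℕ, ∀ a ∈ J ^ k, a • u = 0}
  zero_mem' := ⟨0, by simp⟩
  add_mem' := by
    rintro u w ⟨k, hk⟩ ⟨l, hl⟩
    exact ⟨k + l, fun a ha => by
      rw [smul_add, hk a (Ideal.pow_le_pow_right (by lia) ha),
        hl a (Ideal.pow_le_pow_right (by lia) ha), add_zero]⟩
  smul_mem' := by
    rintro r u ⟨k, hk⟩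
    exact ⟨k, fun a ha => by rw [smul_comm, hk a ha, smul_zero]⟩

/-- Evaluation at `1` on the degree zero local cohomology. -/
noncomputable def LC.eval (J : Ideal R) (N : ModuleCat.{u} R) : LC J 0 N →ₗ[R] N :=
  Module.DirectLimit.lift R ℕ _ (lcTrans J 0 N)
    (fun t =>
      { toFun := fun x => (Ext.homEquiv₀ x).hom (Submodule.Quotient.mk 1 : R ⧸ J ^ t)
        map_add' := fun x y => by
          obtain ⟨φ, rfl⟩ := Ext.homEquiv₀.symm.surjective x
          obtain ⟨ψ, rfl⟩ := Ext.homEquiv₀.symm.surjective y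
          have : Ext.homEquiv₀.symm φ + Ext.homEquiv₀.symm ψ = Ext.homEquiv₀.symm (φ + ψ) :=
            (Ext.mk₀_add φ ψ).symm
          rw [this]
          simp only [Equiv.apply_symm_apply]
          rfl
        map_smul' := fun r x => by
          obtain ⟨φ, rfl⟩ := Ext.homEquiv₀.symm.surjective x
          have : r • Ext.homEquiv₀.symm φ = Ext.homEquiv₀.symm (r • φ) :=
            (Ext.mk₀_smul r φ).symm
          rw [this]
          simp only [Equiv.apply_symm_apply]
          rfl })
    (fun s t h x => by
      obtain ⟨φ, rfl⟩ := Ext.homEquiv₀.symm.surjective x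
      have : lcTrans J 0 N s t h (Ext.homEquiv₀.symm φ) = Ext.homEquiv₀.symm (powProj J h ≫ φ) :=
        Ext.mk₀_comp_mk₀ _ _
      rw [this]
      simp only [LinearMap.coe_mk, AddHom.coe_mk, Equiv.apply_symm_apply]
      rfl)

lemma LC.eval_of (J : Ideal R) (N : ModuleCat.{u} R) (t : ℕ)
    (φ : ModuleCat.of R (R ⧸ J ^ t) ⟶ N) :
    LC.eval J N (LC.of J 0 N t (Ext.mk₀ φ)) = φ.hom (Submodule.Quotient.mk 1 : R ⧸ J ^ t) := by
  refine (Module.DirectLimit.lift_of (f := lcTrans J 0 N) _ _ _).trans ?_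
  exact congrArg (fun ψ : ModuleCat.of R (R ⧸ J ^ t) ⟶ N =>
    ψ.hom (Submodule.Quotient.mk 1 : R ⧸ J ^ t)) (Ext.homEquiv₀.apply_symm_apply φ)

lemma LC.eval_injective (J : Ideal R) (N : ModuleCat.{u} R) :
    Function.Injective (LC.eval J N) := by
  rw [injective_iff_map_eq_zero]
  intro z hz
  obtain ⟨t, x, rfl⟩ := LC.exists_of z
  obtain ⟨φ, rfl⟩ := Ext.homEquiv₀.symm.surjective x
  have h : φ.hom (Submodule.Quotient.mk 1 : R ⧸ J ^ t) = 0 := (LC.eval_of J N t φ).symm.trans hz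
  have : φ = 0 := by
    ext
    exact h
  change LC.of J 0 N t (Ext.mk₀ φ) = 0
  rw [this, Ext.mk₀_zero, map_zero]

lemma LC.range_eval (J : Ideal R) (N : ModuleCat.{u} R) :
    LinearMap.range (LC.eval J N) = powTorsionSub J N := by
  apply le_antisymm
  · rintro _ ⟨z, rfl⟩
    obtain ⟨t, ht⟩ := LC.exists_pow_smul J 0 z
    exact ⟨t, fun a ha => by rw [← map_smul, ht a ha, map_zero]⟩
  · rintro u ⟨k, hk⟩
    refine ⟨LC.of J 0 N k (Ext.mk₀ (ModuleCat.ofHom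
      (Submodule.liftQ (J ^ k) (LinearMap.toSpanSingleton R N u) ?_))), ?_⟩
    · intro a ha
      exact hk a ha
    · rw [LC.eval_of]
      change (LinearMap.toSpanSingleton R N u) 1 = u
      simp

end LocalCohomologyVanishing

section ExtComparison

open Opposite

variable {R : Type u} [CommRing R]

/-- The contravariant functor `Hom(-, M)`. -/
noncomputable abbrev homInto (M : ModuleCat.{u} R) : ModuleCat.{u} R ⥤ (ModuleCat.{u} R)ᵒᵖ :=
  ((linearYoneda R (ModuleCat.{u} R)).obj M).rightOp

/-- The complex `Hom(P, M)` as a chain complex in the opposite category. -/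
noncomputable abbrev homComplex (K : ChainComplex (ModuleCat.{u} R) ℕ) (M : ModuleCat.{u} R) :
    ChainComplex (ModuleCat.{u} R)ᵒᵖ ℕ :=
  ((homInto M).mapHomologicalComplex _).obj K

variable (K : ChainComplex (ModuleCat.{u} R) ℕ) (M : ModuleCat.{u} R) (n : ℕ)

/-- Cocycles of `Hom(K, M)`. -/
noncomputable abbrev cocyc : ModuleCat.{u} R := ((homComplex K M).opcycles n).unop

/-- The underlying morphism of a cocycle. -/
noncomputable def cocycVal : cocyc K M n →ₗ[R] (K.X n ⟶ M) :=
  ((homComplex K M).pOpcycles n).unop.hom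

/-- The cohomology class of a cocycle. -/
noncomputable def cocycClass : cocyc K M n →ₗ[R] ((homComplex K M).homology n).unop :=
  ((homComplex K M).homologyι n).unop.hom

lemma cocycVal_injective : Function.Injective (cocycVal K M n) :=
  (ModuleCat.mono_iff_injective ((homComplex K M).pOpcycles n).unop).1 inferInstance

lemma cocycClass_surjective : Function.Surjective (cocycClass K M n) :=
  (ModuleCat.epi_iff_surjective ((homComplex K M).homologyι n).unop).1 inferInstance

lemma d_comp_cocycVal (m : ℕ) (z : cocyc K M n) : K.d m n ≫ cocycVal K M n z = 0 := by
  have h := (homComplex K M).d_pOpcycles m n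
  have h' := congrArg (fun φ => φ.unop.hom z) h
  exact h'

lemma exists_cocycVal (m : ℕ) (hm : n + 1 = m) (f : K.X n ⟶ M) (hf : K.d m n ≫ f = 0) :
    ∃ z, cocycVal K M n z = f := by
  let l : R →ₗ[R] (K.X n ⟶ M) := LinearMap.toSpanSingleton R _ f
  let k : (homComplex K M).X n ⟶ op (ModuleCat.of R R) := (ModuleCat.ofHom l).op
  have hk : (homComplex K M).d m n ≫ k = 0 := by
    apply Quiver.Hom.unop_inj
    apply ModuleCat.hom_ext
    apply LinearMap.ext_ring
    change K.d m n ≫ ((1 : R) • f) = 0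
    rw [one_smul, hf]
  have hprev : (ComplexShape.down ℕ).prev n = m := by
    rw [← hm]; simp
  let q := (homComplex K M).descOpcycles k m hprev hk
  have hq : (homComplex K M).pOpcycles n ≫ q = k :=
    (homComplex K M).p_descOpcycles k m hprev hk
  refine ⟨q.unop.hom (1 : R), ?_⟩
  have := congrArg (fun φ => φ.unop.hom (1 : R)) hq
  exact this.trans (one_smul R f)

lemma cocycClass_eq_zero_iff (j : ℕ) (hj : (ComplexShape.down ℕ).next n = j) (z : cocyc K M n) :
    cocycClass K M n z = 0 ↔ ∃ g : K.X j ⟶ M, K.d n j ≫ g = cocycVal K M n z := by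
  let b : (K.X j ⟶ M) →ₗ[R] cocyc K M n := ((homComplex K M).fromOpcycles n j).unop.hom
  have hb : ∀ g, cocycVal K M n (b g) = K.d n j ≫ g := fun g => by
    have h := (homComplex K M).p_fromOpcycles n j
    exact congrArg (fun φ => φ.unop.hom g) h
  constructor
  · intro hz
    let q : ((homComplex K M).opcycles n).unop ⟶ ModuleCat.of R (cocyc K M n ⧸ LinearMap.range b) :=
      ModuleCat.ofHom (LinearMap.range b).mkQ
    have hq : q.op ≫ (homComplex K M).fromOpcycles n j = 0 := by
      apply Quiver.Hom.unop_inj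
      apply ModuleCat.hom_ext
      ext g
      exact (Submodule.Quotient.mk_eq_zero _).mpr ⟨g, rfl⟩
    have hl := ((homComplex K M).homologyIsKernel n j hj).fac
      (Limits.KernelFork.ofι q.op hq) Limits.WalkingParallelPair.zero
    set l := ((homComplex K M).homologyIsKernel n j hj).lift (Limits.KernelFork.ofι q.op hq)
    have h2 : l.unop.hom (cocycClass K M n z) = (LinearMap.range b).mkQ z :=
      congrArg (fun φ => φ.unop.hom z) hl
    rw [hz, map_zero] at h2
    obtain ⟨g, hg⟩ := (Submodule.Quotient.mk_eq_zero _).mp h2.symm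
    exact ⟨g, by rw [← hg, hb]⟩
  · rintro ⟨g, hg⟩
    rw [← hb] at hg
    rw [← cocycVal_injective K M n hg]
    have h := (homComplex K M).homologyι_comp_fromOpcycles n j
    exact congrArg (fun φ => φ.unop.hom g) h

variable {K} in
lemma cocycVal_map {K' : ChainComplex (ModuleCat.{u} R) ℕ} (φ : K ⟶ K') (z : cocyc K' M n) :
    cocycVal K M n ((HomologicalComplex.opcyclesMap
      (((homInto M).mapHomologicalComplex _).map φ) n).unop.hom z) =
      φ.f n ≫ cocycVal K' M n z := by
  have h := HomologicalComplex.p_opcyclesMap (((homInto M).mapHomologicalComplex _).map φ) n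
  exact congrArg (fun φ => φ.unop.hom z) h

variable {K} in
lemma cocycClass_map {K' : ChainComplex (ModuleCat.{u} R) ℕ} (φ : K ⟶ K') (z : cocyc K' M n) :
    cocycClass K M n ((HomologicalComplex.opcyclesMap
      (((homInto M).mapHomologicalComplex _).map φ) n).unop.hom z) =
      (HomologicalComplex.homologyMap
      (((homInto M).mapHomologicalComplex _).map φ) n).unop.hom (cocycClass K' M n z) := by
  have h := HomologicalComplex.homologyι_naturality
    (((homInto M).mapHomologicalComplex _).map φ) n
  exact (congrArg (fun φ => φ.unop.hom z) h).symm

variable {X : ModuleCat.{u} R} (P : ProjectiveResolution X)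

/-- The extension class of a cocycle. -/
noncomputable def cocycExt : cocyc P.complex M n →ₗ[R] Abelian.Ext X M n where
  toFun z := P.extMk (cocycVal P.complex M n z) (n + 1) rfl (d_comp_cocycVal _ _ _ _ z)
  map_add' z w := by
    rw [P.add_extMk]
    simp
  map_smul' r z := by
    rw [RingHom.id_apply, Abelian.Ext.smul_eq_comp_mk₀, P.extMk_comp_mk₀]
    congr 1
    simp

lemma cocycExt_surjective : Function.Surjective (cocycExt M n P) := by
  intro α
  obtain ⟨f, hf, rfl⟩ := P.extMk_surjective α (n + 1) rfl
  obtain ⟨z, rfl⟩ := exists_cocycVal P.complex M n (n + 1) rfl f hf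
  exact ⟨z, rfl⟩

lemma extMk_zero_eq_zero_iff (f : P.complex.X 0 ⟶ M) (hf : P.complex.d 1 0 ≫ f = 0) :
    P.extMk f 1 rfl hf = 0 ↔ f = 0 := by
  constructor
  · intro h
    rw [← P.extEquivCohomologyClass.apply_eq_iff_eq, P.extEquivCohomologyClass_extMk,
      P.extEquivCohomologyClass_zero, CochainComplex.HomComplex.CohomologyClass.mk_eq_zero_iff,
      CochainComplex.HomComplex.Cocycle.toSingleMk_mem_coboundaries_iff _ _ _ _ _ 1 (by simp)] at h
    obtain ⟨g, hg⟩ := h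
    have h0 : P.cochainComplex.d (-(0 : ℕ) : ℤ) 1 = 0 := by
      apply Limits.IsZero.eq_of_tgt
      exact P.cochainComplex.isZero_of_isStrictlyLE 0 1
    rw [h0, Limits.zero_comp] at hg
    rw [← cancel_epi (P.cochainComplexXIso (-(0 : ℕ) : ℤ) 0 rfl).hom, ← hg, Limits.comp_zero]
  · rintro rfl
    simp

lemma ker_cocycExt : LinearMap.ker (cocycExt M n P) = LinearMap.ker (cocycClass P.complex M n) := by
  ext z
  change P.extMk (cocycVal P.complex M n z) (n + 1) rfl
    (d_comp_cocycVal _ _ _ _ z) = 0 ↔ cocycClass P.complex M n z = 0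
  cases n with
  | zero =>
    rw [cocycClass_eq_zero_iff P.complex M 0 0 (by simp), extMk_zero_eq_zero_iff]
    simp [eq_comm]
  | succ n =>
    rw [cocycClass_eq_zero_iff P.complex M (n + 1) n (by simp), P.extMk_eq_zero_iff _ _ _ _ n rfl]

/-- The class of a cocycle in the left derived functor version of `Ext`. -/
noncomputable def cocycDerived : cocyc P.complex M n →ₗ[R]
    ((Ext R (ModuleCat.{u} R) n).obj (op X)).obj M :=
  (P.isoLeftDerivedObj (homInto M) n).hom.unop.hom ∘ₗ cocycClass P.complex M n

lemma cocycDerived_surjective : Function.Surjective (cocycDerived M n P) := by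
  have h : Function.Surjective (P.isoLeftDerivedObj (homInto M) n).hom.unop.hom :=
    (ModuleCat.epi_iff_surjective (P.isoLeftDerivedObj (homInto M) n).hom.unop).1 inferInstance
  exact h.comp (cocycClass_surjective _ _ _)

lemma ker_cocycDerived :
    LinearMap.ker (cocycDerived M n P) = LinearMap.ker (cocycClass P.complex M n) := by
  have h : Function.Injective (P.isoLeftDerivedObj (homInto M) n).hom.unop.hom :=
    (ModuleCat.mono_iff_injective (P.isoLeftDerivedObj (homInto M) n).hom.unop).1 inferInstance
  exact LinearMap.ker_comp_of_ker_eq_bot _ (LinearMap.ker_eq_bot.2 h)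

variable {M n P} in
lemma cocyc_naturality {X' : ModuleCat.{u} R} {P' : ProjectiveResolution X'} {f : X' ⟶ X}
    (φ : ProjectiveResolution.Hom P' P f) (z : cocyc P.complex M n) :
    ∃ w : cocyc P'.complex M n,
      (Abelian.Ext.mk₀ f).comp (cocycExt M n P z) (zero_add n) = cocycExt M n P' w ∧
      (((Ext R (ModuleCat.{u} R) n).map f.op).app M).hom (cocycDerived M n P z) =
        cocycDerived M n P' w := by
  refine ⟨(HomologicalComplex.opcyclesMap
      (((homInto M).mapHomologicalComplex _).map φ.hom) n).unop.hom z, ?_, ?_⟩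
  · refine (ProjectiveResolution.mk₀_comp_extMk (cocycVal P.complex M n z) (n + 1) rfl
      (d_comp_cocycVal _ _ _ _ z) φ).trans ?_
    change _ = P'.extMk _ (n + 1) rfl (d_comp_cocycVal _ _ _ _ _)
    congr 1
    exact (cocycVal_map M n φ.hom z).symm
  · have hn := ProjectiveResolution.isoLeftDerivedObj_hom_naturality f P' P φ.hom
      φ.hom_f_zero_comp_π_f_zero (homInto M) n
    have h := congrArg (fun ψ => ψ.unop.hom (cocycClass P.complex M n z)) hn
    refine Eq.trans h ?_
    exact congrArg (P'.isoLeftDerivedObj (homInto M) n).hom.unop.hom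
      (cocycClass_map M n φ.hom z).symm

lemma exists_linearEquiv_of_ker_eq {A B C : Type*} [AddCommGroup A] [AddCommGroup B]
    [AddCommGroup C] [Module R A] [Module R B] [Module R C] (f : A →ₗ[R] B) (g : A →ₗ[R] C)
    (hf : Function.Surjective f) (hg : Function.Surjective g)
    (h : LinearMap.ker f = LinearMap.ker g) : ∃ e : B ≃ₗ[R] C, ∀ a, e (f a) = g a := by
  refine ⟨(f.quotKerEquivOfSurjective hf).symm ≪≫ₗ Submodule.quotEquivOfEq _ _ h ≪≫ₗ
    g.quotKerEquivOfSurjective hg, fun a => ?_⟩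
  have : (f.quotKerEquivOfSurjective hf).symm (f a) = Submodule.Quotient.mk a := by
    rw [LinearEquiv.symm_apply_eq]
    rfl
  simp only [LinearEquiv.trans_apply, this, Submodule.quotEquivOfEq_mk]
  rfl

/-- The comparison between the two versions of `Ext`. -/
noncomputable def extComparison (X : ModuleCat.{u} R) :
    Abelian.Ext X M n ≃ₗ[R] ((Ext R (ModuleCat.{u} R) n).obj (op X)).obj M :=
  (exists_linearEquiv_of_ker_eq _ _ (cocycExt_surjective M n (projectiveResolution X))
    (cocycDerived_surjective M n (projectiveResolution X))
    ((ker_cocycExt M n _).trans (ker_cocycDerived M n _).symm)).choose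

lemma extComparison_cocycExt (X : ModuleCat.{u} R)
    (z : cocyc (projectiveResolution X).complex M n) :
    extComparison M n X (cocycExt M n _ z) = cocycDerived M n _ z :=
  (exists_linearEquiv_of_ker_eq _ _ (cocycExt_surjective M n (projectiveResolution X))
    (cocycDerived_surjective M n (projectiveResolution X))
    ((ker_cocycExt M n _).trans (ker_cocycDerived M n _).symm)).choose_spec z

lemma extComparison_naturality {X X' : ModuleCat.{u} R} (f : X' ⟶ X) (x : Abelian.Ext X M n) :
    extComparison M n X' ((Abelian.Ext.mk₀ f).comp x (zero_add n)) =
      (((Ext R (ModuleCat.{u} R) n).map f.op).app M).hom (extComparison M n X x) := by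
  obtain ⟨z, rfl⟩ := cocycExt_surjective M n (projectiveResolution X) x
  let φ : ProjectiveResolution.Hom (projectiveResolution X') (projectiveResolution X) f :=
    { hom := ProjectiveResolution.lift f _ _
      hom_f_zero_comp_π_f_zero := by
        have := ProjectiveResolution.lift_commutes f (projectiveResolution X')
          (projectiveResolution X)
        exact congrArg (fun ψ => ψ.f 0) this }
  obtain ⟨w, h1, h2⟩ := cocyc_naturality φ z
  rw [extComparison_cocycExt, h1, extComparison_cocycExt]
  exact h2.symm

/-- The evaluation at `M` of the diagram defining local cohomology. -/
noncomputable abbrev lcDiagram (J : Ideal R) (i : ℕ) (M : ModuleCat.{u} R) :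
    ℕᵒᵖᵒᵖ ⥤ ModuleCat.{u} R :=
  localCohomology.diagram (localCohomology.idealPowersDiagram J) i ⋙ (evaluation _ _).obj M

instance : Limits.PreservesColimitsOfShape ℕᵒᵖᵒᵖ (forget (ModuleCat.{u} R)) := by
  haveI : Limits.PreservesFilteredColimitsOfSize.{0, 0} (forget (ModuleCat.{u} R)) :=
    Limits.preservesFilteredColimitsOfSize_shrink.{0, u, 0, u} _
  exact Limits.PreservesFilteredColimitsOfSize.preserves_filtered_colimits _

lemma length_localCohomology (J : Ideal R) (i : ℕ) (M : ModuleCat.{u} R) :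
    Module.length R ((localCohomology J i).obj M) = Module.length R (LC J i M) := by
  let G := lcDiagram J i M
  let ι (t : ℕ) := (Limits.colimit.ι G (op (op t))).hom
  let E (t : ℕ) : Abelian.Ext (ModuleCat.of R (R ⧸ J ^ t)) M i ≃ₗ[R] G.obj (op (op t)) :=
    extComparison M i (ModuleCat.of R (R ⧸ J ^ t))
  have hE : ∀ s t (h : s ≤ t) (x : Abelian.Ext (ModuleCat.of R (R ⧸ J ^ s)) M i),
      E t (lcTrans J i M s t h x) = (G.map (homOfLE h).op.op).hom (E s x) :=
    fun s t h x => extComparison_naturality M i (powProj J h) x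
  let L : LC J i M →ₗ[R] (Limits.colimit G : ModuleCat.{u} R) :=
    Module.DirectLimit.lift R ℕ _ (lcTrans J i M) (fun t => ι t ∘ₗ (E t).toLinearMap) (by
      intro s t h x
      change ι t (E t (lcTrans J i M s t h x)) = ι s (E s x)
      rw [hE]
      exact congrArg (fun ψ => ψ.hom (E s x)) (Limits.colimit.w G (homOfLE h).op.op))
  have hL : ∀ t x, L (LC.of J i M t x) = ι t (E t x) := fun t x =>
    Module.DirectLimit.lift_of (f := lcTrans J i M) _ _ _
  have hinj : Function.Injective L := by
    rw [injective_iff_map_eq_zero]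
    intro z hz
    obtain ⟨t, x, rfl⟩ := LC.exists_of z
    rw [hL] at hz
    obtain ⟨k, f, g, hfg⟩ := Limits.Concrete.colimit_exists_of_rep_eq G (i := op (op t))
      (j := op (op t)) (E t x) 0 (hz.trans (map_zero (ι t)).symm)
    have hk : t ≤ k.unop.unop := f.unop.unop.le
    have hf : f = (homOfLE hk).op.op := Subsingleton.elim _ _
    have h0 : (G.map (homOfLE hk).op.op).hom (E t x) = 0 := by
      rw [← hf]
      exact hfg.trans (map_zero (G.map g).hom)
    have h1 : E _ (lcTrans J i M t _ hk x) = 0 := (hE t _ hk x).trans h0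
    rw [map_eq_zero_iff _ (E _).injective] at h1
    rw [← LC.of_trans J i M hk]
    exact (congrArg _ h1).trans (map_zero _)
  have hsurj : Function.Surjective L := by
    intro y
    obtain ⟨k, x, hx⟩ := Limits.Concrete.colimit_exists_rep G y
    obtain ⟨w, hw⟩ := (E k.unop.unop).surjective x
    exact ⟨LC.of J i M _ w, by rw [hL, hw]; exact hx⟩
  have e1 := (LinearEquiv.ofBijective L ⟨hinj, hsurj⟩).length_eq
  have e2 := (Limits.colimitObjIsoColimitCompEvaluation
    (localCohomology.diagram (localCohomology.idealPowersDiagram J) i) M).toLinearEquiv.length_eq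
  exact e2.trans e1.symm

end ExtComparison

section LongExactSequence

open Abelian

variable {R : Type u} [CommRing R] (J : Ideal R)
variable {A B C : Type u} [AddCommGroup A] [Module R A] [AddCommGroup B] [Module R B]
  [AddCommGroup C] [Module R C]

/-- Local cohomology of an unbundled module. -/
abbrev lc (i : ℕ) (A : Type u) [AddCommGroup A] [Module R A] : Type u :=
  LC J i (ModuleCat.of R A)

/-- The map on local cohomology induced by a linear map. -/
noncomputable def lcMap (i : ℕ) (f : A →ₗ[R] B) : lc J i A →ₗ[R] lc J i B :=
  LC.map J (Ext.mk₀ (ModuleCat.ofHom f)) (add_zero i)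

lemma lcMap_lsmul (i : ℕ) (r : R) (z : lc J i A) :
    lcMap J i (LinearMap.lsmul R A r) z = r • z :=
  LC.map_smul_id J r i z

lemma LC.exists_delta {S : ShortComplex (ModuleCat.{u} R)} (hS : S.ShortExact) (i : ℕ) :
    ∃ δ : LC J i S.X₃ →ₗ[R] LC J (i + 1) S.X₁,
      Function.Exact (LC.map J (i := i) (Ext.mk₀ S.f) (add_zero i))
        (LC.map J (i := i) (Ext.mk₀ S.g) (add_zero i)) ∧
      Function.Exact (LC.map J (i := i) (Ext.mk₀ S.g) (add_zero i)) δ ∧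
      Function.Exact δ (LC.map J (i := i + 1) (Ext.mk₀ S.f) (add_zero (i + 1))) := by
  refine ⟨LC.map (i := i) (j := i + 1) (k := 1) J hS.extClass rfl, ?_, ?_, ?_⟩
  · refine LC.exact J (Ext.mk₀ S.f) (Ext.mk₀ S.g) (add_zero i) (add_zero i) fun X x => ⟨fun h =>
      Ext.covariant_sequence_exact₂ X hS x h, ?_⟩
    rintro ⟨y, rfl⟩
    simp [S.zero]
  · refine LC.exact J (Ext.mk₀ S.g) hS.extClass (add_zero i) rfl fun X x => ⟨fun h =>
      Ext.covariant_sequence_exact₃ X hS x rfl h, ?_⟩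
    rintro ⟨y, rfl⟩
    simp [Ext.comp_assoc_of_second_deg_zero]
  · have hex : ∀ (X : ModuleCat.{u} R) (x : Ext X S.X₁ (i + 1)),
        x.comp (Ext.mk₀ S.f) (add_zero (i + 1)) = 0 ↔
          ∃ y : Ext X S.X₃ i, y.comp hS.extClass (rfl : i + 1 = i + 1) = x := by
      refine fun X x => ⟨fun h => Ext.covariant_sequence_exact₁ X hS x h rfl, ?_⟩
      rintro ⟨y, rfl⟩
      simp [Ext.comp_assoc_of_third_deg_zero]
    exact LC.exact (i := i) (j := i + 1) (n := i + 1) (k := 1) (l := 0) J hS.extClass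
      (Ext.mk₀ S.f) (rfl : i + 1 = i + 1) (add_zero (i + 1)) hex

lemma lc_exists_delta (f : A →ₗ[R] B) (g : B →ₗ[R] C) (hf : Function.Injective f)
    (hg : Function.Surjective g) (hfg : Function.Exact f g) (i : ℕ) :
    ∃ δ : lc J i C →ₗ[R] lc J (i + 1) A, Function.Exact (lcMap J i f) (lcMap J i g) ∧
      Function.Exact (lcMap J i g) δ ∧ Function.Exact δ (lcMap J (i + 1) f) := by
  let S := ModuleCat.shortComplexOfCompEqZero f g hfg.linearMap_comp_eq_zero
  have hS : S.ShortExact := ModuleCat.shortComplex_shortExact S hfg hf hg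
  exact LC.exists_delta J hS i

end LongExactSequence

section LocalCohomologyQuotient

variable {R : Type u} [CommRing R] [IsLocalRing R] [IsNoetherianRing R]
  {M : Type u} [AddCommGroup M] [Module R M]

/-- Local cohomology with support in the maximal ideal. -/
abbrev Hm (R : Type u) [CommRing R] [IsLocalRing R] (i : ℕ) (M : Type u) [AddCommGroup M]
    [Module R M] : Type u :=
  lc (maximalIdeal R) i M

lemma hm_zero_eq_zero (hM : TorsionFree R M) (z : Hm R 0 M) : z = 0 := by
  apply LC.eval_injective
  rw [map_zero]
  have : LC.eval (maximalIdeal R) (ModuleCat.of R M) z ∈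
      powTorsionSub (maximalIdeal R) (ModuleCat.of R M) := by
    rw [← LC.range_eval]
    exact ⟨z, rfl⟩
  obtain ⟨k, hk⟩ := this
  exact hM.eq_zero_of_pow k _ hk

lemma hm_exact_of_regular {x : R} (hx : RegularOn x M) (i : ℕ) :
    ∃ (α : Hm R i M →ₗ[R] Hm R i (M ⧸ mulRange x M))
      (β : Hm R i (M ⧸ mulRange x M) →ₗ[R] Hm R (i + 1) M),
      Function.Exact (LinearMap.lsmul R (Hm R i M) x) α ∧ Function.Exact α β ∧
        Function.Exact β (LinearMap.lsmul R (Hm R (i + 1) M) x) := by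
  obtain ⟨δ, h1, h2, h3⟩ := lc_exists_delta (maximalIdeal R) (LinearMap.lsmul R M x)
    (mulRange x M).mkQ (fun _ _ h => hx.smul_left_cancel h) (Submodule.mkQ_surjective _)
    (LinearMap.exact_iff.mpr (Submodule.ker_mkQ _)) i
  refine ⟨_, δ, fun z => ?_, h2, fun z => ?_⟩
  · rw [h1 z]
    exact exists_congr fun w => by rw [lcMap_lsmul]; rfl
  · rw [← h3 z, lcMap_lsmul]
    rfl

lemma hm_factor_bijective [Module.Finite R M] (x : R) (i : ℕ) : Function.Bijective
    (lcMap (maximalIdeal R) (i + 1) (Submodule.factor (le_sat (mulRange x M)))) := by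
  set g := Submodule.factor (le_sat (mulRange x M)) with hg
  have hT : PowTorsion (maximalIdeal R) (LinearMap.ker g) := by
    rintro ⟨v, hv⟩
    obtain ⟨v, rfl⟩ := Submodule.mkQ_surjective _ v
    have h : v ∈ satMul x M := (Submodule.Quotient.mk_eq_zero _).mp hv
    obtain ⟨k, hk⟩ := h
    refine ⟨k, fun a ha => Subtype.ext ?_⟩
    exact (Submodule.Quotient.mk_eq_zero _).mpr (hk a ha)
  have hE : Function.Exact (LinearMap.ker g).subtype g :=
    LinearMap.exact_iff.mpr (by simp)
  have hs : Function.Surjective g := Submodule.factor_surjective _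
  obtain ⟨δ, h1, h2, -⟩ := lc_exists_delta (maximalIdeal R) _ g
    (Submodule.subtype_injective _) hs hE (i + 1)
  constructor
  · rw [injective_iff_map_eq_zero]
    intro z hz
    obtain ⟨w, rfl⟩ := (h1 z).1 hz
    rw [LC.eq_zero_of_powTorsion (maximalIdeal R) (N := ModuleCat.of R (LinearMap.ker g)) hT i w,
      map_zero]
  · intro z
    exact (h2 z).1
      (LC.eq_zero_of_powTorsion (maximalIdeal R) (N := ModuleCat.of R (LinearMap.ker g)) hT _ _)

lemma hm_exact_satMul [Module.Finite R M] {x : R} (hx : RegularOn x M) (i : ℕ) :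
    ∃ (α : Hm R (i + 1) M →ₗ[R] Hm R (i + 1) (M ⧸ satMul x M))
      (β : Hm R (i + 1) (M ⧸ satMul x M) →ₗ[R] Hm R (i + 2) M),
      Function.Exact (LinearMap.lsmul R (Hm R (i + 1) M) x) α ∧ Function.Exact α β ∧
        Function.Exact β (LinearMap.lsmul R (Hm R (i + 2) M) x) := by
  obtain ⟨α, β, h1, h2, h3⟩ := hm_exact_of_regular hx (i + 1)
  let e := LinearEquiv.ofBijective _ (hm_factor_bijective (M := M) x i)
  refine ⟨e.toLinearMap ∘ₗ α, β ∘ₗ e.symm.toLinearMap, fun z => ?_, fun z => ?_, fun z => ?_⟩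
  · rw [← h1 z]
    exact map_eq_zero_iff e e.injective
  · change β (e.symm z) = 0 ↔ _
    rw [h2]
    refine exists_congr fun w => ?_
    rw [LinearEquiv.eq_symm_apply]
    rfl
  · rw [h3 z]
    constructor
    · rintro ⟨w, rfl⟩
      exact ⟨e w, congrArg β (e.symm_apply_apply w)⟩
    · rintro ⟨w, rfl⟩
      exact ⟨e.symm w, rfl⟩

lemma relLength_satMul_eq [Module.Finite R M] {x : R} (hM : TorsionFree R M)
    (hx : RegularOn x M) :
    relLength (mulRange x M) (satMul x M) =
      Module.length R (LinearMap.ker (LinearMap.lsmul R (Hm R 1 M) x)) := by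
  obtain ⟨α, β, h1, h2, h3⟩ := hm_exact_of_regular hx 0
  have hβ : Function.Injective β := by
    rw [injective_iff_map_eq_zero]
    intro z hz
    obtain ⟨w, rfl⟩ := (h2 z).1 hz
    rw [hm_zero_eq_zero hM w, map_zero]
  have e1 := (LinearEquiv.ofInjective β hβ).length_eq
  have e2 := (LinearEquiv.ofInjective _
    (LC.eval_injective (maximalIdeal R) (ModuleCat.of R (M ⧸ mulRange x M)))).length_eq
  rw [LinearMap.exact_iff.mp h3, ← e1, e2, LC.range_eval, ← length_ker_factor_satMul]
  have : LinearMap.ker (Submodule.factor (le_sat (mulRange x M))) =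
      powTorsionSub (maximalIdeal R) (M ⧸ mulRange x M) := by
    ext v
    obtain ⟨v, rfl⟩ := Submodule.mkQ_surjective _ v
    constructor
    · intro hv
      obtain ⟨k, hk⟩ : v ∈ satMul x M := (Submodule.Quotient.mk_eq_zero _).mp hv
      exact ⟨k, fun a ha => (Submodule.Quotient.mk_eq_zero _).mpr (hk a ha)⟩
    · rintro ⟨k, hk⟩
      have : v ∈ satMul x M := ⟨k, fun a ha => (Submodule.Quotient.mk_eq_zero _).mp (hk a ha)⟩
      exact (Submodule.Quotient.mk_eq_zero _).mpr this
  rw [this]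

/-- The local cohomology modules in degrees below `s` have finite length. -/
def FinLC (R : Type u) [CommRing R] [IsLocalRing R] (s : ℕ) (M : Type u) [AddCommGroup M]
    [Module R M] : Prop :=
  ∀ i < s, Module.length R (Hm R i M) ≠ ⊤

/-- The length of local cohomology. -/
noncomputable def lcLen (R : Type u) [CommRing R] [IsLocalRing R] (i : ℕ) (M : Type u)
    [AddCommGroup M] [Module R M] : ℕ :=
  len R (Hm R i M)

lemma length_hm_zero (hM : TorsionFree R M) : Module.length R (Hm R 0 M) = 0 := by
  rw [Module.length_eq_zero_iff]
  exact ⟨fun a b => by rw [hm_zero_eq_zero hM a, hm_zero_eq_zero hM b]⟩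

lemma lcLen_zero (hM : TorsionFree R M) : lcLen R 0 M = 0 := by
  unfold lcLen len
  rw [length_hm_zero hM]
  rfl

/-- Multiplication by `x` annihilates the module. -/
def KilledBy (x : R) (H : Type*) [AddCommGroup H] [Module R H] : Prop :=
  ∀ z : H, x • z = 0

lemma len_ker_lsmul_le {H : Type*} [AddCommGroup H] [Module R H] (x : R)
    (h : Module.length R H ≠ ⊤) : len R (LinearMap.ker (LinearMap.lsmul R H x)) ≤ len R H :=
  len_le_of_injective _ (Submodule.subtype_injective _) h

lemma len_ker_lsmul_eq_iff {H : Type*} [AddCommGroup H] [Module R H] (x : R)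
    (h : Module.length R H ≠ ⊤) :
    len R (LinearMap.ker (LinearMap.lsmul R H x)) = len R H ↔ KilledBy x H := by
  have h1 := len_add_of_exact (LinearMap.ker (LinearMap.lsmul R H x)).subtype
    (LinearMap.lsmul R H x).rangeRestrict (Submodule.subtype_injective _)
    (LinearMap.surjective_rangeRestrict _) (LinearMap.exact_iff.mpr (by
      rw [LinearMap.ker_rangeRestrict, Submodule.range_subtype])) h
  have h2 : Module.length R (LinearMap.range (LinearMap.lsmul R H x)) ≠ ⊤ :=
    length_ne_top_of_injective _ (Submodule.subtype_injective _) h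
  constructor
  · intro he z
    have h0 : len R (LinearMap.range (LinearMap.lsmul R H x)) = 0 := by omega
    have h3 := coe_len h2
    rw [h0] at h3
    have h4 := Module.length_eq_zero_iff.mp h3.symm
    exact congrArg Subtype.val (h4.elim ⟨x • z, z, rfl⟩ 0)
  · intro hk
    have : LinearMap.ker (LinearMap.lsmul R H x) = ⊤ := by
      rw [LinearMap.ker_eq_top]
      ext z
      exact hk z
    rw [this]
    exact len_eq_of_equiv Submodule.topEquiv

lemma len_coker_lsmul_eq {H : Type*} [AddCommGroup H] [Module R H] (x : R)
    (h : Module.length R H ≠ ⊤) :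
    len R (H ⧸ mulRange x H) = len R (LinearMap.ker (LinearMap.lsmul R H x)) := by
  have h1 := len_add_of_exact (LinearMap.ker (LinearMap.lsmul R H x)).subtype
    (LinearMap.lsmul R H x).rangeRestrict (Submodule.subtype_injective _)
    (LinearMap.surjective_rangeRestrict _) (LinearMap.exact_iff.mpr (by
      rw [LinearMap.ker_rangeRestrict, Submodule.range_subtype])) h
  have h2 := len_add_of_exact (mulRange x H).subtype (mulRange x H).mkQ
    (Submodule.subtype_injective _) (Submodule.mkQ_surjective _) (LinearMap.exact_iff.mpr (by
      rw [Submodule.ker_mkQ, Submodule.range_subtype])) h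
  change len R H = _ + len R (mulRange x H) at h1
  omega

lemma length_hm_satMul [Module.Finite R M] {x : R} (hx : RegularOn x M) (i : ℕ) :
    Module.length R (Hm R (i + 1) (M ⧸ satMul x M)) =
      Module.length R (Hm R (i + 1) M ⧸ mulRange x (Hm R (i + 1) M)) +
        Module.length R (LinearMap.ker (LinearMap.lsmul R (Hm R (i + 2) M) x)) := by
  obtain ⟨α, β, h1, h2, h3⟩ := hm_exact_satMul hx i
  have e1 := ((Submodule.quotEquivOfEq _ _ (LinearMap.exact_iff.mp h1).symm).trans
    α.quotKerEquivRange).length_eq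
  have e2 := LinearMap.exact_iff.mp h3
  have e3 := Module.length_eq_add_of_exact (LinearMap.range α).subtype β.rangeRestrict
    (Submodule.subtype_injective _) (LinearMap.surjective_rangeRestrict _)
    (LinearMap.exact_iff.mpr (by
      rw [LinearMap.ker_rangeRestrict, Submodule.range_subtype, LinearMap.exact_iff.mp h2]))
  rw [e3, e1, e2]

lemma FinLC.satMul [Module.Finite R M] {s : ℕ} (h : FinLC R (s + 1) M) {x : R}
    (hx : RegularOn x M) : FinLC R s (M ⧸ satMul x M) := by
  intro i hi
  rcases i with _ | i
  · rw [length_hm_zero (torsionFree_quotient_sat _)]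
    simp
  · rw [length_hm_satMul hx i]
    exact WithTop.add_ne_top.2
      ⟨length_ne_top_of_surjective _ (Submodule.mkQ_surjective _) (h _ (by omega)),
        length_ne_top_of_injective _ (Submodule.subtype_injective _) (h _ (by omega))⟩

lemma lcLen_satMul [Module.Finite R M] {s : ℕ} (h : FinLC R s M) {x : R} (hx : RegularOn x M)
    {i : ℕ} (hi : i + 2 < s) :
    lcLen R (i + 1) (M ⧸ satMul x M) =
      len R (LinearMap.ker (LinearMap.lsmul R (Hm R (i + 1) M) x)) +
        len R (LinearMap.ker (LinearMap.lsmul R (Hm R (i + 2) M) x)) := by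
  have h1 : Module.length R (Hm R (i + 1) M) ≠ ⊤ := h _ (by omega)
  have h2 : Module.length R (Hm R (i + 2) M) ≠ ⊤ := h _ hi
  rw [← len_coker_lsmul_eq x h1]
  unfold lcLen len
  rw [length_hm_satMul hx i, ENat.toNat_add]
  · exact length_ne_top_of_surjective _ (Submodule.mkQ_surjective _) h1
  · exact length_ne_top_of_injective _ (Submodule.subtype_injective _) h2

lemma satLen_eq [Module.Finite R M] {x : R} (hM : TorsionFree R M) (hx : RegularOn x M) :
    satLen x M = len R (LinearMap.ker (LinearMap.lsmul R (Hm R 1 M) x)) := by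
  unfold satLen relLen len
  rw [relLength_satMul_eq hM hx]

end LocalCohomologyQuotient

section GenericElements

lemma exists_add_notMem_of_finset {R : Type*} [CommRing R] (I : Ideal R) (x : R) (n : ℕ) :
    ∀ T : Finset (Ideal R), T.card = n → (∀ p ∈ T, p.IsPrime) →
      (∀ p ∈ T, ¬ Ideal.span {x} ⊔ I ≤ p) → ∃ c ∈ I, ∀ p ∈ T, x + c ∉ p := by
  classical
  induction n with
  | zero =>
    intro T hT _ _
    rw [Finset.card_eq_zero] at hT
    subst hT
    exact ⟨0, I.zero_mem, by simp⟩
  | succ n ih =>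
    intro T hT hp hn
    have hne : T.Nonempty := Finset.card_pos.mp (by omega)
    obtain ⟨p, hpT, hmin⟩ := Finset.exists_minimal hne
    obtain ⟨c, hc, hcT⟩ := ih (T.erase p) (by rw [Finset.card_erase_of_mem hpT]; omega)
      (fun q hq => hp q (Finset.mem_of_mem_erase hq))
      (fun q hq => hn q (Finset.mem_of_mem_erase hq))
    by_cases hxp : x + c ∈ p
    · haveI := hp p hpT
      have hI : ¬ I ≤ p := fun hI => hn p hpT (sup_le (by
        rw [Ideal.span_singleton_le_iff_mem]
        simpa using p.sub_mem hxp (hI hc)) hI)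
      have hprod : ¬ I * ∏ q ∈ T.erase p, q ≤ p := by
        rw [Ideal.IsPrime.mul_le (hp p hpT), Ideal.IsPrime.prod_le (hp p hpT)]
        rintro (h | ⟨q, hq, hqp⟩)
        · exact hI h
        · exact Finset.ne_of_mem_erase hq
            (le_antisymm hqp (hmin (Finset.mem_of_mem_erase hq) hqp))
      obtain ⟨d, hd, hdp⟩ := SetLike.not_le_iff_exists.mp hprod
      refine ⟨c + d, I.add_mem hc (Ideal.mul_le_left hd), fun q hq h => ?_⟩
      by_cases hqp : q = p
      · subst hqp
        apply hdp
        have := q.sub_mem h hxp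
        rwa [show x + (c + d) - (x + c) = d by ring] at this
      · have hq' : q ∈ T.erase p := Finset.mem_erase.mpr ⟨hqp, hq⟩
        have h5 : ∏ q ∈ T.erase p, q ≤ q := Ideal.le_of_dvd (Finset.dvd_prod_of_mem (fun q => q) hq')
        have hdq : d ∈ q := h5 (Ideal.mul_le_right hd)
        apply hcT q hq'
        have := q.sub_mem h hdq
        rwa [show x + (c + d) - d = x + c by ring] at this
    · refine ⟨c, hc, fun q hq => ?_⟩
      by_cases hqp : q = p
      · rwa [hqp]
      · exact hcT q (Finset.mem_erase.mpr ⟨hqp, hq⟩)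

lemma exists_add_notMem {R : Type*} [CommRing R] (I : Ideal R) (x : R) {T : Set (Ideal R)}
    (hT : T.Finite) (hp : ∀ p ∈ T, p.IsPrime) (hn : ∀ p ∈ T, ¬ Ideal.span {x} ⊔ I ≤ p) :
    ∃ c ∈ I, ∀ p ∈ T, x + c ∉ p := by
  obtain ⟨c, hc, h⟩ := exists_add_notMem_of_finset I x _ hT.toFinset rfl (by simpa using hp)
    (by simpa using hn)
  exact ⟨c, hc, by simpa using h⟩

variable {R : Type v} [CommRing R] [IsLocalRing R] [IsNoetherianRing R]
  {M : Type u} [AddCommGroup M] [Module R M]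

/-- Parameter ideals with specified generators. -/
structure ParList (Q : Ideal R) (l : List R) (M : Type u) [AddCommGroup M] [Module R M] :
    Prop where
  le : Q ≤ maximalIdeal R
  pow : ∃ a, (maximalIdeal R ^ a • ⊤ : Submodule R M) ≤ Q • ⊤
  mem : ∀ y ∈ l, y ∈ Q
  gen : (Q • ⊤ : Submodule R M) ≤ Ideal.ofList l • ⊤

lemma ParList.par {Q : Ideal R} {l : List R} (h : ParList Q l M) : Par l.length Q M :=
  ⟨h.le, h.pow, l, rfl, h.mem, h.gen⟩

lemma Par.exists_parList {s : ℕ} {Q : Ideal R} (h : Par s Q M) :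
    ∃ l, l.length = s ∧ ParList Q l M := by
  obtain ⟨l, hl, hQ, hle⟩ := h.gen
  exact ⟨l, hl, h.le, h.pow, hQ, hle⟩

lemma ParList.of_surjective {N : Type u} [AddCommGroup N] [Module R N] {Q : Ideal R} {l : List R}
    (h : ParList Q l M) (f : M →ₗ[R] N) (hf : Function.Surjective f) : ParList Q l N := by
  obtain ⟨h1, ⟨a, ha⟩, hlQ, hle⟩ := h
  exact ⟨h1, ⟨a, smul_top_le_of_surjective f hf ha⟩, hlQ, smul_top_le_of_surjective f hf hle⟩

lemma ParList.of_ofList_le {Q : Ideal R} {l l' : List R} (h : ParList Q l M)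
    (hQ : ∀ y ∈ l', y ∈ Q) (hle : Ideal.ofList l ≤ Ideal.ofList l') : ParList Q l' M :=
  ⟨h.le, h.pow, hQ, h.gen.trans (smul_top_mono hle)⟩

lemma ParList.swap {Q : Ideal R} {a b : R} {l : List R} (h : ParList Q (a :: b :: l) M) :
    ParList Q (b :: a :: l) M :=
  h.of_ofList_le (fun y hy => h.mem y (by
    simp only [List.mem_cons] at hy ⊢
    tauto)) (le_of_eq (by simp only [Ideal.ofList_cons, sup_left_comm]))

lemma ParList.quotient {Q : Ideal R} {x : R} {l : List R} (h : ParList Q (x :: l) M) :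
    ParList Q l (M ⧸ mulRange x M) := by
  have h' := h.of_surjective (mulRange x M).mkQ (Submodule.mkQ_surjective _)
  refine ⟨h'.le, h'.pow, fun y hy => h.mem y (List.mem_cons_of_mem _ hy), h'.gen.trans ?_⟩
  rw [Ideal.ofList_cons_smul]
  refine sup_le ?_ le_rfl
  intro v hv
  obtain ⟨w, -, rfl⟩ := hv
  obtain ⟨w, rfl⟩ := Submodule.mkQ_surjective _ w
  have : (x • (mulRange x M).mkQ w) = 0 := by
    rw [← map_smul]
    exact (Submodule.Quotient.mk_eq_zero _).mpr ⟨w, rfl⟩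
  change x • (mulRange x M).mkQ w ∈ _
  rw [this]
  exact zero_mem _

lemma ParList.not_le [Module.Finite R M] {Q : Ideal R} {l : List R} (h : ParList Q l M)
    {p : Ideal R} (hp : p.IsPrime) (hpm : p ≠ maximalIdeal R) (hann : Module.annihilator R M ≤ p) :
    ¬ Ideal.ofList l ≤ p := by
  intro hle
  obtain ⟨a, ha⟩ := h.pow
  have ha' := ha.trans h.gen
  let P : PrimeSpectrum R := ⟨p, hp⟩
  have h1 : P ∈ Module.support R (M ⧸ (Ideal.ofList l • ⊤ : Submodule R M)) := by
    rw [Module.support_quotient]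
    exact ⟨Module.mem_support_iff_of_finite.mpr hann, hle⟩
  have h2 := Module.mem_support_iff_of_finite.mp h1
  have h3 : maximalIdeal R ^ a ≤ p := by
    refine le_trans ?_ h2
    intro r hr
    rw [Module.mem_annihilator]
    intro v
    obtain ⟨v, rfl⟩ := Submodule.mkQ_surjective _ v
    rw [← map_smul]
    exact (Submodule.Quotient.mk_eq_zero _).mpr
      (ha' (Submodule.smul_mem_smul hr (Submodule.mem_top (x := v))))
  exact hpm (le_antisymm (le_maximalIdeal hp.ne_top) (hp.le_of_pow_le h3))

/-- A finite set of primes in the support of `M` that are not maximal. -/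
structure Avoidable (T : Set (Ideal R)) (M : Type u) [AddCommGroup M] [Module R M] : Prop where
  finite : T.Finite
  prime : ∀ p ∈ T, p.IsPrime
  ne : ∀ p ∈ T, p ≠ maximalIdeal R
  ann : ∀ p ∈ T, Module.annihilator R M ≤ p

lemma Avoidable.union {T T' : Set (Ideal R)} (h : Avoidable T M) (h' : Avoidable T' M) :
    Avoidable (T ∪ T') M where
  finite := h.finite.union h'.finite
  prime p hp := hp.elim (h.prime p) (h'.prime p)
  ne p hp := hp.elim (h.ne p) (h'.ne p)
  ann p hp := hp.elim (h.ann p) (h'.ann p)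

lemma Avoidable.of_surjective {N : Type u} [AddCommGroup N] [Module R N] {T : Set (Ideal R)}
    (h : Avoidable T N) (f : M →ₗ[R] N) (hf : Function.Surjective f) : Avoidable T M :=
  ⟨h.finite, h.prime, h.ne, fun p hp =>
    (LinearMap.annihilator_le_of_surjective f hf).trans (h.ann p hp)⟩

lemma TorsionFree.avoidable [Module.Finite R M] (h : TorsionFree R M) :
    Avoidable (associatedPrimes R M) M where
  finite := associatedPrimes.finite R M
  prime p hp := hp.isPrime
  ne p hp hpm := by
    obtain ⟨h1, u, hu⟩ := isAssociatedPrime_iff.mp hp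
    have : u = 0 := h u fun a ha => by
      rw [← hpm, hu, Submodule.mem_colon_singleton] at ha
      exact ha
    apply h1.ne_top
    rw [hu, this]
    simp
  ann p hp := by
    have := IsAssociatedPrime.annihilator_le hp
    rwa [Submodule.annihilator_top] at this

lemma regularOn_of_notMem {x : R} (h : ∀ p ∈ associatedPrimes R M, x ∉ p) : RegularOn x M := by
  intro u hu
  by_contra hne
  have : x ∈ ⋃ p ∈ associatedPrimes R M, (p : Set R) := by
    rw [biUnion_associatedPrimes_eq_zero_divisors]
    exact ⟨u, hne, hu⟩
  simp only [Set.mem_iUnion] at this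
  obtain ⟨p, hp, hxp⟩ := this
  exact h p hp hxp

lemma ParList.exists_generic [Module.Finite R M] {Q : Ideal R} {x : R} {l : List R}
    (h : ParList Q (x :: l) M) {T : Set (Ideal R)} (hT : Avoidable T M) :
    ∃ y, (∀ p ∈ T, y ∉ p) ∧ y - x ∈ Ideal.ofList l ∧ y ∈ Q ∧ ParList Q (y :: l) M := by
  obtain ⟨c, hc, hcT⟩ := exists_add_notMem (Ideal.ofList l) x hT.finite hT.prime (fun p hp => by
    rw [← Ideal.ofList_cons]
    exact h.not_le (hT.prime p hp) (hT.ne p hp) (hT.ann p hp))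
  have hcQ : c ∈ Q := ofList_le (fun y hy => h.mem y (List.mem_cons_of_mem _ hy)) hc
  have hxc : x + c ∈ Q := Q.add_mem (h.mem x (by simp)) hcQ
  refine ⟨x + c, hcT, by simpa using hc, hxc, h.of_ofList_le ?_ ?_⟩
  · intro y hy
    rcases List.mem_cons.mp hy with rfl | hy
    · exact hxc
    · exact h.mem y (List.mem_cons_of_mem _ hy)
  · rw [Ideal.ofList_cons, Ideal.ofList_cons]
    refine sup_le ?_ le_sup_right
    rw [Ideal.span_singleton_le_iff_mem]
    have h1 : x + c ∈ Ideal.span {x + c} ⊔ Ideal.ofList l :=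
      Ideal.mem_sup_left (Ideal.mem_span_singleton_self _)
    have h2 : c ∈ Ideal.span {x + c} ⊔ Ideal.ofList l := Ideal.mem_sup_right hc
    simpa using Ideal.sub_mem _ h1 h2

lemma Par.exists_generic [Module.Finite R M] {s : ℕ} {Q : Ideal R} (h : Par (s + 1) Q M)
    {T : Set (Ideal R)} (hT : Avoidable T M) :
    ∃ y ∈ Q, (∀ p ∈ T, y ∉ p) ∧ Par s Q (M ⧸ mulRange y M) := by
  obtain ⟨l, hl, hp⟩ := h.exists_parList
  obtain ⟨x, l, rfl⟩ := List.exists_cons_of_length_eq_add_one hl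
  obtain ⟨y, hy, -, hyQ, hy'⟩ := hp.exists_generic hT
  refine ⟨y, hyQ, hy, ?_⟩
  have := hy'.quotient.par
  rwa [show l.length = s by simpa using hl] at this

lemma Par.exists_regular [Module.Finite R M] {s : ℕ} {Q : Ideal R} (h : Par (s + 1) Q M)
    (hM : TorsionFree R M) :
    ∃ y ∈ Q, RegularOn y M ∧ Par s Q (M ⧸ mulRange y M) := by
  obtain ⟨y, hy, hr, hp⟩ := h.exists_generic hM.avoidable
  exact ⟨y, hy, regularOn_of_notMem hr, hp⟩

lemma Par.exists_deep {s : ℕ} {Q : Ideal R} (h : Par s Q M) (k : ℕ) :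
    ∃ l : List R, l.length = s ∧ Ideal.ofList l ≤ maximalIdeal R ^ k ∧ Ideal.ofList l ≤ Q ∧
      Par s (Ideal.ofList l) M := by
  obtain ⟨l, hl, hp⟩ := h.exists_parList
  have hlm : ∀ y ∈ l, y ∈ maximalIdeal R := fun y hy => hp.le (hp.mem y hy)
  have h1 : Ideal.ofList (l.map (· ^ (k + 1))) ≤ maximalIdeal R ^ k := ofList_le fun y hy => by
    obtain ⟨z, hz, rfl⟩ := List.mem_map.mp hy
    exact Ideal.pow_le_pow_right (Nat.le_succ k) (Ideal.pow_mem_pow (hlm z hz) _)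
  have h2 : Ideal.ofList (l.map (· ^ (k + 1))) ≤ Q := ofList_le fun y hy => by
    obtain ⟨z, hz, rfl⟩ := List.mem_map.mp hy
    exact Ideal.pow_mem_of_mem _ (hp.mem z hz) _ (Nat.succ_pos _)
  refine ⟨l.map (· ^ (k + 1)), by simpa using hl, h1, h2, h2.trans h.le, ?_,
    l.map (· ^ (k + 1)), by simpa using hl, fun y hy => Ideal.subset_span hy, le_rfl⟩
  obtain ⟨a, ha⟩ := hp.pow
  obtain ⟨n, hn⟩ := Ideal.exists_pow_le_of_le_radical_of_fg (I := Ideal.ofList l)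
    (J := Ideal.ofList (l.map (· ^ (k + 1))))
    (Ideal.span_le.mpr fun y hy => ⟨k + 1, Ideal.subset_span (List.mem_map_of_mem hy)⟩)
    (IsNoetherian.noetherian _)
  refine ⟨a * n, ?_⟩
  rw [pow_mul]
  exact (pow_smul_top_le (ha.trans hp.gen) n).trans (smul_top_mono hn)

end GenericElements

section BinomialSums

/-- `∑ C(t,i) k_i` over `0 ≤ i ≤ t`. -/
def sumE (t : ℕ) (k : ℕ → ℕ) : ℕ := ∑ i ∈ range (t + 1), t.choose i * k i

/-- `∑ C(t,i+1) k_i` over `0 ≤ i < t`. -/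
def sumI (t : ℕ) (k : ℕ → ℕ) : ℕ := ∑ i ∈ range t, t.choose (i + 1) * k i

lemma sumE_zero (k : ℕ → ℕ) : sumE 0 k = k 0 := by simp [sumE]

lemma sumI_zero (k : ℕ → ℕ) : sumI 0 k = 0 := by simp [sumI]

lemma sumE_succ (t : ℕ) (k : ℕ → ℕ) : sumE (t + 1) k = sumE t (fun i => k i + k (i + 1)) := by
  have h1 : ∑ i ∈ range (t + 1), t.choose i * k i =
      ∑ i ∈ range (t + 1), t.choose (i + 1) * k (i + 1) + k 0 := by
    have := sum_range_succ' (fun i => t.choose i * k i) (t + 1)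
    rw [sum_range_succ] at this
    simpa using this
  simp only [sumE, mul_add, sum_add_distrib]
  rw [h1, sum_range_succ']
  simp only [Nat.choose_succ_succ', add_mul, sum_add_distrib]
  simp
  ring

lemma sumI_succ (t : ℕ) (k : ℕ → ℕ) :
    sumI (t + 1) k = sumI t (fun i => k i + k (i + 1)) + k 0 := by
  simp only [sumI, mul_add, sum_add_distrib, Nat.choose_succ_succ', add_mul]
  rw [sum_range_succ' (fun i => t.choose i * k i), sum_range_succ (fun i => t.choose (i + 1) * k i)]
  simp
  ring

lemma sumE_congr {t : ℕ} {k k' : ℕ → ℕ} (h : ∀ i < t + 1, k i = k' i) : sumE t k = sumE t k' :=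
  sum_congr rfl fun i hi => by rw [h i (mem_range.mp hi)]

lemma sumI_congr {t : ℕ} {k k' : ℕ → ℕ} (h : ∀ i < t, k i = k' i) : sumI t k = sumI t k' :=
  sum_congr rfl fun i hi => by rw [h i (mem_range.mp hi)]

lemma sumE_le {t : ℕ} {k k' : ℕ → ℕ} (h : ∀ i < t + 1, k i ≤ k' i) : sumE t k ≤ sumE t k' :=
  sum_le_sum fun i hi => Nat.mul_le_mul_left _ (h i (mem_range.mp hi))

lemma sumI_le {t : ℕ} {k k' : ℕ → ℕ} (h : ∀ i < t, k i ≤ k' i) : sumI t k ≤ sumI t k' :=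
  sum_le_sum fun i hi => Nat.mul_le_mul_left _ (h i (mem_range.mp hi))

lemma eq_of_sumE_le {t : ℕ} {k k' : ℕ → ℕ} (h : ∀ i < t + 1, k i ≤ k' i)
    (he : sumE t k' ≤ sumE t k) : ∀ i < t + 1, k i = k' i := by
  intro i hi
  have := (sum_eq_sum_iff_of_le (s := range (t + 1)) (f := fun i => t.choose i * k i)
    (g := fun i => t.choose i * k' i)
    fun i hi => Nat.mul_le_mul_left _ (h i (mem_range.mp hi))).mp
    (le_antisymm (sumE_le h) he) i (mem_range.mpr hi)
  exact Nat.eq_of_mul_eq_mul_left (Nat.choose_pos (by omega)) this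

lemma eq_of_sumI_le {t : ℕ} {k k' : ℕ → ℕ} (h : ∀ i < t, k i ≤ k' i)
    (he : sumI t k' ≤ sumI t k) : ∀ i < t, k i = k' i := by
  intro i hi
  have := (sum_eq_sum_iff_of_le (s := range t) (f := fun i => t.choose (i + 1) * k i)
    (g := fun i => t.choose (i + 1) * k' i)
    fun i hi => Nat.mul_le_mul_left _ (h i (mem_range.mp hi))).mp
    (le_antisymm (sumI_le h) he) i (mem_range.mpr hi)
  exact Nat.eq_of_mul_eq_mul_left (Nat.choose_pos (by omega)) this

lemma le_sumE {t : ℕ} (k : ℕ → ℕ) {i : ℕ} (hi : i < t + 1) : k i ≤ sumE t k :=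
  (Nat.le_mul_of_pos_left _ (Nat.choose_pos (by omega))).trans
    (single_le_sum (f := fun i => t.choose i * k i) (fun _ _ => Nat.zero_le _) (mem_range.mpr hi))

lemma le_sumI {t : ℕ} (k : ℕ → ℕ) {i : ℕ} (hi : i < t) : k i ≤ sumI t k :=
  (Nat.le_mul_of_pos_left _ (Nat.choose_pos (by omega))).trans
    (single_le_sum (f := fun i => t.choose (i + 1) * k i) (fun _ _ => Nat.zero_le _)
      (mem_range.mpr hi))

end BinomialSums

section Standard

variable {R : Type u} [CommRing R] [IsLocalRing R] [IsNoetherianRing R]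
  {M : Type u} [AddCommGroup M] [Module R M]

/-- The length of `H^{i+1}`. -/
noncomputable def lcShift (R : Type u) [CommRing R] [IsLocalRing R] (M : Type u)
    [AddCommGroup M] [Module R M] (i : ℕ) : ℕ := lcLen R (i + 1) M

/-- The length of the kernel of multiplication by `x` on `H^{i+1}`. -/
noncomputable def kerLen {R : Type u} [CommRing R] [IsLocalRing R] (x : R) (M : Type u)
    [AddCommGroup M] [Module R M] (i : ℕ) : ℕ :=
  len R (LinearMap.ker (LinearMap.lsmul R (Hm R (i + 1) M) x))

lemma kerLen_le {s : ℕ} (h : FinLC R s M) (x : R) {i : ℕ} (hi : i + 1 < s) :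
    kerLen x M i ≤ lcShift R M i :=
  len_ker_lsmul_le x (h _ hi)

lemma kerLen_eq_iff {s : ℕ} (h : FinLC R s M) (x : R) {i : ℕ} (hi : i + 1 < s) :
    kerLen x M i = lcShift R M i ↔ KilledBy x (Hm R (i + 1) M) :=
  len_ker_lsmul_eq_iff x (h _ hi)

variable [Module.Finite R M]

lemma satLen_eq_kerLen {x : R} (hM : TorsionFree R M) (hx : RegularOn x M) :
    satLen x M = kerLen x M 0 := satLen_eq hM hx

lemma sumI_quotient {t : ℕ} {x : R} (h : FinLC R (t + 2) M) (hM : TorsionFree R M)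
    (hx : RegularOn x M) :
    sumI t (lcShift R (M ⧸ satMul x M)) + satLen x M = sumI (t + 1) (kerLen x M) := by
  rw [sumI_succ, satLen_eq_kerLen hM hx]
  congr 1
  exact sumI_congr fun i hi => lcLen_satMul h hx (by omega)

lemma sumE_quotient {t : ℕ} {x : R} (h : FinLC R (t + 3) M) (hx : RegularOn x M) :
    sumE t (lcShift R (M ⧸ satMul x M)) = sumE (t + 1) (kerLen x M) := by
  rw [sumE_succ]
  exact sumE_congr fun i hi => lcLen_satMul h hx (by omega)

lemma defect_le (t : ℕ) : ∀ {M : Type u} [AddCommGroup M] [Module R M] [Module.Finite R M]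
    {Q : Ideal R}, FinLC R (t + 1) M → TorsionFree R M → Par (t + 1) Q M →
    defect (t + 1) Q M ≤ sumI t (lcShift R M) := by
  induction t with
  | zero =>
    intro M _ _ _ Q h hM hQ
    rw [zero_add, defect_one hQ hM]
    positivity
  | succ t ih =>
    intro M _ _ _ Q h hM hQ
    obtain ⟨x, hx, hreg, hp⟩ := hQ.exists_regular hM
    rw [defect_step hx hreg hp]
    have h1 := ih (h.satMul hreg) (torsionFree_quotient_sat _) hp.satMul
    have h2 := relLen_smul_sup_satMul_le (M := M) hx
    have h3 := sumI_quotient h hM hreg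
    have h4 : sumI (t + 1) (kerLen x M) ≤ sumI (t + 1) (lcShift R M) :=
      sumI_le fun i hi => kerLen_le h x (by omega)
    zify at h2 h3 h4
    linarith

/-- Standard parameter ideals for a torsion-free module of dimension `t + 1`. -/
def Std (t : ℕ) (Q : Ideal R) (M : Type u) [AddCommGroup M] [Module R M] : Prop :=
  defect (t + 1) Q M = sumI t (lcShift R M)

lemma std_zero {Q : Ideal R} (hQ : Par 1 Q M) (hM : TorsionFree R M) : Std 0 Q M := by
  rw [Std, zero_add, defect_one hQ hM, sumI_zero]
  rfl

lemma Std.cond {t : ℕ} {Q : Ideal R} (hs : Std (t + 1) Q M) (h : FinLC R (t + 2) M)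
    (hM : TorsionFree R M) {x : R} (hx : x ∈ Q) (hreg : RegularOn x M)
    (hp : Par (t + 1) Q (M ⧸ mulRange x M)) :
    Std t Q (M ⧸ satMul x M) ∧ satMul x M ⊓ Q • ⊤ ≤ mulRange x M ∧
      ∀ i < t + 1, KilledBy x (Hm R (i + 1) M) := by
  rw [Std, defect_step hx hreg hp] at hs
  have h1 := defect_le t (h.satMul hreg) (torsionFree_quotient_sat _) hp.satMul
  have h2 := relLen_smul_sup_satMul_le (M := M) hx
  have h3 := sumI_quotient h hM hreg
  have h4 : sumI (t + 1) (kerLen x M) ≤ sumI (t + 1) (lcShift R M) :=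
    sumI_le fun i hi => kerLen_le h x (by omega)
  refine ⟨?_, satMul_inf_le_of_relLen_eq hx ?_, fun i hi => ?_⟩
  · rw [Std]
    zify at h2 h3 h4
    linarith
  · zify at h2 h3 h4 ⊢
    linarith
  · rw [← kerLen_eq_iff h x (by omega)]
    refine eq_of_sumI_le (k := kerLen x M) (k' := lcShift R M) (fun i hi => kerLen_le h x (by omega)) ?_ i hi
    zify at h2 h3 h4 ⊢
    linarith

lemma std_of_cond {t : ℕ} {Q : Ideal R} (h : FinLC R (t + 2) M)
    (hM : TorsionFree R M) {x : R} (hx : x ∈ Q) (hreg : RegularOn x M)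
    (hp : Par (t + 1) Q (M ⧸ mulRange x M)) (h1 : Std t Q (M ⧸ satMul x M))
    (h2 : satMul x M ⊓ Q • ⊤ ≤ mulRange x M) (h3 : ∀ i < t + 1, KilledBy x (Hm R (i + 1) M)) :
    Std (t + 1) Q M := by
  rw [Std, defect_step hx hreg hp, relLen_smul_sup_satMul_eq hx h2]
  have h4 : sumI (t + 1) (kerLen x M) = sumI (t + 1) (lcShift R M) :=
    sumI_congr fun i hi => (kerLen_eq_iff h x (by omega)).mpr (h3 i hi)
  rw [Std] at h1
  rw [h1, ← h4, ← sumI_quotient h hM hreg]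
  push_cast
  rfl

lemma Std.dSeq (t : ℕ) : ∀ {M : Type u} [AddCommGroup M] [Module R M] [Module.Finite R M]
    {Q : Ideal R}, Std t Q M → FinLC R (t + 1) M → TorsionFree R M → Par (t + 1) Q M →
    DSeq (t + 1) Q M := by
  induction t with
  | zero =>
    intro M _ _ _ Q _ _ hM hQ
    exact hQ.dSeq_of_one hM
  | succ t ih =>
    intro M _ _ _ Q hs h hM hQ
    obtain ⟨x, hx, hreg, hp⟩ := hQ.exists_regular hM
    obtain ⟨h1, h2, -⟩ := hs.cond h hM hx hreg hp
    exact ⟨x, hx, hreg, h2, ih h1 (h.satMul hreg) (torsionFree_quotient_sat _) hp.satMul⟩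

lemma Std.chern_eq (t : ℕ) : ∀ {M : Type u} [AddCommGroup M] [Module R M] [Module.Finite R M]
    {Q : Ideal R}, Std (t + 1) Q M → FinLC R (t + 2) M → TorsionFree R M → Par (t + 2) Q M →
    coeff (t + 2) Q M (t + 1) = sumE t (lcShift R M) := by
  induction t with
  | zero =>
    intro M _ _ _ Q hs h hM hQ
    obtain ⟨x, hx, hreg, hp⟩ := hQ.exists_regular hM
    obtain ⟨h1, h2, h3⟩ := hs.cond h hM hx hreg hp
    have hN : TorsionFree R (M ⧸ satMul x M) := torsionFree_quotient_sat _
    rw [chern_step_eq hx hreg hp h2 (h1.dSeq 0 (h.satMul hreg) hN hp.satMul),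
      if_pos rfl, (coeff_one hp.satMul hN).1, sumE_zero, satLen_eq_kerLen hM hreg,
      (kerLen_eq_iff h x (by omega)).mpr (h3 0 (by omega)), zero_add]
  | succ t ih =>
    intro M _ _ _ Q hs h hM hQ
    obtain ⟨x, hx, hreg, hp⟩ := hQ.exists_regular hM
    obtain ⟨h1, h2, h3⟩ := hs.cond h hM hx hreg hp
    have hN : TorsionFree R (M ⧸ satMul x M) := torsionFree_quotient_sat _
    rw [chern_step_eq hx hreg hp h2 (h1.dSeq _ (h.satMul hreg) hN hp.satMul),
      if_neg (by omega), add_zero, ih h1 (h.satMul hreg) hN hp.satMul, sumE_quotient h hreg]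
    congr 1
    exact sumE_congr fun i hi => (kerLen_eq_iff h x (by omega)).mpr (h3 i (by omega))

lemma chern_le (t : ℕ) : ∀ {M : Type u} [AddCommGroup M] [Module R M] [Module.Finite R M]
    {Q : Ideal R}, FinLC R (t + 2) M → TorsionFree R M → Par (t + 2) Q M →
    coeff (t + 2) Q M (t + 1) ≤ sumE t (lcShift R M) := by
  induction t with
  | zero =>
    intro M _ _ _ Q h hM hQ
    obtain ⟨x, hx, hreg, hp⟩ := hQ.exists_regular hM
    have hN : TorsionFree R (M ⧸ satMul x M) := torsionFree_quotient_sat _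
    refine (chern_step_le hx hreg hp).trans ?_
    rw [if_pos rfl, (coeff_one hp.satMul hN).1, sumE_zero, satLen_eq_kerLen hM hreg, zero_add]
    exact_mod_cast kerLen_le h x (by omega)
  | succ t ih =>
    intro M _ _ _ Q h hM hQ
    obtain ⟨x, hx, hreg, hp⟩ := hQ.exists_regular hM
    have hN : TorsionFree R (M ⧸ satMul x M) := torsionFree_quotient_sat _
    refine (chern_step_le hx hreg hp).trans ?_
    rw [if_neg (by omega), add_zero]
    refine (ih (h.satMul hreg) hN hp.satMul).trans ?_
    rw [sumE_quotient h hreg]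
    exact_mod_cast sumE_le fun i hi => kerLen_le h x (by omega)

lemma killedBy_of_chern_eq {t : ℕ} {Q : Ideal R} (h : FinLC R (t + 2) M) (hM : TorsionFree R M)
    (hc : coeff (t + 2) Q M (t + 1) = sumE t (lcShift R M)) {x : R} (hx : x ∈ Q)
    (hreg : RegularOn x M) (hp : Par (t + 1) Q (M ⧸ mulRange x M)) :
    ∀ i < t + 1, KilledBy x (Hm R (i + 1) M) := by
  have hN : TorsionFree R (M ⧸ satMul x M) := torsionFree_quotient_sat _
  have h1 := chern_step_le hx hreg hp
  intro i hi
  rw [← kerLen_eq_iff h x (by omega)]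
  refine eq_of_sumE_le (k := kerLen x M) (k' := lcShift R M) (fun i hi => kerLen_le h x (by omega)) ?_ i hi
  cases t with
  | zero =>
    rw [if_pos rfl, (coeff_one hp.satMul hN).1, satLen_eq_kerLen hM hreg, hc, zero_add,
      ← sumE_zero (kerLen x M)] at h1
    exact_mod_cast h1
  | succ t =>
    rw [if_neg (by omega), add_zero, hc] at h1
    have h2 := h1.trans (chern_le t (h.satMul hreg) hN hp.satMul)
    rw [sumE_quotient h hreg] at h2
    exact_mod_cast h2

lemma chern_quotient_eq {t : ℕ} {Q : Ideal R} (h : FinLC R (t + 3) M)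
    (hc : coeff (t + 3) Q M (t + 2) = sumE (t + 1) (lcShift R M)) {x : R} (hx : x ∈ Q)
    (hreg : RegularOn x M) (hp : Par (t + 2) Q (M ⧸ mulRange x M)) :
    coeff (t + 2) Q (M ⧸ satMul x M) (t + 1) = sumE t (lcShift R (M ⧸ satMul x M)) := by
  have hN : TorsionFree R (M ⧸ satMul x M) := torsionFree_quotient_sat _
  refine le_antisymm (chern_le t (h.satMul hreg) hN hp.satMul) ?_
  have h1 := chern_step_le hx hreg hp
  rw [if_neg (by omega), add_zero, hc] at h1
  rw [sumE_quotient h hreg]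
  refine le_trans ?_ h1
  exact_mod_cast sumE_le fun i hi => kerLen_le h x (by omega)

end Standard

section Existence

variable {R : Type u} [CommRing R] [IsLocalRing R] [IsNoetherianRing R]
  {M : Type u} [AddCommGroup M] [Module R M]

lemma coeff_eq_of_smul_eq {s : ℕ} {Q Q' : Ideal R}
    (h : (Q • ⊤ : Submodule R M) = Q' • ⊤) : coeff s Q M = coeff s Q' M := by
  have : hilb Q M = hilb Q' M := by
    funext n
    rw [hilb, hilb, pow_smul_top_eq h]
  rw [coeff, coeff, this]

lemma defect_eq_of_smul_eq {s : ℕ} {Q Q' : Ideal R}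
    (h : (Q • ⊤ : Submodule R M) = Q' • ⊤) : defect s Q M = defect s Q' M := by
  rw [defect, defect, coeff_eq_of_smul_eq h, h]

lemma Par.of_smul_eq {s : ℕ} {Q Q' : Ideal R} (hP : Par s Q M) (hle : Q ≤ Q')
    (hm : Q' ≤ maximalIdeal R) (h : (Q' • ⊤ : Submodule R M) ≤ Q • ⊤) : Par s Q' M := by
  obtain ⟨-, ⟨a, ha⟩, l, hl, hlQ, hg⟩ := hP
  exact ⟨hm, ⟨a, ha.trans (smul_top_mono hle)⟩, l, hl, fun y hy => hle (hlQ y hy), h.trans hg⟩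

lemma Std.of_smul_eq {t : ℕ} {Q Q' : Ideal R} (hP : Std t Q M)
    (h : (Q • ⊤ : Submodule R M) = Q' • ⊤) : Std t Q' M := by
  rwa [Std, ← defect_eq_of_smul_eq h]

lemma span_sup_smul_eq (x : R) (Q : Ideal R) {P : Submodule R M} (hP : mulRange x M ≤ P) :
    (Q • ⊤ : Submodule R (M ⧸ P)) = (Ideal.span {x} ⊔ Q) • ⊤ := by
  refine le_antisymm (smul_top_mono le_sup_right) ?_
  rw [Submodule.sup_smul]
  refine sup_le ?_ le_rfl
  rw [Submodule.ideal_span_singleton_smul]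
  intro v hv
  obtain ⟨w, -, rfl⟩ := hv
  obtain ⟨w, rfl⟩ := Submodule.mkQ_surjective _ w
  have : x • P.mkQ w = 0 := by
    rw [← map_smul]
    exact (Submodule.Quotient.mk_eq_zero _).mpr (hP ⟨w, rfl⟩)
  change x • P.mkQ w ∈ _
  rw [this]
  exact zero_mem _

variable [Module.Finite R M]

lemma exists_lift {x : R} (hx : x ∈ maximalIdeal R) : ∃ n, ∀ (s : ℕ) (Q : Ideal R),
    Q ≤ maximalIdeal R ^ n → Par s Q (M ⧸ satMul x M) →
    Par s (Ideal.span {x} ⊔ Q) (M ⧸ mulRange x M) ∧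
      satMul x M ⊓ (Ideal.span {x} ⊔ Q) • ⊤ ≤ mulRange x M := by
  have hT : Module.length R (LinearMap.ker (Submodule.factor (le_sat (mulRange x M)))) ≠ ⊤ := by
    rw [length_ker_factor_satMul]
    exact relLength_sat_ne_top _
  obtain ⟨n, hn⟩ := (eventually_pow_smul_top_inf_eq_bot hT le_rfl).exists
  obtain ⟨b, hb⟩ := exists_pow_smul_eq_bot_of_length_ne_top hT
  refine ⟨n, fun s Q hQ hP => ⟨?_, ?_⟩⟩
  · have hm : Ideal.span {x} ⊔ Q ≤ maximalIdeal R :=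
      sup_le ((Ideal.span_singleton_le_iff_mem _).mpr hx) hP.le
    refine Par.of_smul_eq (Q := Q) ?_ le_sup_right hm (span_sup_smul_eq x Q le_rfl).ge
    obtain ⟨h1, ⟨a, ha⟩, l, hl, hlQ, hg⟩ := hP
    have hsurj := Submodule.factor_surjective (le_sat (mulRange x M))
    refine ⟨h1, ⟨b + a, ?_⟩, l, hl, hlQ, ?_⟩
    · have h2 : (maximalIdeal R ^ a • ⊤ : Submodule R (M ⧸ mulRange x M)) ≤
          Q • ⊤ ⊔ LinearMap.ker (Submodule.factor (le_sat (mulRange x M))) := by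
        rw [← comap_smul_top_of_surjective Q _ hsurj, ← Submodule.map_le_iff_le_comap,
          map_smul_top_of_surjective _ _ hsurj]
        exact ha
      rw [pow_add, mul_smul]
      refine (Submodule.smul_mono le_rfl h2).trans ?_
      rw [Submodule.smul_sup, hb, sup_bot_eq]
      exact Submodule.smul_le_right
    · have h2 : (Q • ⊤ : Submodule R (M ⧸ mulRange x M)) ≤
          Ideal.ofList l • ⊤ ⊔ LinearMap.ker (Submodule.factor (le_sat (mulRange x M))) := by
        rw [← comap_smul_top_of_surjective (Ideal.ofList l) _ hsurj,
          ← Submodule.map_le_iff_le_comap, map_smul_top_of_surjective _ _ hsurj]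
        exact hg
      have h3 : (Ideal.ofList l • ⊤ : Submodule R (M ⧸ mulRange x M)) ≤ Q • ⊤ :=
        smul_top_mono (ofList_le hlQ)
      have h4 : LinearMap.ker (Submodule.factor (le_sat (mulRange x M))) ⊓ Q • ⊤ = ⊥ := by
        rw [eq_bot_iff, ← hn, inf_comm]
        exact inf_le_inf_right _ (smul_top_mono hQ)
      calc (Q • ⊤ : Submodule R (M ⧸ mulRange x M))
          ≤ (Ideal.ofList l • ⊤ ⊔ LinearMap.ker (Submodule.factor (le_sat (mulRange x M)))) ⊓
            Q • ⊤ := le_inf h2 le_rfl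
        _ = Ideal.ofList l • ⊤ ⊔
            LinearMap.ker (Submodule.factor (le_sat (mulRange x M))) ⊓ Q • ⊤ :=
              (sup_inf_assoc_of_le _ h3)
        _ ≤ _ := by rw [h4, sup_bot_eq]
  · rw [Submodule.sup_smul, ← mulRange_eq_span_smul]
    have h5 : satMul x M ⊓ Q • ⊤ ≤ mulRange x M := by
      rintro w ⟨hw1, hw2⟩
      have h6 : (mulRange x M).mkQ w ∈ (maximalIdeal R ^ n • ⊤ : Submodule R (M ⧸ mulRange x M)) ⊓
          LinearMap.ker (Submodule.factor (le_sat (mulRange x M))) := by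
        refine ⟨smul_top_mono hQ ?_, ?_⟩
        · rw [← map_smul_top_of_surjective Q (mulRange x M).mkQ (Submodule.mkQ_surjective _)]
          exact ⟨w, hw2, rfl⟩
        · rw [ker_factor_satMul]
          exact ⟨w, hw1, rfl⟩
      rw [hn] at h6
      exact (Submodule.Quotient.mk_eq_zero _).mp h6
    rw [inf_comm, sup_inf_assoc_of_le _ (le_sat _), inf_comm]
    exact sup_le le_rfl h5

lemma exists_pow_killedBy {s : ℕ} (h : FinLC R s M) :
    ∃ k, ∀ x ∈ maximalIdeal R ^ k, ∀ i < s, KilledBy x (Hm R i M) := by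
  have h1 : ∀ i, ∃ k, i < s → ∀ x ∈ maximalIdeal R ^ k, KilledBy x (Hm R i M) := by
    intro i
    by_cases hi : i < s
    · obtain ⟨k, hk⟩ := exists_pow_smul_top_eq_bot (h i hi)
      refine ⟨k, fun _ x hx z => ?_⟩
      have := Submodule.smul_mem_smul hx (Submodule.mem_top (x := z))
      rwa [hk, Submodule.mem_bot] at this
    · exact ⟨0, fun h => absurd h hi⟩
  choose k hk using h1
  refine ⟨(range s).sup k, fun x hx i hi => hk i hi x ?_⟩
  exact Ideal.pow_le_pow_right (Finset.le_sup (f := k) (mem_range.mpr hi)) hx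

lemma exists_std (t : ℕ) : ∀ {M : Type u} [AddCommGroup M] [Module R M] [Module.Finite R M]
    {Q₀ : Ideal R}, FinLC R (t + 1) M → TorsionFree R M → Par (t + 1) Q₀ M → ∀ k,
    ∃ Q ≤ maximalIdeal R ^ k, Par (t + 1) Q M ∧ Std t Q M := by
  induction t with
  | zero =>
    intro M _ _ _ Q₀ h hM hQ k
    obtain ⟨l, -, h1, -, h2⟩ := hQ.exists_deep k
    exact ⟨_, h1, h2, std_zero h2 hM⟩
  | succ t ih =>
    intro M _ _ _ Q₀ h hM hQ k
    obtain ⟨k₀, hk₀⟩ := exists_pow_killedBy h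
    obtain ⟨l, -, h1, -, h2⟩ := hQ.exists_deep (max k k₀)
    obtain ⟨x, hx, hreg, hp⟩ := h2.exists_regular hM
    have hxm : x ∈ maximalIdeal R := h2.le hx
    obtain ⟨n, hn⟩ := exists_lift (M := M) hxm
    obtain ⟨Q, hQ1, hQ2, hQ3⟩ := ih (h.satMul hreg) (torsionFree_quotient_sat _) hp.satMul (max n k)
    obtain ⟨h3, h4⟩ := hn _ Q (hQ1.trans (Ideal.pow_le_pow_right (le_max_left _ _))) hQ2
    have hxQ : x ∈ Ideal.span {x} ⊔ Q := Ideal.mem_sup_left (Ideal.mem_span_singleton_self x)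
    refine ⟨Ideal.span {x} ⊔ Q, sup_le ?_ ?_, Par.of_mulRange hxQ h3, ?_⟩
    · rw [Ideal.span_singleton_le_iff_mem]
      exact Ideal.pow_le_pow_right (le_max_left _ _) (h1 hx)
    · exact hQ1.trans (Ideal.pow_le_pow_right (le_max_right _ _))
    · refine std_of_cond h hM hxQ hreg h3 (hQ3.of_smul_eq (span_sup_smul_eq x Q (le_sat _))) h4
        fun i hi => hk₀ x (Ideal.pow_le_pow_right (le_max_right _ _) (h1 hx)) _ (by omega)

end Existence

section Converse

variable {R : Type u} [CommRing R] [IsLocalRing R] [IsNoetherianRing R]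
  {M : Type u} [AddCommGroup M] [Module R M]

lemma KilledBy.smul_mem [Module.Finite R M] {x y : R} (hM : TorsionFree R M) (hx : RegularOn x M)
    (hy : KilledBy y (Hm R 1 M)) {w : M} (hw : w ∈ satMul x M) : y • w ∈ mulRange x M := by
  obtain ⟨α, β, h1, h2, h3⟩ := hm_exact_of_regular hx 0
  have hβ : Function.Injective β := by
    rw [injective_iff_map_eq_zero]
    intro z hz
    obtain ⟨w, rfl⟩ := (h2 z).1 hz
    rw [hm_zero_eq_zero hM w, map_zero]
  have hw' : (mulRange x M).mkQ w ∈
      powTorsionSub (maximalIdeal R) (ModuleCat.of R (M ⧸ mulRange x M)) := by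
    obtain ⟨k, hk⟩ := hw
    exact ⟨k, fun a ha => (Submodule.Quotient.mk_eq_zero _).mpr (hk a ha)⟩
  rw [← LC.range_eval] at hw'
  obtain ⟨z, hz⟩ := hw'
  have hyz : y • z = 0 := hβ (by rw [map_smul, map_zero]; exact hy _)
  have : y • (mulRange x M).mkQ w = 0 := by
    rw [← hz]
    exact (map_smul _ y z).symm.trans (by rw [hyz, map_zero])
  rw [← map_smul] at this
  exact (Submodule.Quotient.mk_eq_zero _).mp this

lemma satMul_sq {y : R} [Module.Finite R M] (hM : TorsionFree R M) (hy : RegularOn y M)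
    (hk : KilledBy y (Hm R 1 M)) {w : M} (hw : w ∈ satMul (y * y) M) :
    ∃ v ∈ satMul y M, w = y • v := by
  have hy2 : RegularOn (y * y) M := fun u hu => hy u (hy _ (by rwa [smul_smul]))
  obtain ⟨v, hv⟩ := hk.smul_mem hM hy2 hw
  have hv' : w = y • v := hy.smul_left_cancel (by rw [smul_smul]; exact hv.symm)
  refine ⟨v, ?_, hv'⟩
  obtain ⟨k, hk⟩ := hw
  refine ⟨k, fun a ha => ?_⟩
  obtain ⟨p, hp⟩ := hk a ha
  refine ⟨p, hy.smul_left_cancel ?_⟩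
  rw [smul_comm, ← hv', ← hp]
  exact smul_smul _ _ _

lemma mkQ_mem_satMul {x : R} {P : Submodule R M} {w : M} (hw : w ∈ satMul x M) :
    P.mkQ w ∈ satMul x (M ⧸ P) := by
  obtain ⟨k, hk⟩ := hw
  refine ⟨k, fun a ha => ?_⟩
  obtain ⟨p, hp⟩ := hk a ha
  exact ⟨P.mkQ p, by rw [← map_smul, ← hp]; rfl⟩

variable [Module.Finite R M]

/-- Descent of the condition `U(x) ∩ QM ⊆ xM` from `M / U(y)`. -/
lemma satMul_inf_le_of_quotient {x y : R} {Q : Ideal R} (hM : TorsionFree R M)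
    (hx : RegularOn x M) (hy : RegularOn y M) (hkx : KilledBy y (Hm R 1 M))
    (hx2 : RegularOn x (M ⧸ satMul (y * y) M))
    (h : satMul x (M ⧸ satMul y M) ⊓ Q • ⊤ ≤ mulRange x (M ⧸ satMul y M)) :
    satMul x M ⊓ Q • ⊤ ≤ mulRange x M := by
  rintro w ⟨hw1, hw2⟩
  have h1 : (satMul y M).mkQ w ∈ mulRange x (M ⧸ satMul y M) := by
    refine h ⟨mkQ_mem_satMul hw1, ?_⟩
    rw [← map_smul_top_of_surjective Q (satMul y M).mkQ (Submodule.mkQ_surjective _)]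
    exact ⟨w, hw2, rfl⟩
  obtain ⟨n, hn⟩ := h1
  obtain ⟨n, rfl⟩ := Submodule.mkQ_surjective _ n
  have hq : w - x • n ∈ satMul y M := by
    rw [← Submodule.Quotient.mk_eq_zero, Submodule.Quotient.mk_sub, sub_eq_zero]
    exact hn.symm
  have hq' : w - x • n ∈ satMul x M := sub_mem hw1 (le_sat _ ⟨n, rfl⟩)
  obtain ⟨p, hp⟩ := hkx.smul_mem hM hx hq'
  have hp' : p ∈ satMul (y * y) M := by
    rw [← Submodule.Quotient.mk_eq_zero]
    apply hx2
    rw [← Submodule.Quotient.mk_smul, Submodule.Quotient.mk_eq_zero]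
    change x • p = _ at hp
    rw [hp]
    obtain ⟨k, hk⟩ := hq
    refine ⟨k, fun a ha => ?_⟩
    obtain ⟨v, hv⟩ := hk a ha
    refine ⟨v, ?_⟩
    rw [smul_comm, ← hv]
    exact (smul_smul _ _ _).symm
  obtain ⟨v, -, rfl⟩ := satMul_sq hM hy hkx hp'
  have : w - x • n = x • v := hy.smul_left_cancel (by
    rw [← hp]
    exact smul_comm _ _ _)
  exact ⟨n + v, by
    change x • (n + v) = w
    rw [smul_add, ← this]
    abel⟩

theorem std_of_chern_eq (t : ℕ) : ∀ {M : Type u} [AddCommGroup M] [Module R M] [Module.Finite R M]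
    {Q : Ideal R}, FinLC R (t + 2) M → TorsionFree R M → Par (t + 2) Q M →
    coeff (t + 2) Q M (t + 1) = sumE t (lcShift R M) → Std (t + 1) Q M := by
  induction t with
  | zero =>
    intro M _ _ _ Q h hM hQ hc
    obtain ⟨l, hl, hP⟩ := hQ.exists_parList
    obtain ⟨x₁, x₂, rfl⟩ := List.length_eq_two.mp hl
    obtain ⟨y, hy, -, hyQ, hPy⟩ := hP.exists_generic hM.avoidable
    have hyr := regularOn_of_notMem hy
    obtain ⟨x, hxT, -, hxQ, hPx⟩ := hPy.swap.exists_generic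
      (hM.avoidable.union (((torsionFree_quotient_sat (mulRange y M)).avoidable.of_surjective
        (satMul y M).mkQ (Submodule.mkQ_surjective _)).union
        ((torsionFree_quotient_sat (mulRange (y * y) M)).avoidable.of_surjective
        (satMul (y * y) M).mkQ (Submodule.mkQ_surjective _))))
    have hxr : RegularOn x M := regularOn_of_notMem fun p hp => hxT p (Or.inl hp)
    have hx2 : RegularOn x (M ⧸ satMul (y * y) M) :=
      regularOn_of_notMem fun p hp => hxT p (Or.inr (Or.inr hp))
    have hpx : Par 1 Q (M ⧸ mulRange x M) := hPx.quotient.par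
    have hpy : Par 1 Q (M ⧸ mulRange y M) := hPx.swap.quotient.par
    have hky := killedBy_of_chern_eq h hM hc hyQ hyr hpy
    refine std_of_cond h hM hxQ hxr hpx (std_zero hpx.satMul (torsionFree_quotient_sat _)) ?_
      (killedBy_of_chern_eq h hM hc hxQ hxr hpx)
    refine satMul_inf_le_of_quotient hM hxr hyr (hky 0 (by omega)) hx2 (inf_le_right.trans ?_)
    have hN := hPx.swap.quotient.of_surjective (Submodule.factor (le_sat (mulRange y M)))
      (Submodule.factor_surjective _)
    refine hN.gen.trans ?_
    rw [Ideal.ofList_singleton]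
    exact (mulRange_eq_span_smul x).ge
  | succ t ih =>
    intro M _ _ _ Q h hM hQ hc
    obtain ⟨l, hl, hP⟩ := hQ.exists_parList
    obtain ⟨x₁, l, rfl⟩ := List.exists_cons_of_length_eq_add_one hl
    have hl' : l.length = t + 1 + 1 := by simpa using hl
    obtain ⟨x₂, l, rfl⟩ := List.exists_cons_of_length_eq_add_one hl'
    have hl'' : l.length = t + 1 := by simpa using hl'
    obtain ⟨y, hy, -, hyQ, hPy⟩ := hP.exists_generic hM.avoidable
    have hyr := regularOn_of_notMem hy
    have hNy : TorsionFree R (M ⧸ satMul y M) := torsionFree_quotient_sat _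
    obtain ⟨x, hxT, -, hxQ, hPx⟩ := hPy.swap.exists_generic
      (hM.avoidable.union ((hNy.avoidable.of_surjective
        (satMul y M).mkQ (Submodule.mkQ_surjective _)).union
        ((torsionFree_quotient_sat (mulRange (y * y) M)).avoidable.of_surjective
        (satMul (y * y) M).mkQ (Submodule.mkQ_surjective _))))
    have hxr : RegularOn x M := regularOn_of_notMem fun p hp => hxT p (Or.inl hp)
    have hxN : RegularOn x (M ⧸ satMul y M) :=
      regularOn_of_notMem fun p hp => hxT p (Or.inr (Or.inl hp))
    have hx2 : RegularOn x (M ⧸ satMul (y * y) M) :=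
      regularOn_of_notMem fun p hp => hxT p (Or.inr (Or.inr hp))
    have hpx : Par (t + 2) Q (M ⧸ mulRange x M) := by
      have := hPx.quotient.par
      rwa [List.length_cons, hl''] at this
    have hpy : Par (t + 2) Q (M ⧸ mulRange y M) := by
      have := hPx.swap.quotient.par
      rwa [List.length_cons, hl''] at this
    have hpxy : Par (t + 1) Q ((M ⧸ satMul y M) ⧸ mulRange x (M ⧸ satMul y M)) := by
      have := (hPx.swap.quotient.of_surjective (Submodule.factor (le_sat (mulRange y M)))
        (Submodule.factor_surjective _)).quotient.par
      rwa [hl''] at this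
    have hky := killedBy_of_chern_eq h hM hc hyQ hyr hpy
    have hsx := ih (h.satMul hxr) (torsionFree_quotient_sat _) hpx.satMul
      (chern_quotient_eq h hc hxQ hxr hpx)
    have hsy := ih (h.satMul hyr) hNy hpy.satMul (chern_quotient_eq h hc hyQ hyr hpy)
    refine std_of_cond h hM hxQ hxr hpx hsx ?_ (killedBy_of_chern_eq h hM hc hxQ hxr hpx)
    exact satMul_inf_le_of_quotient hM hxr hyr (hky 0 (by omega)) hx2
      (hsy.cond (h.satMul hyr) hNy hxQ hxN hpxy).2.1

end Converse

section Finiteness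

lemma length_ne_top_of_fg_le {R : Type*} [CommRing R] {H : Type*} [AddCommGroup H] [Module R H]
    (c : ℕ) (h : ∀ F : Submodule R H, F.FG → Module.length R F ≤ c) : Module.length R H ≠ ⊤ := by
  have hfin : ∀ F : Submodule R H, F.FG → Module.length R F ≠ ⊤ := fun F hF =>
    ne_top_of_le_ne_top (ENat.natCast_ne_top c) (h F hF)
  have hle : ∀ F : Submodule R H, F.FG → len R F ≤ c := fun F hF => by
    have := h F hF
    rw [← coe_len (hfin F hF)] at this
    exact_mod_cast this
  let A : Set ℕ := {n | ∃ F : Submodule R H, F.FG ∧ len R F = n}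
  have hA : A.Nonempty := ⟨_, ⊥, Submodule.fg_bot, rfl⟩
  have hb : BddAbove A := ⟨c, by rintro _ ⟨F, hF, rfl⟩; exact hle F hF⟩
  obtain ⟨F, hF, hmax⟩ := Nat.sSup_mem hA hb
  have htop : F = ⊤ := by
    rw [eq_top_iff]
    intro z _
    have hG : (F ⊔ Submodule.span R {z}).FG := hF.sup (Submodule.fg_span_singleton z)
    have h1 : len R (F ⊔ Submodule.span R {z} : Submodule R H) ≤ len R F := by
      rw [hmax]
      exact le_csSup hb ⟨_, hG, rfl⟩
    have h2 := relLength_add (R := R) (M := H) (A := ⊥) (B := F) (C := F ⊔ Submodule.span R {z})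
      bot_le le_sup_left
    rw [relLength_bot, relLength_bot, ← coe_len (hfin _ hG), ← coe_len (hfin _ hF)] at h2
    have h3 : relLength F (F ⊔ Submodule.span R {z}) = 0 := by
      have h4 : ((len R F : ℕ) : ℕ∞) + relLength F (F ⊔ Submodule.span R {z}) ≤
          (len R F : ℕ) + 0 := by
        rw [← h2, add_zero]
        exact_mod_cast h1
      exact le_antisymm ((ENat.add_le_add_iff_left (ENat.natCast_ne_top _)).mp h4) bot_le
    exact le_of_relLength_eq_zero h3
      (Submodule.mem_sup_right (Submodule.mem_span_singleton_self z))
  have := hfin F hF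
  rw [htop] at this
  rwa [← Module.length_top]

variable {R : Type u} [CommRing R] [IsLocalRing R] [IsNoetherianRing R]
  {M : Type u} [AddCommGroup M] [Module R M]

lemma length_ne_top_of_ker_le {H : Type*} [AddCommGroup H] [Module R H]
    (ht : ∀ z : H, ∃ k : ℕ, ∀ a ∈ maximalIdeal R ^ k, a • z = 0) (c : ℕ)
    (h : ∀ k, ∃ x ∈ maximalIdeal R ^ k,
      Module.length R (LinearMap.ker (LinearMap.lsmul R H x)) ≤ c) :
    Module.length R H ≠ ⊤ := by
  refine length_ne_top_of_fg_le c fun F hF => ?_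
  obtain ⟨T, rfl⟩ := hF
  choose k hk using ht
  obtain ⟨x, hx, hxc⟩ := h (T.sup k)
  refine le_trans (Module.length_le_of_injective (Submodule.inclusion (?_ : _ ≤ LinearMap.ker
    (LinearMap.lsmul R H x))) (Submodule.inclusion_injective _)) hxc
  rw [Submodule.span_le]
  intro z hz
  exact hk z x (Ideal.pow_le_pow_right (Finset.le_sup (f := k) hz) hx)

lemma hm_length_ne_top {i : ℕ} (c : ℕ) (h : ∀ k, ∃ x ∈ maximalIdeal R ^ k,
    Module.length R (LinearMap.ker (LinearMap.lsmul R (Hm R i M) x)) ≤ c) :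
    Module.length R (Hm R i M) ≠ ⊤ :=
  length_ne_top_of_ker_le (LC.exists_pow_smul _ i) c h

variable [Module.Finite R M]

lemma length_ker_le_of_quotient {s i c : ℕ} {x : R} (hx : RegularOn x M)
    (h : FinLC R s (M ⧸ satMul x M)) (hi : i + 1 < s) (hc : lcLen R (i + 1) (M ⧸ satMul x M) ≤ c) :
    Module.length R (LinearMap.ker (LinearMap.lsmul R (Hm R (i + 2) M) x)) ≤ c := by
  have h1 : Module.length R (Hm R (i + 1) (M ⧸ satMul x M)) ≤ c := by
    rw [← coe_len (h _ hi)]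
    exact_mod_cast hc
  rw [length_hm_satMul hx] at h1
  exact le_trans le_add_self h1

lemma length_ker_le_of_satLen {c : ℕ} {x : R} (hM : TorsionFree R M) (hx : RegularOn x M)
    (hc : satLen x M ≤ c) :
    Module.length R (LinearMap.ker (LinearMap.lsmul R (Hm R 1 M) x)) ≤ c := by
  have h1 : Module.length R (LinearMap.ker (LinearMap.lsmul R (Hm R 1 M) x)) ≠ ⊤ := by
    rw [← relLength_satMul_eq hM hx]
    exact relLength_sat_ne_top _
  rw [← coe_len h1, ← satLen_eq hM hx]
  exact_mod_cast hc

lemma defect_nonneg (t : ℕ) : ∀ {M : Type u} [AddCommGroup M] [Module R M] [Module.Finite R M]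
    {Q : Ideal R}, TorsionFree R M → Par (t + 1) Q M → 0 ≤ defect (t + 1) Q M := by
  induction t with
  | zero =>
    intro M _ _ _ Q hM hQ
    rw [zero_add, defect_one hQ hM]
  | succ t ih =>
    intro M _ _ _ Q hM hQ
    obtain ⟨x, hx, hreg, hp⟩ := hQ.exists_regular hM
    rw [defect_step hx hreg hp]
    have := ih (torsionFree_quotient_sat _) hp.satMul
    positivity

theorem finLC_of_defect_le (t : ℕ) : ∀ {M : Type u} [AddCommGroup M] [Module R M]
    [Module.Finite R M] {Q₀ : Ideal R} (c k₀ : ℕ), TorsionFree R M → Par (t + 1) Q₀ M →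
    (∀ Q ≤ maximalIdeal R ^ k₀, Par (t + 1) Q M → defect (t + 1) Q M ≤ c) →
    FinLC R (t + 1) M := by
  induction t with
  | zero =>
    intro M _ _ _ Q₀ c k₀ hM hQ hb i hi
    obtain rfl : i = 0 := by omega
    rw [length_hm_zero hM]
    simp
  | succ t ih =>
    intro M _ _ _ Q₀ c k₀ hM hQ hb
    have key : ∀ k, ∃ x ∈ maximalIdeal R ^ k, RegularOn x M ∧ satLen x M ≤ c ∧
        FinLC R (t + 1) (M ⧸ satMul x M) ∧ ∀ i < t, lcLen R (i + 1) (M ⧸ satMul x M) ≤ c := by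
      intro k
      obtain ⟨l, -, h1, -, h2⟩ := hQ.exists_deep (max k k₀)
      obtain ⟨x, hx, hreg, hp⟩ := h2.exists_regular hM
      obtain ⟨n, hn⟩ := exists_lift (M := M) (h2.le hx)
      have hN : TorsionFree R (M ⧸ satMul x M) := torsionFree_quotient_sat _
      have hle : ∀ Q ≤ maximalIdeal R ^ (max n k₀), Par (t + 1) Q (M ⧸ satMul x M) →
          defect (t + 1) Q (M ⧸ satMul x M) + satLen x M ≤ c := by
        intro Q hQ1 hQ2
        obtain ⟨h3, h4⟩ := hn _ Q (hQ1.trans (Ideal.pow_le_pow_right (le_max_left _ _))) hQ2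
        have hxQ : x ∈ Ideal.span {x} ⊔ Q := Ideal.mem_sup_left (Ideal.mem_span_singleton_self x)
        have := hb (Ideal.span {x} ⊔ Q) (sup_le (by
          rw [Ideal.span_singleton_le_iff_mem]
          exact Ideal.pow_le_pow_right (le_max_right _ _) (h1 hx))
          (hQ1.trans (Ideal.pow_le_pow_right (le_max_right _ _)))) (Par.of_mulRange hxQ h3)
        rwa [defect_step hxQ hreg h3, relLen_smul_sup_satMul_eq hxQ h4,
          ← defect_eq_of_smul_eq (span_sup_smul_eq x Q (le_sat _))] at this
      have hfin := ih c (max n k₀) hN hp.satMul fun Q hQ1 hQ2 => by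
        have := hle Q hQ1 hQ2
        linarith [Int.natCast_nonneg (satLen x M)]
      obtain ⟨Q, hQ1, hQ2, hQ3⟩ := exists_std t hfin hN hp.satMul (max n k₀)
      have h5 := hle Q hQ1 hQ2
      have h6 := defect_nonneg t hN hQ2
      refine ⟨x, Ideal.pow_le_pow_right (le_max_left _ _) (h1 hx), hreg, ?_, hfin, fun i hi => ?_⟩
      · zify
        linarith
      · refine (le_sumI (lcShift R (M ⧸ satMul x M)) hi).trans ?_
        rw [Std] at hQ3
        zify
        linarith [Int.natCast_nonneg (satLen x M)]
    intro i hi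
    rcases i with _ | _ | i
    · rw [length_hm_zero hM]
      simp
    · refine hm_length_ne_top c fun k => ?_
      obtain ⟨x, hx, hreg, h1, -, -⟩ := key k
      exact ⟨x, hx, length_ker_le_of_satLen hM hreg h1⟩
    · refine hm_length_ne_top c fun k => ?_
      obtain ⟨x, hx, hreg, -, h2, h3⟩ := key k
      exact ⟨x, hx, length_ker_le_of_quotient hreg h2 (by omega) (h3 i (by omega))⟩

end Finiteness

section AnnihilatorCondition

variable {R : Type u} [CommRing R] [IsLocalRing R] [IsNoetherianRing R]

/-- The annihilator of `H^i` defines a closed set of dimension less than `i`, for `1 ≤ i < s`. -/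
def AnnCond (R : Type u) [CommRing R] [IsLocalRing R] (s : ℕ) (M : Type u) [AddCommGroup M]
    [Module R M] : Prop :=
  ∀ i, 1 ≤ i → i < s → ∀ p : Ideal R, p.IsPrime → (i : WithBot ℕ∞) ≤ ringKrullDim (R ⧸ p) →
    ¬ Module.annihilator R (Hm R i M) ≤ p

variable {M : Type u} [AddCommGroup M] [Module R M]

lemma annihilator_le_hm (i : ℕ) : Module.annihilator R M ≤ Module.annihilator R (Hm R i M) := by
  intro r hr
  rw [Module.mem_annihilator] at hr ⊢
  intro z
  have h0 : LinearMap.lsmul R M r = LinearMap.lsmul R M 0 := by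
    ext m
    simp [hr m]
  have h1 := lcMap_lsmul (maximalIdeal R) (A := M) i r z
  rw [h0, lcMap_lsmul, zero_smul] at h1
  exact h1.symm

lemma ringKrullDim_quotient_add_one_le {p q : Ideal R} (hq : q.IsPrime) (hqp : q ≤ p) {x : R}
    (hxp : x ∈ p) (hxq : x ∉ q) : ringKrullDim (R ⧸ p) + 1 ≤ ringKrullDim (R ⧸ q) := by
  refine ringKrullDim_succ_le_of_surjective (Ideal.Quotient.factor hqp)
    (Ideal.Quotient.factor_surjective hqp) (r := Ideal.Quotient.mk q x) ?_ ?_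
  · rw [mem_nonZeroDivisors_iff_ne_zero]
    rwa [Ne, Ideal.Quotient.eq_zero_iff_mem]
  · rw [Ideal.Quotient.factor_mk, Ideal.Quotient.eq_zero_iff_mem]
    exact hxp

lemma one_le_ringKrullDim_quotient {p : Ideal R} (hp : p.IsPrime) (hm : p ≠ maximalIdeal R) :
    1 ≤ ringKrullDim (R ⧸ p) := by
  have hle := le_maximalIdeal hp.ne_top
  obtain ⟨x, hx, hxp⟩ := SetLike.not_le_iff_exists.mp fun h => hm (le_antisymm hle h)
  have h := ringKrullDim_quotient_add_one_le hp hle hx hxp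
  letI := Ideal.Quotient.field (maximalIdeal R)
  rwa [ringKrullDim_eq_zero_of_field, zero_add] at h

/-- The primes to be avoided so that the annihilator condition descends. -/
def annPrimes (R : Type u) [CommRing R] [IsLocalRing R] (s : ℕ) (M : Type u) [AddCommGroup M]
    [Module R M] : Set (Ideal R) :=
  {p | ∃ i < s, p ∈ (Module.annihilator R (Hm R i M)).minimalPrimes ∧ p ≠ maximalIdeal R}

lemma avoidable_annPrimes (s : ℕ) : Avoidable (annPrimes R s M) M where
  finite := by
    have : annPrimes R s M ⊆ ⋃ i ∈ range s, (Module.annihilator R (Hm R i M)).minimalPrimes := by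
      rintro p ⟨i, hi, hp, -⟩
      simp only [Set.mem_iUnion]
      exact ⟨i, mem_range.mpr hi, hp⟩
    exact Set.Finite.subset (Set.Finite.biUnion (Finset.finite_toSet _)
      fun i _ => Ideal.finite_minimalPrimes_of_isNoetherianRing R _) this
  prime := by
    rintro p ⟨i, -, hp, -⟩
    exact hp.1.1
  ne := by
    rintro p ⟨i, -, -, hp⟩
    exact hp
  ann := by
    rintro p ⟨i, -, hp, -⟩
    exact (annihilator_le_hm i).trans hp.1.2

variable [Module.Finite R M]

lemma AnnCond.satMul {s : ℕ} (h : AnnCond R (s + 1) M) {x : R} (hx : RegularOn x M)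
    (hT : ∀ p ∈ annPrimes R (s + 1) M, x ∉ p) : AnnCond R s (M ⧸ satMul x M) := by
  intro i hi1 his p hp hdim hle
  obtain ⟨i, rfl⟩ : ∃ j, i = j + 1 := ⟨i - 1, by omega⟩
  have h1 := h (i + 1) hi1 (by omega) p hp hdim
  obtain ⟨a, ha, hap⟩ := SetLike.not_le_iff_exists.mp h1
  obtain ⟨α, β, -, h2, h3⟩ := hm_exact_satMul hx i
  have key : ∀ b : R, (∀ z : Hm R (i + 2) M, x • z = 0 → b • z = 0) → b ∈ p := by
    intro b hb
    have : a * b ∈ p := by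
      apply hle
      rw [Module.mem_annihilator]
      intro z
      have h4 : β (b • z) = 0 := by
        rw [map_smul]
        exact hb _ ((h3 _).mpr ⟨z, rfl⟩)
      obtain ⟨w, hw⟩ := (h2 _).mp h4
      rw [mul_smul, ← hw, ← map_smul, Module.mem_annihilator.mp ha w, map_zero]
    exact (hp.mem_or_mem this).resolve_left hap
  have hxp : x ∈ p := key x fun z hz => hz
  have hJ : Module.annihilator R (Hm R (i + 2) M) ≤ p := fun b hb =>
    key b fun z _ => Module.mem_annihilator.mp hb z
  obtain ⟨q, hq, hqp⟩ := Ideal.exists_minimalPrimes_le hJ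
  by_cases hqm : q = maximalIdeal R
  · have hpm : p = maximalIdeal R :=
      le_antisymm (le_maximalIdeal hp.ne_top) (hqm ▸ hqp)
    have : ringKrullDim (R ⧸ p) = 0 := by
      subst hpm
      letI := Ideal.Quotient.field (maximalIdeal R)
      exact ringKrullDim_eq_zero_of_field _
    rw [this] at hdim
    have : ((i + 1 : ℕ) : WithBot ℕ∞) ≤ (0 : ℕ) := hdim
    have : i + 1 ≤ 0 := by exact_mod_cast this
    omega
  · have hxq : x ∉ q := hT q ⟨i + 2, by omega, hq, hqm⟩
    haveI := hq.1.1
    have hlt := ringKrullDim_quotient_add_one_le hq.1.1 hqp hxp hxq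
    refine h (i + 2) (by omega) (by omega) q hq.1.1 ?_ hq.1.2
    refine le_trans ?_ hlt
    have := add_le_add_left hdim 1
    push_cast at this ⊢
    rwa [add_assoc, one_add_one_eq_two] at this

lemma AnnCond.length_ne_top {s : ℕ} (h : AnnCond R (s + 2) M) (hM : TorsionFree R M)
    {Q : Ideal R} (hQ : Par (s + 2) Q M) : Module.length R (Hm R 1 M) ≠ ⊤ := by
  obtain ⟨k, hk⟩ : ∃ k, maximalIdeal R ^ k ≤ Module.annihilator R (Hm R 1 M) := by
    refine Ideal.exists_pow_le_of_le_radical_of_fg ?_ (IsNoetherian.noetherian _)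
    rw [Ideal.radical_eq_sInf]
    refine le_sInf fun p ⟨hp1, hp⟩ => ?_
    by_contra hne
    exact h 1 le_rfl (by omega) p hp (one_le_ringKrullDim_quotient hp fun h => hne h.ge) hp1
  obtain ⟨l, -, h1, -, h2⟩ := hQ.exists_deep k
  obtain ⟨x, hx, hreg, hp⟩ := h2.exists_regular hM
  have hker : LinearMap.ker (LinearMap.lsmul R (Hm R 1 M) x) = ⊤ := by
    rw [eq_top_iff]
    intro z _
    exact Module.mem_annihilator.mp (hk (h1 hx)) z
  have := relLength_satMul_eq hM hreg
  rw [hker, Module.length_top] at this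
  rw [← this]
  exact relLength_sat_ne_top _

theorem finLC_of_chern_le (t : ℕ) : ∀ {M : Type u} [AddCommGroup M] [Module R M]
    [Module.Finite R M] {Q₀ : Ideal R} (c k₀ : ℕ), TorsionFree R M → AnnCond R (t + 2) M →
    Par (t + 2) Q₀ M →
    (∀ Q ≤ maximalIdeal R ^ k₀, Par (t + 2) Q M → DSeq (t + 2) Q M →
      coeff (t + 2) Q M (t + 1) ≤ c) →
    FinLC R (t + 2) M := by
  induction t with
  | zero =>
    intro M _ _ _ Q₀ c k₀ hM hA hQ hb i hi
    rcases i with _ | _ | i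
    · rw [length_hm_zero hM]
      simp
    · exact hA.length_ne_top hM hQ
    · omega
  | succ t ih =>
    intro M _ _ _ Q₀ c k₀ hM hA hQ hb
    have key : ∀ k, ∃ x ∈ maximalIdeal R ^ k, RegularOn x M ∧
        FinLC R (t + 2) (M ⧸ satMul x M) ∧ ∀ i < t + 1, lcLen R (i + 1) (M ⧸ satMul x M) ≤ c := by
      intro k
      obtain ⟨l, -, h1, -, h2⟩ := hQ.exists_deep (max k k₀)
      obtain ⟨x, hx, hxT, hp⟩ := h2.exists_generic (hM.avoidable.union (avoidable_annPrimes (t + 3)))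
      have hreg : RegularOn x M := regularOn_of_notMem fun p hp => hxT p (Or.inl hp)
      obtain ⟨n, hn⟩ := exists_lift (M := M) (h2.le hx)
      have hN : TorsionFree R (M ⧸ satMul x M) := torsionFree_quotient_sat _
      have hle : ∀ Q ≤ maximalIdeal R ^ (max n k₀), Par (t + 2) Q (M ⧸ satMul x M) →
          DSeq (t + 2) Q (M ⧸ satMul x M) → coeff (t + 2) Q (M ⧸ satMul x M) (t + 1) ≤ c := by
        intro Q hQ1 hQ2 hQ3
        obtain ⟨h3, h4⟩ := hn _ Q (hQ1.trans (Ideal.pow_le_pow_right (le_max_left _ _))) hQ2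
        have hxQ : x ∈ Ideal.span {x} ⊔ Q := Ideal.mem_sup_left (Ideal.mem_span_singleton_self x)
        have heq := span_sup_smul_eq x Q (le_sat (mulRange x M))
        have hD := hQ3.mono le_sup_right heq.ge
        have := hb (Ideal.span {x} ⊔ Q) (sup_le (by
          rw [Ideal.span_singleton_le_iff_mem]
          exact Ideal.pow_le_pow_right (le_max_right _ _) (h1 hx))
          (hQ1.trans (Ideal.pow_le_pow_right (le_max_right _ _)))) (Par.of_mulRange hxQ h3)
          ⟨x, hxQ, hreg, h4, hD⟩
        rwa [chern_step_eq hxQ hreg h3 h4 hD, if_neg (by omega), add_zero,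
          ← coeff_eq_of_smul_eq heq] at this
      have hfin := ih c (max n k₀) hN (hA.satMul hreg fun p hp => hxT p (Or.inr hp)) hp.satMul hle
      obtain ⟨Q, hQ1, hQ2, hQ3⟩ := exists_std (t + 1) hfin hN hp.satMul (max n k₀)
      have h5 := hle Q hQ1 hQ2 (hQ3.dSeq _ hfin hN hQ2)
      rw [hQ3.chern_eq t hfin hN hQ2] at h5
      refine ⟨x, Ideal.pow_le_pow_right (le_max_left _ _) (h1 hx), hreg, hfin, fun i hi => ?_⟩
      refine (le_sumE (lcShift R (M ⧸ satMul x M)) hi).trans ?_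
      exact_mod_cast h5
    intro i hi
    rcases i with _ | _ | i
    · rw [length_hm_zero hM]
      simp
    · exact hA.length_ne_top hM hQ
    · refine hm_length_ne_top c fun k => ?_
      obtain ⟨x, hx, hreg, h2, h3⟩ := key k
      exact ⟨x, hx, length_ker_le_of_quotient hreg h2 (by omega) (h3 i (by omega))⟩

end AnnihilatorCondition

section InjectiveHull

/-- A maximal essential extension of a submodule inside an injective module is injective. -/
lemma exists_injective_essential {R : Type u} [CommRing R] {J : Type u} [AddCommGroup J]
    [Module R J] [Module.Injective R J] (K : Submodule R J) :
    ∃ E : Submodule R J, K ≤ E ∧ Module.Injective R E ∧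
      ∀ z ∈ E, z ≠ 0 → ∃ r : R, r • z ≠ 0 ∧ r • z ∈ K := by
  obtain ⟨E, hKE, hE⟩ := zorn_le_nonempty₀
    {E : Submodule R J | K ≤ E ∧ ∀ z ∈ E, z ≠ 0 → ∃ r : R, r • z ≠ 0 ∧ r • z ∈ K}
    (fun c hc hchain y hy => ⟨sSup c, ⟨(hc hy).1.trans (le_sSup hy), fun z hz hz0 => by
      obtain ⟨F, hF, hzF⟩ := (Submodule.mem_sSup_of_directed ⟨y, hy⟩ hchain.directedOn).mp hz
      exact (hc hF).2 z hzF hz0⟩, fun z hz => le_sSup hz⟩) K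
    ⟨le_rfl, fun z hz hz0 => ⟨1, by rwa [one_smul], by rwa [one_smul]⟩⟩
  obtain ⟨C, -, hC⟩ := zorn_le_nonempty₀ {C : Submodule R J | Disjoint C E}
    (fun c hc hchain y hy => ⟨sSup c, by
      change Disjoint (sSup c) E
      rw [Submodule.disjoint_def]
      intro z hz hzE
      obtain ⟨F, hF, hzF⟩ := (Submodule.mem_sSup_of_directed ⟨y, hy⟩ hchain.directedOn).mp hz
      exact Submodule.disjoint_def.mp (hc hF) z hzF hzE, fun z hz => le_sSup hz⟩) ⊥
    (disjoint_bot_left : Disjoint (⊥ : Submodule R J) E)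
  have hinj : Function.Injective (C.mkQ.comp E.subtype) := by
    rw [injective_iff_map_eq_zero]
    intro z hz
    have : (z : J) ∈ C := (Submodule.Quotient.mk_eq_zero _).mp hz
    exact Subtype.ext (Submodule.disjoint_def.mp hC.1 z this z.2)
  obtain ⟨φ, hφ⟩ := Module.Injective.out (C.mkQ.comp E.subtype) hinj E.subtype
  have hφE : ∀ z ∈ E, φ (C.mkQ z) = z := fun z hz => hφ ⟨z, hz⟩
  have hker : LinearMap.ker (φ.comp C.mkQ) ≤ C := by
    refine hC.2 (?_ : Disjoint _ E) ?_
    · rw [Submodule.disjoint_def]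
      intro z hz hzE
      have h1 : φ (C.mkQ z) = 0 := hz
      rwa [hφE z hzE] at h1
    · intro z hz
      rw [LinearMap.mem_ker, LinearMap.comp_apply, Submodule.mkQ_apply,
        (Submodule.Quotient.mk_eq_zero _).mpr hz, map_zero]
  have hrange : LinearMap.range (φ.comp C.mkQ) ≤ E := by
    have hER : E ≤ LinearMap.range (φ.comp C.mkQ) := fun z hz => ⟨z, hφE z hz⟩
    refine hE.2 ⟨hE.1.1.trans hER, ?_⟩ hER
    rintro _ ⟨y, rfl⟩ hy0
    have hyC : y ∉ C := fun hy => hy0 (by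
      rw [LinearMap.comp_apply, Submodule.mkQ_apply,
        (Submodule.Quotient.mk_eq_zero _).mpr hy, map_zero])
    have hnd : ¬ Disjoint (C ⊔ Submodule.span R {y}) E := fun hd =>
      hyC (hC.2 hd le_sup_left
        (Submodule.mem_sup_right (Submodule.mem_span_singleton_self y)))
    rw [Submodule.disjoint_def] at hnd
    push Not at hnd
    obtain ⟨w, hw, hwE, hw0⟩ := hnd
    obtain ⟨c, hc, z, hz, rfl⟩ := Submodule.mem_sup.mp hw
    obtain ⟨r, rfl⟩ := Submodule.mem_span_singleton.mp hz
    have h1 : r • (φ.comp C.mkQ) y = c + r • y := by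
      have h2 := hφE _ hwE
      rw [map_add, Submodule.mkQ_apply, Submodule.mkQ_apply,
        (Submodule.Quotient.mk_eq_zero _).mpr hc, zero_add] at h2
      rw [← h2, ← map_smul]
      rfl
    obtain ⟨r', h3, h4⟩ := hE.1.2 _ hwE hw0
    refine ⟨r' * r, ?_, ?_⟩ <;> rwa [mul_smul, h1]
  refine ⟨E, hE.1.1, ⟨fun X Y _ _ _ _ f hf g => ?_⟩, hE.1.2⟩
  obtain ⟨h, hh⟩ := Module.Injective.out f hf (E.subtype.comp g)
  refine ⟨((φ.comp C.mkQ).codRestrict E fun z => hrange ⟨z, rfl⟩).comp h, fun x => ?_⟩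
  apply Subtype.ext
  change φ (C.mkQ (h (f x))) = g x
  rw [hh]
  exact hφE _ (g x).2

/-- The injective hull of the residue field. -/
lemma exists_injective_hull_residueField (R : Type u) [CommRing R] [IsLocalRing R] :
    ∃ (E : Type u) (_ : AddCommGroup E) (_ : Module R E), Module.Injective R E ∧
      ∃ e : E, e ≠ 0 ∧ (∀ a ∈ maximalIdeal R, a • e = 0) ∧
        ∀ z : E, (∀ a ∈ maximalIdeal R, a • z = 0) → ∃ r : R, z = r • e := by
  obtain ⟨⟨J, hJ, f, hf⟩⟩ := (EnoughInjectives.presentation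
    (ModuleCat.of R (R ⧸ maximalIdeal R)))
  haveI : Module.Injective R J := Module.injective_module_of_injective_object R J
  have hinj : Function.Injective f.hom := (ModuleCat.mono_iff_injective f).mp hf
  set e₀ : J := f.hom (Ideal.Quotient.mk (maximalIdeal R) 1) with he₀
  obtain ⟨E, hKE, hE, hess⟩ := exists_injective_essential (Submodule.span R {e₀})
  have hann : ∀ a : R, a • e₀ = 0 ↔ a ∈ maximalIdeal R := by
    intro a
    have h1 : a • e₀ = f.hom (Ideal.Quotient.mk (maximalIdeal R) a) := by
      rw [he₀, ← map_smul]
      congr 1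
      change Submodule.Quotient.mk (a • (1 : R)) = _
      rw [smul_eq_mul, mul_one]
      rfl
    rw [h1, ← Ideal.Quotient.eq_zero_iff_mem]
    exact map_eq_zero_iff f.hom hinj
  refine ⟨E, inferInstance, inferInstance, hE,
    ⟨e₀, hKE (Submodule.mem_span_singleton_self _)⟩, ?_, ?_, ?_⟩
  · intro h
    have h1 : e₀ = 0 := congrArg Subtype.val h
    have h2 := (hann 1).mp (by rw [h1, smul_zero])
    exact (Ideal.ne_top_iff_one _).mp (maximalIdeal.isMaximal R).ne_top h2
  · exact fun a ha => Subtype.ext ((hann a).mpr ha)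
  · intro z hz
    by_cases hz0 : z = 0
    · exact ⟨0, by rw [hz0, zero_smul]⟩
    obtain ⟨r, hr0, hr⟩ := hess z z.2 fun h => hz0 (Subtype.ext h)
    have hru : IsUnit r := by
      by_contra hru
      exact hr0 (congrArg Subtype.val (hz r hru))
    obtain ⟨u, rfl⟩ := hru
    obtain ⟨t, ht⟩ := Submodule.mem_span_singleton.mp hr
    refine ⟨((u⁻¹ : Rˣ) : R) * t, Subtype.ext ?_⟩
    change (z : J) = (((u⁻¹ : Rˣ) : R) * t) • e₀
    rw [mul_smul, ht, smul_smul, Units.inv_mul, one_smul]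

end InjectiveHull

section Duality

variable {R : Type u} [CommRing R]

lemma exists_extension {A B E : Type u} [AddCommGroup A] [Module R A] [AddCommGroup B]
    [Module R B] [AddCommGroup E] [Module R E] [Module.Injective R E] (φ : A →ₗ[R] B)
    (f : A →ₗ[R] E) (h : LinearMap.ker φ ≤ LinearMap.ker f) : ∃ g : B →ₗ[R] E, ∀ z, g (φ z) = f z := by
  obtain ⟨g, hg⟩ := Module.Injective.out ((LinearMap.ker φ).liftQ φ le_rfl)
    (LinearMap.ker_eq_bot.mp (Submodule.ker_liftQ_eq_bot _ _ _ le_rfl))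
    ((LinearMap.ker φ).liftQ f h)
  exact ⟨g, fun z => hg (Submodule.Quotient.mk z)⟩

lemma mem_smul_top_of_vanish {A E : Type u} [AddCommGroup A] [Module R A] [AddCommGroup E]
    [Module R E] [Module.Injective R E] {J : Ideal R} (hJ : J.FG) (f : A →ₗ[R] E)
    (hf : ∀ z, (∀ a ∈ J, a • z = 0) → f z = 0) : f ∈ J • (⊤ : Submodule R (A →ₗ[R] E)) := by
  classical
  obtain ⟨T, rfl⟩ := hJ
  obtain ⟨g, hg⟩ := exists_extension (B := T → A)
    (LinearMap.pi fun x : T => LinearMap.lsmul R A (x : R)) f (by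
      intro z hz
      refine hf z fun a ha => ?_
      have h1 : ∀ x ∈ T, x • z = 0 := fun x hx => congrFun hz ⟨x, hx⟩
      have h2 : Submodule.span R (T : Set R) ≤ LinearMap.ker (LinearMap.toSpanSingleton R A z) :=
        Submodule.span_le.mpr h1
      exact h2 ha)
  have : f = ∑ x : T, (x : R) • (g.comp (LinearMap.single R (fun _ : T => A) x)) := by
    ext z
    rw [← hg z, LinearMap.sum_apply]
    rw [← Finset.univ_sum_single ((LinearMap.pi fun x : T => LinearMap.lsmul R A (x : R)) z),
      map_sum]
    refine Finset.sum_congr rfl fun x _ => ?_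
    change g (Pi.single x ((x : R) • z)) = (x : R) • g (Pi.single x z)
    rw [← map_smul, ← Pi.single_smul]
  rw [this]
  exact Submodule.sum_mem _ fun x _ =>
    Submodule.smul_mem_smul (Submodule.subset_span x.2) Submodule.mem_top

variable [IsLocalRing R]

lemma exists_smul_ne_zero_of_torsion {A : Type*} [AddCommGroup A] [Module R A] {z : A} (hz : z ≠ 0)
    (h : ∃ k : ℕ, ∀ a ∈ maximalIdeal R ^ k, a • z = 0) :
    ∃ r : R, r • z ≠ 0 ∧ ∀ a ∈ maximalIdeal R, a • r • z = 0 := by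
  classical
  have hk := Nat.find_spec h
  have hk0 : Nat.find h ≠ 0 := fun h0 => hz (by
    have := hk 1 (by rw [h0, pow_zero, Ideal.one_eq_top]; exact Submodule.mem_top)
    rwa [one_smul] at this)
  obtain ⟨j, hj⟩ := Nat.exists_eq_succ_of_ne_zero hk0
  have hmin := Nat.find_min h (m := j) (by omega)
  push Not at hmin
  obtain ⟨r, hr, hrz⟩ := hmin
  refine ⟨r, hrz, fun a ha => ?_⟩
  rw [smul_smul]
  refine hk _ ?_
  rw [hj, Nat.succ_eq_add_one, pow_succ']
  exact Ideal.mul_mem_mul ha hr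

lemma exists_dual_ne_zero {A E : Type u} [AddCommGroup A] [Module R A] [AddCommGroup E]
    [Module R E] [Module.Injective R E] {e : E} (he0 : e ≠ 0)
    (he : ∀ a ∈ maximalIdeal R, a • e = 0) {z : A} (hz : z ≠ 0)
    (h : ∃ k : ℕ, ∀ a ∈ maximalIdeal R ^ k, a • z = 0) : ∃ f : A →ₗ[R] E, f z ≠ 0 := by
  obtain ⟨r, hr, hra⟩ := exists_smul_ne_zero_of_torsion hz h
  obtain ⟨g, hg⟩ := exists_extension (LinearMap.toSpanSingleton R A (r • z))
    (LinearMap.toSpanSingleton R E e) (by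
      intro a ha
      have h1 : a • r • z = 0 := ha
      refine he a ?_
      by_contra hu
      have : IsUnit a := by
        by_contra h2
        exact hu h2
      exact hr ((this.smul_eq_zero).mp h1))
  refine ⟨g, fun h0 => he0 ?_⟩
  have := hg 1
  simpa [h0] using this.symm

lemma isHausdorff_dual {A E : Type u} [AddCommGroup A] [Module R A] [AddCommGroup E] [Module R E]
    (hA : ∀ z : A, ∃ k : ℕ, ∀ a ∈ maximalIdeal R ^ k, a • z = 0) :
    IsHausdorff (maximalIdeal R) (A →ₗ[R] E) where
  haus' := by
    intro f hf
    ext z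
    obtain ⟨k, hk⟩ := hA z
    have h1 := (SModEq.zero).mp (hf k)
    have h2 : maximalIdeal R ^ k • (⊤ : Submodule R (A →ₗ[R] E)) ≤
        LinearMap.ker (LinearMap.applyₗ (R := R) (M₂ := E) z) := by
      rw [Submodule.smul_le]
      intro a ha g _
      change (a • g) z = 0
      rw [LinearMap.smul_apply, ← map_smul, hk a ha, map_zero]
    exact h2 h1

variable (R) in
/-- The socle of a module. -/
def socle (A : Type*) [AddCommGroup A] [Module R A] : Submodule R A where
  carrier := {z | ∀ a ∈ maximalIdeal R, a • z = 0}
  add_mem' := fun h1 h2 a ha => by rw [smul_add, h1 a ha, h2 a ha, add_zero]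
  zero_mem' := fun a _ => smul_zero a
  smul_mem' := fun r z h a ha => by rw [smul_comm, h a ha, smul_zero]

lemma isPrecomplete_pi {n : ℕ} (I : Ideal R) [IsPrecomplete I R] : IsPrecomplete I (Fin n → R) where
  prec' := by
    have key : ∀ (m : ℕ) (x y : Fin n → R),
        x ≡ y [SMOD (I ^ m • ⊤ : Submodule R (Fin n → R))] ↔
          ∀ i, x i ≡ y i [SMOD (I ^ m • ⊤ : Submodule R R)] := by
      intro m x y
      simp only [SModEq.sub_mem]
      constructor
      · intro h i
        have := Submodule.mem_map_of_mem (f := LinearMap.proj (R := R) (φ := fun _ : Fin n => R) i) h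
        rw [Submodule.map_smul''] at this
        exact Submodule.smul_mono le_rfl le_top this
      · intro h
        have h1 : x - y = ∑ i, (x i - y i) • (Pi.single i (1 : R) : Fin n → R) := by
          ext j
          simp [Pi.single_apply]
        rw [h1]
        refine Submodule.sum_mem _ fun i _ => Submodule.smul_mem_smul ?_ Submodule.mem_top
        have := h i
        rwa [smul_eq_mul, Ideal.mul_top] at this
    intro f hf
    choose L hL using fun i => IsPrecomplete.prec' (I := I) (M := R) (fun m => f m i)
      fun {a b} hab => (key a _ _).mp (hf hab) i
    exact ⟨L, fun m => (key m _ _).mpr fun i => hL i m⟩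

variable [IsNoetherianRing R] [IsAdicComplete (maximalIdeal R) R]

lemma finite_dual {A E : Type u} [AddCommGroup A] [Module R A] [AddCommGroup E]
    [Module R E] [Module.Injective R E] {e : E}
    (he1 : ∀ z : E, (∀ a ∈ maximalIdeal R, a • z = 0) → ∃ r : R, z = r • e)
    (hA : ∀ z : A, ∃ k : ℕ, ∀ a ∈ maximalIdeal R ^ k, a • z = 0) (hsoc : (socle R A).FG) :
    Module.Finite R (A →ₗ[R] E) := by
  haveI := isHausdorff_dual (E := E) hA
  obtain ⟨T, hT⟩ := hsoc
  have hTs : ∀ t ∈ T, ∀ a ∈ maximalIdeal R, a • t = 0 := fun t ht => by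
    have : t ∈ socle R A := hT ▸ Submodule.subset_span ht
    exact this
  let ρ : (A →ₗ[R] E) →ₗ[R] (T → Submodule.span R {e}) :=
    LinearMap.pi fun t => (LinearMap.applyₗ (t : A)).codRestrict _ fun f => by
      obtain ⟨r, hr⟩ := he1 (f t) fun a ha => by rw [← map_smul, hTs t t.2 a ha, map_zero]
      change f t ∈ _
      rw [hr]
      exact Submodule.mem_span_singleton.mpr ⟨r, rfl⟩
  have hker : LinearMap.ker ρ ≤ maximalIdeal R • ⊤ := by
    intro f hf
    refine mem_smul_top_of_vanish (IsNoetherian.noetherian _) f fun z hz => ?_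
    have h1 : ∀ t ∈ T, f t = 0 := fun t ht => congrArg Subtype.val (congrFun hf ⟨t, ht⟩)
    have h2 : socle R A ≤ LinearMap.ker f := by
      rw [← hT, Submodule.span_le]
      exact h1
    exact h2 hz
  obtain ⟨n, w, hw⟩ := Submodule.fg_iff_exists_fin_generating_family.mp
    (IsNoetherian.noetherian (LinearMap.range ρ))
  have hw' : ∀ i, ∃ g, ρ g = w i := fun i => by
    have : w i ∈ LinearMap.range ρ := hw ▸ Submodule.subset_span ⟨i, rfl⟩
    exact this
  choose g hg using hw'
  haveI := isPrecomplete_pi (n := n) (maximalIdeal R)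
  refine Module.Finite.of_surjective (Fintype.linearCombination R g)
    (surjective_of_mkQ_comp_surjective (I := maximalIdeal R) ?_)
  intro y
  obtain ⟨f, rfl⟩ := Submodule.mkQ_surjective _ y
  have h1 : ρ f ∈ Submodule.span R (Set.range w) := hw ▸ ⟨f, rfl⟩
  obtain ⟨c, hc⟩ := (Submodule.mem_span_range_iff_exists_fun R).mp h1
  refine ⟨c, ?_⟩
  rw [LinearMap.comp_apply, Submodule.mkQ_apply, Submodule.mkQ_apply, Submodule.Quotient.eq]
  refine hker ?_
  rw [LinearMap.mem_ker, map_sub, Fintype.linearCombination_apply, map_sum, sub_eq_zero, ← hc]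
  simp [hg]

theorem isArtinian_of_socle_fg {A : Type u} [AddCommGroup A] [Module R A]
    (hA : ∀ z : A, ∃ k : ℕ, ∀ a ∈ maximalIdeal R ^ k, a • z = 0) (hsoc : (socle R A).FG) :
    IsArtinian R A := by
  obtain ⟨E, _, _, _, e, he0, he, he1⟩ := exists_injective_hull_residueField R
  haveI := finite_dual he1 hA hsoc
  let F : Submodule R A → (Submodule R (A →ₗ[R] E))ᵒᵈ := fun B =>
    OrderDual.toDual (LinearMap.ker (LinearMap.lcomp R E B.subtype))
  have hmem : ∀ B f, f ∈ OrderDual.ofDual (F B) ↔ ∀ z ∈ B, f z = 0 := by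
    intro B f
    constructor
    · intro h z hz
      exact LinearMap.congr_fun (h : f.comp B.subtype = 0) ⟨z, hz⟩
    · intro h
      change f.comp B.subtype = 0
      ext z
      exact h z z.2
  have hF : StrictMono F := by
    intro B C hBC
    refine lt_of_le_not_ge (fun f hf => (hmem B f).mpr fun z hz =>
      (hmem C f).mp hf z (hBC.le hz)) fun h => ?_
    obtain ⟨z, hzC, hzB⟩ := SetLike.exists_of_lt hBC
    obtain ⟨f, hf⟩ := exists_dual_ne_zero (A := A ⧸ B) he0 he
      (z := Submodule.Quotient.mk z) (by rwa [Ne, Submodule.Quotient.mk_eq_zero]) (by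
        obtain ⟨k, hk⟩ := hA z
        exact ⟨k, fun a ha => by rw [← Submodule.Quotient.mk_smul, hk a ha]; rfl⟩)
    have h1 : f.comp B.mkQ ∈ OrderDual.ofDual (F B) := (hmem B _).mpr fun y hy => by
      rw [LinearMap.comp_apply, Submodule.mkQ_apply, (Submodule.Quotient.mk_eq_zero _).mpr hy,
        map_zero]
    exact hf ((hmem C _).mp (h h1) z hzC)
  exact hF.wellFoundedLT

theorem exists_pow_add_mul_mem_annihilator {A : Type u} [AddCommGroup A] [Module R A]
    (hA : ∀ z : A, ∃ k : ℕ, ∀ a ∈ maximalIdeal R ^ k, a • z = 0) (hsoc : (socle R A).FG)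
    {x b : R} (hb : ∀ z : A, x • z = 0 → b • z = 0) :
    ∃ (n : ℕ) (r : R), b ^ n + x * r ∈ Module.annihilator R A := by
  obtain ⟨E, _, _, _, e, he0, he, he1⟩ := exists_injective_hull_residueField R
  haveI := finite_dual he1 hA hsoc
  obtain ⟨p, hp, -, hc, hz⟩ :=
    LinearMap.exists_monic_and_natDegree_eq_and_coeff_mem_pow_and_aeval_eq_zero R
      (LinearMap.lsmul R (A →ₗ[R] E) b) (Ideal.span {x}) (by
        rintro _ ⟨f, rfl⟩
        refine mem_smul_top_of_vanish (Submodule.fg_span_singleton x) _ fun z hz => ?_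
        rw [LinearMap.lsmul_apply, LinearMap.smul_apply, ← map_smul,
          hb z (hz x (Ideal.mem_span_singleton_self x)), map_zero])
  have h1 : ∀ f : A →ₗ[R] E, p.eval b • f = 0 := by
    intro f
    have h2 : Polynomial.aeval (algebraMap R (Module.End R (A →ₗ[R] E)) b) p = 0 := hz
    rw [Polynomial.aeval_algebraMap_apply] at h2
    have h3 := LinearMap.congr_fun h2 f
    simpa [Polynomial.coe_aeval_eq_eval] using h3
  have h2 : ∃ r, p.eval b = b ^ p.natDegree + x * r := by
    have h3 : p.eval b - b ^ p.natDegree ∈ Ideal.span {x} := by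
      rw [Polynomial.eval_eq_sum_range, Finset.sum_range_succ, hp.coeff_natDegree, one_mul,
        add_sub_cancel_right]
      refine Ideal.sum_mem _ fun i hi => Ideal.mul_mem_right _ _ ?_
      have := mem_range.mp hi
      exact Ideal.pow_le_self (by omega) (hc i)
    obtain ⟨r, hr⟩ := Ideal.mem_span_singleton.mp h3
    exact ⟨r, by rw [← hr]; ring⟩
  obtain ⟨r, hr⟩ := h2
  refine ⟨p.natDegree, r, ?_⟩
  rw [← hr, Module.mem_annihilator]
  intro z
  by_contra hne
  obtain ⟨k, hk⟩ := hA z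
  obtain ⟨f, hf⟩ := exists_dual_ne_zero he0 he hne
    ⟨k, fun a ha => by rw [smul_comm, hk a ha, smul_zero]⟩
  apply hf
  rw [map_smul, ← LinearMap.smul_apply, h1, LinearMap.zero_apply]

end Duality

section CompleteAnnihilators

variable {R : Type u} [CommRing R] [IsLocalRing R]

lemma finite_of_isArtinian_of_smul_eq_zero {A : Type*} [AddCommGroup A] [Module R A]
    [IsArtinian R A] (h : ∀ a ∈ maximalIdeal R, ∀ z : A, a • z = 0) : Module.Finite R A := by
  have ht : Module.IsTorsionBySet R A (maximalIdeal R) := fun z a => h a a.2 z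
  letI : Module (R ⧸ maximalIdeal R) A := ht.module
  haveI : IsScalarTower R (R ⧸ maximalIdeal R) A := ht.isScalarTower
  letI : Field (R ⧸ maximalIdeal R) := Ideal.Quotient.field _
  haveI : IsArtinian (R ⧸ maximalIdeal R) A := isArtinian_of_tower R inferInstance
  have hfin := IsArtinian.finite_of_linearIndependent
    (Module.Basis.ofVectorSpace (R ⧸ maximalIdeal R) A).linearIndependent.linearIndepOn_id
  haveI : Finite (Module.Basis.ofVectorSpaceIndex (R ⧸ maximalIdeal R) A) :=
    Set.finite_range_iff (Module.Basis.ofVectorSpace _ A).injective |>.mp hfin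
  haveI : Module.Finite (R ⧸ maximalIdeal R) A :=
    Module.Finite.of_basis (Module.Basis.ofVectorSpace (R ⧸ maximalIdeal R) A)
  exact Module.Finite.trans (R ⧸ maximalIdeal R) A

lemma socle_fg_of_equiv {A B : Type*} [AddCommGroup A] [Module R A] [AddCommGroup B] [Module R B]
    (e : A ≃ₗ[R] B) (h : (socle R B).FG) : (socle R A).FG := by
  have : socle R A = (socle R B).map e.symm.toLinearMap := by
    ext z
    constructor
    · intro hz
      exact ⟨e z, fun a ha => by rw [← map_smul, hz a ha, map_zero], e.symm_apply_apply z⟩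
    · rintro ⟨w, hw, rfl⟩ a ha
      change a • e.symm w = 0
      rw [← map_smul, hw a ha, map_zero]
  rw [this]
  exact h.map _

variable [IsNoetherianRing R]

lemma exists_prime_ge_of_dim {p : Ideal R} {x : R} (hp : p.IsPrime) (hx : x ∈ maximalIdeal R)
    {n : ℕ} (hn : ((n + 1 : ℕ) : WithBot ℕ∞) ≤ ringKrullDim (R ⧸ p)) :
    ∃ q : Ideal R, q.IsPrime ∧ p ≤ q ∧ x ∈ q ∧ (n : WithBot ℕ∞) ≤ ringKrullDim (R ⧸ q) := by
  haveI : Nontrivial (R ⧸ p) := Ideal.Quotient.nontrivial_iff.mpr hp.ne_top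
  haveI : IsLocalRing (R ⧸ p) := .of_surjective' _ Ideal.Quotient.mk_surjective
  have h1 := ringKrullDim_le_ringKrullDim_quotient_add_card ({Ideal.Quotient.mk p x} : Finset (R ⧸ p))
    (by
      rw [IsLocalRing.ringJacobson_eq_maximalIdeal]
      simp only [Finset.coe_singleton, Set.singleton_subset_iff, SetLike.mem_coe]
      have := eq_maximalIdeal (Ideal.comap_isMaximal_of_surjective (Ideal.Quotient.mk p)
        Ideal.Quotient.mk_surjective (K := maximalIdeal (R ⧸ p)))
      rwa [← Ideal.mem_comap, this])
  rw [Finset.coe_singleton, Finset.card_singleton] at h1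
  have h2 : Ideal.span {Ideal.Quotient.mk p x} = (Ideal.span {x}).map (Ideal.Quotient.mk p) := by
    rw [Ideal.map_span, Set.image_singleton]
  rw [h2, ringKrullDim_eq_of_ringEquiv (DoubleQuot.quotQuotEquivQuotSup p (Ideal.span {x}))] at h1
  have h3 : (n : WithBot ℕ∞) ≤ ringKrullDim (R ⧸ p ⊔ Ideal.span {x}) := by
    have h4 := hn.trans h1
    generalize ringKrullDim (R ⧸ p ⊔ Ideal.span {x}) = d at h4
    cases d with
    | bot => simp at h4
    | coe d =>
      norm_cast at h4 ⊢
      exact (ENat.add_le_add_iff_right (by simp)).mp h4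
  rw [ringKrullDim_quotient, Order.le_krullDim_iff] at h3
  obtain ⟨l, hl⟩ := h3
  have hmem : p ⊔ Ideal.span {x} ≤ l.head.1.asIdeal := l.head.2
  refine ⟨l.head.1.asIdeal, l.head.1.2, le_sup_left.trans hmem, hmem
    (Ideal.mem_sup_right (Ideal.mem_span_singleton_self x)), ?_⟩
  rw [ringKrullDim_quotient, Order.le_krullDim_iff]
  refine ⟨⟨l.length, fun i => ⟨(l i).1, ?_⟩, fun i => l.step i⟩, hl⟩
  exact LTSeries.head_le l i

variable {M : Type u} [AddCommGroup M] [Module R M]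

lemma hm_quotient_sat_bijective [Module.Finite R M] (i : ℕ) : Function.Bijective
    (lcMap (maximalIdeal R) (i + 1) (sat (⊥ : Submodule R M)).mkQ) := by
  have hT : PowTorsion (maximalIdeal R) (sat (⊥ : Submodule R M)) := by
    rintro ⟨v, k, hk⟩
    exact ⟨k, fun a ha => Subtype.ext (hk a ha)⟩
  have hE : Function.Exact (sat (⊥ : Submodule R M)).subtype (sat (⊥ : Submodule R M)).mkQ :=
    LinearMap.exact_iff.mpr (by simp)
  obtain ⟨δ, h1, h2, -⟩ := lc_exists_delta (maximalIdeal R) _ _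
    (Submodule.subtype_injective _) (Submodule.mkQ_surjective _) hE (i + 1)
  constructor
  · rw [injective_iff_map_eq_zero]
    intro z hz
    obtain ⟨w, rfl⟩ := (h1 z).1 hz
    rw [LC.eq_zero_of_powTorsion (maximalIdeal R)
      (N := ModuleCat.of R (sat (⊥ : Submodule R M))) hT i w, map_zero]
  · intro z
    exact (h2 z).1 (LC.eq_zero_of_powTorsion (maximalIdeal R)
      (N := ModuleCat.of R (sat (⊥ : Submodule R M))) hT _ _)

lemma TorsionFree.exists_regular [Module.Finite R M] (hM : TorsionFree R M) :
    ∃ x ∈ maximalIdeal R, RegularOn x M := by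
  have hA := hM.avoidable
  have h : ¬ ((maximalIdeal R : Ideal R) : Set R) ⊆
      ⋃ p ∈ (hA.finite.toFinset : Set (Ideal R)), (p : Set R) := by
    intro h
    obtain ⟨p, hp, hle⟩ := (Ideal.subset_union_prime (f := id) ⊤ ⊤
      (fun p hp _ _ => hA.prime p (hA.finite.mem_toFinset.mp hp))).mp h
    have hp' := hA.finite.mem_toFinset.mp hp
    exact hA.ne p hp' (le_antisymm (le_maximalIdeal (hA.prime p hp').ne_top) hle)
  obtain ⟨x, hx, hxp⟩ := Set.not_subset.mp h
  refine ⟨x, hx, regularOn_of_notMem fun p hp hxq => hxp ?_⟩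
  simp only [Set.mem_iUnion]
  exact ⟨p, hA.finite.mem_toFinset.mpr hp, hxq⟩

variable [IsAdicComplete (maximalIdeal R) R]

lemma socle_hm_fg_of_quotient {x : R} (hx : x ∈ maximalIdeal R) (hreg : RegularOn x M) {i : ℕ}
    (h : (socle R (Hm R i (M ⧸ mulRange x M))).FG) : (socle R (Hm R (i + 1) M)).FG := by
  obtain ⟨α, β, -, -, h3⟩ := hm_exact_of_regular hreg i
  haveI : IsArtinian R (Hm R i (M ⧸ mulRange x M)) :=
    isArtinian_of_socle_fg (fun z => LC.exists_pow_smul (maximalIdeal R) i z) h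
  haveI : IsArtinian R (LinearMap.range β) :=
    isArtinian_of_surjective _ β.rangeRestrict β.surjective_rangeRestrict
  have hle : socle R (Hm R (i + 1) M) ≤ LinearMap.range β := fun z hz => (h3 z).1 (hz x hx)
  haveI : IsArtinian R (socle R (Hm R (i + 1) M)) :=
    isArtinian_of_injective (Submodule.inclusion hle) (Submodule.inclusion_injective hle)
  rw [← Module.Finite.iff_fg]
  exact finite_of_isArtinian_of_smul_eq_zero fun a ha z => Subtype.ext (z.2 a ha)

lemma not_annihilator_hm_le {x : R} (hreg : RegularOn x M) {i : ℕ}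
    (hsoc : (socle R (Hm R (i + 1) M)).FG) {q : Ideal R} (hq : q.IsPrime) (hxq : x ∈ q)
    (h : ¬ Module.annihilator R (Hm R i (M ⧸ mulRange x M)) ≤ q) :
    ¬ Module.annihilator R (Hm R (i + 1) M) ≤ q := by
  intro hle
  obtain ⟨b, hb, hbq⟩ := SetLike.not_le_iff_exists.mp h
  obtain ⟨α, β, -, -, h3⟩ := hm_exact_of_regular hreg i
  obtain ⟨n, r, hnr⟩ := exists_pow_add_mul_mem_annihilator
    (fun z => LC.exists_pow_smul (maximalIdeal R) (i + 1) z) hsoc (x := x) (b := b) (fun z hz => by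
      obtain ⟨w, rfl⟩ := (h3 z).1 hz
      rw [← map_smul, Module.mem_annihilator.mp hb w, map_zero])
  have h4 := (Ideal.add_mem_iff_left q (q.mul_mem_right r hxq)).mp (hle hnr)
  exact hbq (hq.mem_of_pow_mem n h4)

/-- Local cohomology modules over a complete local ring have finitely generated socle, and the
dimension of `R ⧸ Ann Hⁱ` is at most `i`. -/
theorem socle_hm_fg_and_not_annihilator_le (i : ℕ) : ∀ {M : Type u} [AddCommGroup M] [Module R M]
    [Module.Finite R M], (socle R (Hm R i M)).FG ∧ ∀ p : Ideal R, p.IsPrime →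
      ((i + 1 : ℕ) : WithBot ℕ∞) ≤ ringKrullDim (R ⧸ p) →
        ¬ Module.annihilator R (Hm R i M) ≤ p := by
  induction i with
  | zero =>
    intro M _ _ _
    haveI : Module.Finite R (Hm R 0 M) :=
      Module.Finite.of_injective _ (LC.eval_injective (maximalIdeal R) (ModuleCat.of R M))
    refine ⟨IsNoetherian.noetherian _, fun p hp hdim hle => ?_⟩
    have hne : p ≠ maximalIdeal R := by
      rintro rfl
      letI := Ideal.Quotient.field (maximalIdeal R)
      rw [ringKrullDim_eq_zero_of_field] at hdim
      norm_cast at hdim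
    obtain ⟨x, hx, hxp⟩ := SetLike.not_le_iff_exists.mp
      fun h => hne (le_antisymm (le_maximalIdeal hp.ne_top) h)
    obtain ⟨S, hS⟩ := Module.Finite.fg_top (R := R) (M := Hm R 0 M)
    choose k hk using fun z : Hm R 0 M => LC.exists_pow_smul (maximalIdeal R) 0 z
    have : x ^ (S.sup k) ∈ Module.annihilator R (Hm R 0 M) := by
      rw [← Submodule.annihilator_top, ← hS, Submodule.mem_annihilator_span]
      rintro ⟨z, hz⟩
      exact hk z _ (Ideal.pow_le_pow_right (Finset.le_sup hz) (Ideal.pow_mem_pow hx _))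
    exact hxp (hp.mem_of_pow_mem _ (hle this))
  | succ i ih =>
    intro M _ _ _
    let e := LinearEquiv.ofBijective _ (hm_quotient_sat_bijective (R := R) (M := M) i)
    have hM : TorsionFree R (M ⧸ sat (⊥ : Submodule R M)) := torsionFree_quotient_sat (⊥ : Submodule R M)
    obtain ⟨x, hx, hreg⟩ := hM.exists_regular
    obtain ⟨h1, h2⟩ := ih (M := (M ⧸ sat (⊥ : Submodule R M)) ⧸
      mulRange x (M ⧸ sat (⊥ : Submodule R M)))
    have hsoc := socle_hm_fg_of_quotient hx hreg h1
    refine ⟨socle_fg_of_equiv e hsoc, fun p hp hdim hle => ?_⟩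
    obtain ⟨q, hq, hpq, hxq, hdq⟩ := exists_prime_ge_of_dim hp hx hdim
    refine not_annihilator_hm_le hreg hsoc hq hxq (h2 q hq hdq) (le_trans ?_ (hle.trans hpq))
    exact e.annihilator_eq.ge

theorem annCond_of_associatedPrimes [Module.Finite R M] {s : ℕ}
    (h : ∀ p ∈ associatedPrimes R M, ringKrullDim (R ⧸ p) = s) : AnnCond R s M := by
  intro i hi1 his p hp hdim
  obtain ⟨j, rfl⟩ : ∃ j, i = j + 1 := ⟨i - 1, by omega⟩
  by_cases hx : ∃ x ∈ p, RegularOn x M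
  · obtain ⟨x, hxp, hreg⟩ := hx
    exact not_annihilator_hm_le hreg (socle_hm_fg_and_not_annihilator_le (j + 1)).1 hp hxp
      ((socle_hm_fg_and_not_annihilator_le j).2 p hp hdim)
  · have hfin := associatedPrimes.finite R M
    obtain ⟨P, hP, hle⟩ := (Ideal.subset_union_prime (s := hfin.toFinset) (f := id) (I := p) ⊤ ⊤
      (fun P hP _ _ => (hfin.mem_toFinset.mp hP).isPrime)).mp (by
        intro x hxp
        by_contra hne
        refine hx ⟨x, hxp, regularOn_of_notMem fun P hP hxP => hne ?_⟩
        simp only [Set.mem_iUnion]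
        exact ⟨P, hfin.mem_toFinset.mpr hP, hxP⟩)
    refine (socle_hm_fg_and_not_annihilator_le (j + 1)).2 p hp ?_
    calc ((j + 1 + 1 : ℕ) : WithBot ℕ∞) ≤ (s : WithBot ℕ∞) := by exact_mod_cast his
      _ = ringKrullDim (R ⧸ P) := (h P (hfin.mem_toFinset.mp hP)).symm
      _ ≤ ringKrullDim (R ⧸ p) := ringKrullDim_le_of_surjective (Ideal.Quotient.factor hle)
        (Ideal.Quotient.factor_surjective hle)

lemma torsionFree_of_associatedPrimes {s : ℕ} (hs : s ≠ 0)
    (h : ∀ p ∈ associatedPrimes R M, ringKrullDim (R ⧸ p) = s) : TorsionFree R M := by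
  intro u hu
  by_contra hne
  have hp : maximalIdeal R ∈ associatedPrimes R M := by
    refine isAssociatedPrime_iff.mpr ⟨inferInstance, u, le_antisymm ?_ (le_maximalIdeal ?_)⟩
    · intro a ha
      rw [Submodule.mem_colon_singleton]
      exact hu a ha
    · rw [Ne, Ideal.eq_top_iff_one, Submodule.mem_colon_singleton, one_smul]
      exact hne
  have h1 := h _ hp
  letI := Ideal.Quotient.field (maximalIdeal R)
  rw [ringKrullDim_eq_zero_of_field] at h1
  exact hs (by exact_mod_cast h1.symm)

end CompleteAnnihilators

lemma exists_adicCompletion_ringHom {P R : Type*} [CommRing P] [CommRing R] (J : Ideal P)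
    (I : Ideal R) (φ : P →+* R) (h : J.map φ ≤ I) :
    ∃ f : AdicCompletion J P →+* AdicCompletion I R,
      ∀ p, f (algebraMap P _ p) = algebraMap R _ (φ p) := by
  have hle : ∀ n, J ^ n ≤ (I ^ n).comap φ := fun n => by
    rw [← Ideal.map_le_iff_le_comap, Ideal.map_pow]
    exact Ideal.pow_right_mono h n
  have hcomp : ∀ {m n : ℕ} (hmn : m ≤ n), (Ideal.Quotient.factorPow I hmn).comp
      ((Ideal.quotientMap _ φ (hle n)).comp (AdicCompletion.evalₐ J n).toRingHom) =
      (Ideal.quotientMap _ φ (hle m)).comp (AdicCompletion.evalₐ J m).toRingHom := by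
    intro m n hmn
    ext x
    obtain ⟨y, rfl⟩ := AdicCompletion.mk_surjective J P x
    have h := AdicCompletion.Ideal.mk_eq_mk J hmn y
    rw [Ideal.Quotient.eq] at h
    have h' := hle m h
    rw [Ideal.mem_comap, map_sub, ← Ideal.Quotient.eq] at h'
    simpa using h'
  refine ⟨AdicCompletion.liftRingHom I _ hcomp, fun p => AdicCompletion.ext_evalₐ fun n => ?_⟩
  rw [AdicCompletion.evalₐ_liftRingHom]
  simp [AdicCompletion.algebraMap_apply]

lemma isNoetherianRing_adicCompletion (R : Type u) [CommRing R] [IsLocalRing R]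
    [IsNoetherianRing R] : IsNoetherianRing (AdicCompletion (maximalIdeal R) R) := by
  obtain ⟨k, g, hg⟩ := Submodule.fg_iff_exists_fin_generating_family.mp
    (IsNoetherian.noetherian (maximalIdeal R))
  let P := MvPolynomial (Fin k) R
  let J : Ideal P := MvPolynomial.idealOfVars (Fin k) R
  let A := AdicCompletion J P
  haveI : IsNoetherianRing A := isNoetherianRing_of_ringEquiv _
    (MvPowerSeries.toAdicCompletionAlgEquiv (Fin k) R).toRingEquiv
  haveI : IsAdicComplete (J.map (algebraMap P A)) A :=
    AdicCompletion.isAdicComplete_self J (IsNoetherian.noetherian J)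
  let φ : P →+* R := (MvPolynomial.aeval g).toRingHom
  have hφ : J.map φ = maximalIdeal R := by
    rw [← hg, Ideal.map_span, ← Set.range_comp]
    exact congrArg Ideal.span (congrArg Set.range (funext fun i => MvPolynomial.aeval_X g i))
  obtain ⟨f, hf⟩ := exists_adicCompletion_ringHom J _ φ hφ.le
  have hmap : (J.map (algebraMap P A)).map f = maximalIdeal (AdicCompletion (maximalIdeal R) R) := by
    rw [Ideal.map_map, AdicCompletion.maximalIdeal_eq_map, ← congrArg (Ideal.map _) hφ,
      Ideal.map_map]
    exact congrArg (fun h => Ideal.map h J) (RingHom.ext hf)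
  refine isNoetherianRing_of_surjective A _ f ?_
  haveI : IsHausdorff ((J.map (algebraMap P A)).map f) (AdicCompletion (maximalIdeal R) R) := by
    rw [hmap]
    infer_instance
  refine surjective_of_mk_map_comp_surjective (I := J.map (algebraMap P A)) f fun y => ?_
  obtain ⟨y, rfl⟩ := Ideal.Quotient.mk_surjective y
  obtain ⟨z, hz⟩ := (AdicCompletion.residueField_map_bijective R).2 (residue _ y)
  obtain ⟨z, rfl⟩ := residue_surjective z
  rw [ResidueField.map_residue] at hz
  refine ⟨algebraMap P A (MvPolynomial.C z), ?_⟩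
  rw [RingHom.comp_apply, hf, Ideal.Quotient.eq, hmap]
  have : φ (MvPolynomial.C z) = z := MvPolynomial.aeval_C g z
  rw [this]
  exact (Ideal.Quotient.eq).mp hz

section Transfer

lemma length_eq_of_forall_exists_smul {R S X : Type*} [CommRing R] [CommRing S] [Algebra R S]
    [AddCommGroup X] [Module R X] [Module S X] [IsScalarTower R S X]
    (h : ∀ (y : S) (z : X), ∃ r : R, y • z = r • z) : Module.length R X = Module.length S X := by
  have e : Submodule S X ≃o Submodule R X := RelIso.ofSurjective
    (Submodule.restrictScalarsEmbedding R S X) fun A =>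
      ⟨{ A with
          smul_mem' := fun y z hz => by
            obtain ⟨r, hr⟩ := h y z
            rw [hr]
            exact A.smul_mem r hz }, rfl⟩
  have h1 := Order.krullDim_eq_of_orderIso e
  rw [← Module.coe_length, ← Module.coe_length] at h1
  exact (WithBot.coe_injective h1).symm

variable {R S : Type u} [CommRing R] [IsLocalRing R] [IsNoetherianRing R] [CommRing S]
  [IsLocalRing S] [IsNoetherianRing S] [Algebra R S] {M N : Type u} [AddCommGroup M] [Module R M]
  [Module.Finite R M] [AddCommGroup N] [Module R N] [Module S N] [IsScalarTower R S N]
  [Module.Finite S N]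

/-- The properties of the map from a module to its completion that are used to compare Hilbert
functions. -/
structure IsCompletionMap (S : Type u) [CommRing S] [IsLocalRing S] [Algebra R S] [Module S N]
    (ι : M →ₗ[R] N) : Prop where
  max_map : (maximalIdeal R).map (algebraMap R S) = maximalIdeal S
  ring_dense : ∀ (k : ℕ) (y : S), ∃ r : R, y - algebraMap R S r ∈ maximalIdeal S ^ k
  dense : ∀ (k : ℕ) (u : N), ∃ v : M, u - ι v ∈ (maximalIdeal S ^ k • ⊤ : Submodule S N)
  reflect : ∀ (k : ℕ) (v : M), ι v ∈ (maximalIdeal S ^ k • ⊤ : Submodule S N) →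
    v ∈ (maximalIdeal R ^ k • ⊤ : Submodule R M)

namespace IsCompletionMap

variable {ι : M →ₗ[R] N} (hι : IsCompletionMap S ι)
include hι

lemma mem_of_algebraMap_mem {r : R} (hr : algebraMap R S r ∈ maximalIdeal S) :
    r ∈ maximalIdeal R := by
  by_contra h
  exact hr ((not_not.mp h).map (algebraMap R S))

lemma map_mem {Q : Ideal R} {v : M} (hv : v ∈ (Q • ⊤ : Submodule R M)) :
    ι v ∈ (Q.map (algebraMap R S) • ⊤ : Submodule S N) := by
  refine Submodule.smul_induction_on hv (fun r hr w _ => ?_) (fun u w hu hw => ?_)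
  · rw [map_smul, ← algebraMap_smul S r (ι w)]
    exact Submodule.smul_mem_smul (Ideal.mem_map_of_mem _ hr) Submodule.mem_top
  · rw [map_add]
    exact add_mem hu hw

lemma exists_of_mem_map_smul_top (k : ℕ) {Q : Ideal R} {u : N}
    (hu : u ∈ (Q.map (algebraMap R S) • ⊤ : Submodule S N)) :
    ∃ v ∈ (Q • ⊤ : Submodule R M),
      u - ι v ∈ (maximalIdeal S ^ k • Q.map (algebraMap R S) • ⊤ : Submodule S N) := by
  have hu' : u ∈ (Q • ⊤ : Submodule R N) := by
    have := Ideal.smul_restrictScalars (S := S) Q (⊤ : Submodule S N)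
    rw [Submodule.restrictScalars_top] at this
    rw [← this]
    exact hu
  refine Submodule.smul_induction_on hu' (fun r hr w _ => ?_) (fun u w hu hw => ?_)
  · obtain ⟨v, hv⟩ := hι.dense k w
    refine ⟨r • v, Submodule.smul_mem_smul hr Submodule.mem_top, ?_⟩
    rw [map_smul, ← smul_sub, ← algebraMap_smul S r (w - ι v), ← Submodule.mul_smul, mul_comm,
      Submodule.mul_smul]
    exact Submodule.smul_mem_smul (Ideal.mem_map_of_mem _ hr) hv
  · obtain ⟨v, hv, hv'⟩ := hu
    obtain ⟨v₁, hv₁, hv₁'⟩ := hw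
    refine ⟨v + v₁, add_mem hv hv₁, ?_⟩
    rw [map_add, add_sub_add_comm]
    exact add_mem hv' hv₁'

lemma map_smul_top_mono {Q L : Ideal R} (h : (Q • ⊤ : Submodule R M) ≤ L • ⊤) :
    (Q.map (algebraMap R S) • ⊤ : Submodule S N) ≤ L.map (algebraMap R S) • ⊤ := by
  refine Submodule.le_of_le_smul_of_le_jacobson_bot (I := maximalIdeal S)
    (IsNoetherian.noetherian _) (maximalIdeal_le_jacobson ⊥) fun u hu => ?_
  obtain ⟨v, hv, hv'⟩ := hι.exists_of_mem_map_smul_top 1 hu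
  rw [pow_one] at hv'
  rw [← sub_add_cancel u (ι v), add_comm]
  exact Submodule.add_mem_sup (hι.map_mem (h hv)) hv'

lemma mem_sup_of_map_mem (k : ℕ) {Q : Ideal R} {v : M}
    (hv : ι v ∈ (Q.map (algebraMap R S) • ⊤ : Submodule S N)) :
    v ∈ (Q • ⊤ : Submodule R M) ⊔ maximalIdeal R ^ k • ⊤ := by
  obtain ⟨w, hw, hw'⟩ := hι.exists_of_mem_map_smul_top k hv
  rw [← map_sub] at hw'
  rw [← sub_add_cancel v w, add_comm]
  exact Submodule.add_mem_sup hw (hι.reflect k _ (Submodule.smul_mono le_rfl le_top hw'))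

lemma map_pow_eq (k : ℕ) :
    (maximalIdeal R ^ k).map (algebraMap R S) = maximalIdeal S ^ k := by
  rw [Ideal.map_pow, hι.max_map]

lemma length_eq {a : ℕ} {Q : Ideal R} (hQ : (maximalIdeal R ^ a • ⊤ : Submodule R M) ≤ Q • ⊤) :
    Module.length R (M ⧸ (Q • ⊤ : Submodule R M)) =
      Module.length S (N ⧸ (Q.map (algebraMap R S) • ⊤ : Submodule S N)) := by
  have hQ' := hι.map_smul_top_mono hQ
  rw [hι.map_pow_eq] at hQ'
  rw [← length_eq_of_forall_exists_smul (R := R) (S := S)]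
  · let f : M →ₗ[R] N ⧸ (Q.map (algebraMap R S) • ⊤ : Submodule S N) :=
      ((Q.map (algebraMap R S) • ⊤ : Submodule S N).mkQ.restrictScalars R) ∘ₗ ι
    have hker : LinearMap.ker f = Q • ⊤ := by
      ext v
      have : v ∈ LinearMap.ker f ↔ ι v ∈ (Q.map (algebraMap R S) • ⊤ : Submodule S N) :=
        Submodule.Quotient.mk_eq_zero _
      rw [this]
      refine ⟨fun h => ?_, hι.map_mem⟩
      exact (sup_le le_rfl hQ) (hι.mem_sup_of_map_mem a h)
    have hsurj : Function.Surjective f := by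
      intro u
      obtain ⟨u, rfl⟩ := Submodule.mkQ_surjective _ u
      obtain ⟨v, hv⟩ := hι.dense a u
      exact ⟨v, ((Submodule.Quotient.eq _).mpr (hQ' hv)).symm⟩
    rw [← hker]
    exact LinearEquiv.length_eq (f.quotKerEquivOfSurjective hsurj)
  · intro y z
    obtain ⟨u, rfl⟩ := Submodule.mkQ_surjective _ z
    obtain ⟨r, hr⟩ := hι.ring_dense a y
    refine ⟨r, ?_⟩
    rw [← algebraMap_smul S r, ← sub_eq_zero, ← sub_smul, ← map_smul]
    exact (Submodule.Quotient.mk_eq_zero _).mpr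
      (hQ' (Submodule.smul_mem_smul hr Submodule.mem_top))

lemma par_map {s : ℕ} {Q : Ideal R} (h : Par s Q M) : Par s (Q.map (algebraMap R S)) N := by
  obtain ⟨h1, ⟨a, ha⟩, l, hl, hlQ, hle⟩ := h
  refine ⟨?_, ⟨a, ?_⟩, l.map (algebraMap R S), by simp [hl], ?_, ?_⟩
  · rw [← hι.max_map]
    exact Ideal.map_mono h1
  · rw [← hι.map_pow_eq]
    exact hι.map_smul_top_mono ha
  · intro y hy
    obtain ⟨r, hr, rfl⟩ := List.mem_map.mp hy
    exact Ideal.mem_map_of_mem _ (hlQ r hr)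
  · rw [← Ideal.map_ofList]
    exact hι.map_smul_top_mono hle

lemma coeff_map {s : ℕ} {Q : Ideal R} (h : Par s Q M) :
    coeff s (Q.map (algebraMap R S)) N = coeff s Q M := by
  have : hilb (Q.map (algebraMap R S)) N = hilb Q M := by
    funext n
    obtain ⟨a, ha⟩ := h.pow
    have h1 := pow_smul_top_le ha (n + 1)
    rw [← pow_mul] at h1
    unfold hilb len
    rw [hι.length_eq h1, Ideal.map_pow]
  rw [coeff, coeff, this]

lemma defect_map {s : ℕ} {Q : Ideal R} (h : Par s Q M) :
    defect s (Q.map (algebraMap R S)) N = defect s Q M := by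
  obtain ⟨a, ha⟩ := h.pow
  unfold defect len
  rw [hι.coeff_map h, hι.length_eq ha]

omit hι in
lemma map_ofList_le {l : List S} {r : S → R} {J : Ideal S}
    (hr : ∀ y, y - algebraMap R S (r y) ∈ J) {Q' : Ideal S} (hl : ∀ y ∈ l, y ∈ Q') :
    (Ideal.ofList (l.map r)).map (algebraMap R S) ≤ Q' ⊔ J := by
  rw [Ideal.map_le_iff_le_comap]
  refine ofList_le fun z hz => ?_
  obtain ⟨y, hy, rfl⟩ := List.mem_map.mp hz
  change algebraMap R S (r y) ∈ Q' ⊔ J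
  have h1 : y ∈ Q' ⊔ J := Ideal.mem_sup_left (hl y hy)
  have h2 : y - algebraMap R S (r y) ∈ Q' ⊔ J := Ideal.mem_sup_right (hr y)
  have h3 := sub_mem h1 h2
  rwa [sub_sub_cancel] at h3

omit hι in
lemma ofList_le_map {l : List S} {r : S → R} {J : Ideal S}
    (hr : ∀ y, y - algebraMap R S (r y) ∈ J) :
    Ideal.ofList l ≤ (Ideal.ofList (l.map r)).map (algebraMap R S) ⊔ J := by
  refine ofList_le fun y hy => ?_
  have h1 : algebraMap R S (r y) ∈ (Ideal.ofList (l.map r)).map (algebraMap R S) :=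
    Ideal.mem_map_of_mem _ (Ideal.subset_span (List.mem_map_of_mem hy))
  have h3 := Submodule.add_mem_sup h1 (hr y)
  rwa [add_sub_cancel] at h3

lemma exists_par {s : ℕ} {Q' : Ideal S} (h : Par s Q' N) : ∃ Q : Ideal R, Par s Q M ∧
    (∃ l : List R, l.length = s ∧ Q = Ideal.ofList l) ∧
      (Q.map (algebraMap R S) • ⊤ : Submodule S N) = Q' • ⊤ := by
  obtain ⟨h1, ⟨a, ha⟩, l, hl, hlQ, hle⟩ := h
  choose r hr using hι.ring_dense (a + 1)
  have hr' : ∀ y ∈ l, r y ∈ maximalIdeal R := fun y hy => by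
    refine hι.mem_of_algebraMap_mem ?_
    have h2 := sub_mem (h1 (hlQ y hy)) (Ideal.pow_le_self (by omega) (hr y))
    rwa [sub_sub_cancel] at h2
  obtain ⟨Q, hQ⟩ : ∃ Q : Ideal R, Q = Ideal.ofList (l.map r) := ⟨_, rfl⟩
  have heq : (Q.map (algebraMap R S) • ⊤ : Submodule S N) = Q' • ⊤ := by
    have ha' : (maximalIdeal S ^ (a + 1) • ⊤ : Submodule S N) ≤ maximalIdeal S • Q' • ⊤ := by
      rw [pow_succ', Submodule.mul_smul]
      exact Submodule.smul_mono le_rfl ha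
    have hle1 := ofList_le_map (l := l) hr
    have hle2 := map_ofList_le hr hlQ
    rw [← hQ] at hle1 hle2
    apply le_antisymm
    · refine (smul_top_mono hle2).trans ?_
      rw [Submodule.sup_smul]
      exact sup_le le_rfl (ha'.trans Submodule.smul_le_right)
    · refine Submodule.le_of_le_smul_of_le_jacobson_bot (I := maximalIdeal S)
        (IsNoetherian.noetherian _) (maximalIdeal_le_jacobson ⊥) ?_
      refine (hle.trans (smul_top_mono hle1)).trans ?_
      rw [Submodule.sup_smul]
      exact sup_le_sup le_rfl ha'
  have hlen : (l.map r).length = s := by rw [List.length_map, hl]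
  refine ⟨Q, ⟨?_, ⟨a, ?_⟩, l.map r, hlen, fun y hy => ?_, hQ ▸ le_rfl⟩, ⟨l.map r, hlen, hQ⟩, heq⟩
  · rw [hQ]
    refine ofList_le fun z hz => ?_
    obtain ⟨y, hy, rfl⟩ := List.mem_map.mp hz
    exact hr' y hy
  · refine Submodule.le_of_le_smul_of_le_jacobson_bot (I := maximalIdeal R)
        (IsNoetherian.noetherian _) (maximalIdeal_le_jacobson ⊥) fun v hv => ?_
    rw [← Submodule.mul_smul, ← pow_succ']
    refine hι.mem_sup_of_map_mem (a + 1) ?_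
    rw [heq]
    refine ha ?_
    rw [← hι.map_pow_eq]
    exact hι.map_mem hv
  · rw [hQ]
    exact Ideal.subset_span hy

lemma torsionFree (h : TorsionFree S N) : TorsionFree R M := by
  intro u hu
  have h1 : ι u = 0 := by
    refine h _ fun a ha => ?_
    rw [← hι.max_map] at ha
    have hle : (maximalIdeal R).map (algebraMap R S) ≤
        LinearMap.ker (LinearMap.toSpanSingleton S N (ι u)) := by
      rw [Ideal.map_le_iff_le_comap]
      intro r hr
      change algebraMap R S r • ι u = 0
      rw [algebraMap_smul, ← map_smul, hu r hr, map_zero]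
    exact hle ha
  have h2 : ∀ k, u ∈ (maximalIdeal R ^ k • ⊤ : Submodule R M) := fun k =>
    hι.reflect k u (by rw [h1]; exact zero_mem _)
  have h3 : u ∈ (⨅ k, maximalIdeal R ^ k • ⊤ : Submodule R M) := by
    rw [Submodule.mem_iInf]
    exact h2
  rwa [Ideal.iInf_pow_smul_eq_bot_of_isLocalRing _ (maximalIdeal.isMaximal R).ne_top] at h3

end IsCompletionMap

end Transfer

section Completion

variable {R : Type u} [CommRing R] [IsLocalRing R] [IsNoetherianRing R] {M : Type u}
  [AddCommGroup M] [Module R M] [Module.Finite R M]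

lemma finite_adicCompletion : Module.Finite (AdicCompletion (maximalIdeal R) R)
    (AdicCompletion (maximalIdeal R) M) :=
  Module.Finite.of_surjective _
    (AdicCompletion.ofTensorProduct_surjective_of_finite (maximalIdeal R) M)

lemma maximalIdeal_pow_smul_top_adicCompletion (k : ℕ)
    (u : AdicCompletion (maximalIdeal R) M) :
    u ∈ (maximalIdeal (AdicCompletion (maximalIdeal R) R) ^ k • ⊤ :
      Submodule (AdicCompletion (maximalIdeal R) R) (AdicCompletion (maximalIdeal R) M)) ↔
      AdicCompletion.eval (maximalIdeal R) M k u = 0 := by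
  have h1 := AdicCompletion.pow_smul_top_eq_ker_eval (I := maximalIdeal R) (M := M) (n := k)
    (IsNoetherian.noetherian _)
  have h2 := Ideal.smul_restrictScalars (S := AdicCompletion (maximalIdeal R) R)
    (maximalIdeal R ^ k) (⊤ : Submodule _ (AdicCompletion (maximalIdeal R) M))
  rw [Submodule.restrictScalars_top, h1, Ideal.map_pow, ← AdicCompletion.maximalIdeal_eq_map] at h2
  rw [← LinearMap.mem_ker, ← h2]
  rfl

lemma isCompletionMap_of : IsCompletionMap (AdicCompletion (maximalIdeal R) R)
    (AdicCompletion.of (maximalIdeal R) M) := by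
  have hdense : ∀ (N : Type u) [AddCommGroup N] [Module R N] [Module.Finite R N] (k : ℕ)
      (u : AdicCompletion (maximalIdeal R) N), ∃ v : N,
      u - AdicCompletion.of (maximalIdeal R) N v ∈
        (maximalIdeal (AdicCompletion (maximalIdeal R) R) ^ k • ⊤ :
          Submodule (AdicCompletion (maximalIdeal R) R) _) := fun N _ _ _ k u => by
    obtain ⟨v, hv⟩ := Submodule.mkQ_surjective _ (AdicCompletion.eval (maximalIdeal R) N k u)
    refine ⟨v, ?_⟩
    rw [maximalIdeal_pow_smul_top_adicCompletion, map_sub, ← hv, sub_eq_zero]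
    rfl
  refine ⟨AdicCompletion.maximalIdeal_eq_map.symm, fun k y => ?_, hdense M, fun k v hv => ?_⟩
  · obtain ⟨r, hr⟩ := hdense R k y
    refine ⟨r, ?_⟩
    exact (Ideal.mul_top (maximalIdeal (AdicCompletion (maximalIdeal R) R) ^ k)).le hr
  · rw [maximalIdeal_pow_smul_top_adicCompletion] at hv
    exact (Submodule.Quotient.mk_eq_zero _).mp hv

lemma torsionFree_of_unmixed {s : ℕ} (hs : s ≠ 0)
    (h : ∀ p ∈ associatedPrimes (AdicCompletion (maximalIdeal R) R)
      (AdicCompletion (maximalIdeal R) M),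
      ringKrullDim (AdicCompletion (maximalIdeal R) R ⧸ p) = (s : WithBot ℕ∞)) :
    TorsionFree R M := by
  haveI := isNoetherianRing_adicCompletion R
  haveI := finite_adicCompletion (R := R) (M := M)
  exact isCompletionMap_of.torsionFree (torsionFree_of_associatedPrimes hs h)

theorem finLC_of_unmixed {t : ℕ} {Q₀ : Ideal R} {c : ℤ}
    (h : ∀ p ∈ associatedPrimes (AdicCompletion (maximalIdeal R) R)
      (AdicCompletion (maximalIdeal R) M),
      ringKrullDim (AdicCompletion (maximalIdeal R) R ⧸ p) = ((t + 2 : ℕ) : WithBot ℕ∞))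
    (hQ₀ : Par (t + 2) Q₀ M)
    (hc : ∀ l : List R, l.length = t + 2 → Par (t + 2) (Ideal.ofList l) M →
      coeff (t + 2) (Ideal.ofList l) M (t + 1) = c) : FinLC R (t + 2) M := by
  haveI := isNoetherianRing_adicCompletion R
  haveI := finite_adicCompletion (R := R) (M := M)
  have hι := isCompletionMap_of (R := R) (M := M)
  have hN : TorsionFree (AdicCompletion (maximalIdeal R) R) (AdicCompletion (maximalIdeal R) M) :=
    torsionFree_of_associatedPrimes (by omega) h
  have hfin : FinLC (AdicCompletion (maximalIdeal R) R) (t + 2)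
      (AdicCompletion (maximalIdeal R) M) := by
    refine finLC_of_chern_le t c.toNat 0 hN (annCond_of_associatedPrimes h) (hι.par_map hQ₀)
      fun Q' _ hQ' _ => ?_
    obtain ⟨Q, hQ, ⟨l, hl, rfl⟩, heq⟩ := hι.exists_par hQ'
    rw [coeff_eq_of_smul_eq heq.symm, hι.coeff_map hQ, hc l hl hQ]
    exact Int.self_le_toNat c
  refine finLC_of_defect_le (t + 1)
    (sumI (t + 1) (lcShift (AdicCompletion (maximalIdeal R) R) (AdicCompletion (maximalIdeal R) M)))
    0 (hι.torsionFree hN) hQ₀ fun Q _ hQ => ?_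
  rw [← hι.defect_map hQ]
  exact defect_le (t + 1) hfin hN (hι.par_map hQ)

end Completion

section Statement

lemma moduleLength_eq_natCast_iff {R M : Type*} [CommRing R] [AddCommGroup M] [Module R M]
    {l : ℕ} : moduleLength R M = (l : WithBot ℕ∞) ↔ Module.length R M = l := by
  rw [moduleLength, ← Module.coe_length]
  exact_mod_cast Iff.rfl

lemma moduleLength_eq_len {R M : Type*} [CommRing R] [AddCommGroup M] [Module R M]
    (h : Module.length R M ≠ ⊤) : moduleLength R M = (len R M : WithBot ℕ∞) :=
  moduleLength_eq_natCast_iff.mpr (coe_len h).symm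

lemma len_eq_of_moduleLength_eq {R M : Type*} [CommRing R] [AddCommGroup M] [Module R M]
    {l : ℕ} (h : moduleLength R M = (l : WithBot ℕ∞)) :
    Module.length R M ≠ ⊤ ∧ len R M = l := by
  rw [moduleLength_eq_natCast_iff] at h
  rw [len, h]
  exact ⟨ENat.natCast_ne_top l, ENat.toNat_natCast l⟩

lemma sum_hilbert_eq (s n : ℕ) (e : ℕ → ℤ) :
    ∑ i ∈ range (s + 1), (-1 : ℤ) ^ i * e i * ((n + s - i).choose (s - i)) =
      ∑ i ∈ range (s + 1), ((-1 : ℤ) ^ (s - i) * e (s - i)) * ((n + i).choose i : ℕ) := by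
  rw [← sum_range_reflect]
  refine sum_congr rfl fun i hi => ?_
  have hi' : i ≤ s := by simpa [Nat.lt_succ_iff] using hi
  rw [show s + 1 - 1 - i = s - i by omega, show n + s - (s - i) = n + i by omega,
    show s - (s - i) = i by omega]

variable {R : Type u} [CommRing R] [IsLocalRing R] [IsNoetherianRing R] {M : Type u}
  [AddCommGroup M] [Module R M] [Module.Finite R M]

lemma hasHilbertCoeffsMod_coeff {s : ℕ} {Q : Ideal R} (h : Par s Q M) :
    HasHilbertCoeffsMod M Q s fun i => (-1) ^ i * coeff s Q M (s - i) := by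
  obtain ⟨N, hN⟩ := Filter.eventually_atTop.mp h.hasCoeff_coeff
  refine ⟨N, fun n hn => ⟨_, moduleLength_eq_len (h.length_ne_top (n + 1)), ?_⟩⟩
  rw [sum_hilbert_eq]
  refine (hN n hn).trans (sum_congr rfl fun i hi => ?_)
  have hi' : i ≤ s := by simpa [Nat.lt_succ_iff] using hi
  rw [← mul_assoc, ← mul_pow, show s - (s - i) = i by omega]
  simp

lemma coeff_eq_of_hasHilbertCoeffsMod {s : ℕ} {Q : Ideal R} (h : Par s Q M) {e : ℕ → ℤ}
    (he : HasHilbertCoeffsMod M Q s e) {i : ℕ} (hi : i ≤ s) :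
    coeff s Q M i = (-1) ^ (s - i) * e (s - i) := by
  obtain ⟨N, hN⟩ := he
  have : HasCoeff (s + 1) (hilb Q M) fun i => (-1) ^ (s - i) * e (s - i) := by
    refine Filter.eventually_atTop.mpr ⟨N, fun n hn => ?_⟩
    obtain ⟨l, hl, hl'⟩ := hN n hn
    rw [hilb, (len_eq_of_moduleLength_eq hl).2, hl', sum_hilbert_eq]
  exact h.hasCoeff_coeff.unique this i (by omega)

lemma chern_eq_of_hasHilbertCoeffsMod {t : ℕ} {Q : Ideal R} (h : Par (t + 2) Q M) {e : ℕ → ℤ}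
    (he : HasHilbertCoeffsMod M Q (t + 2) e) : e 1 = -coeff (t + 2) Q M (t + 1) := by
  rw [coeff_eq_of_hasHilbertCoeffsMod h he (by omega), show t + 2 - (t + 1) = 1 by omega]
  ring

lemma mult_eq_of_hasHilbertCoeffsMod {s : ℕ} {Q : Ideal R} (h : Par s Q M) {e : ℕ → ℤ}
    (he : HasHilbertCoeffsMod M Q s e) : e 0 = coeff s Q M s := by
  rw [coeff_eq_of_hasHilbertCoeffsMod h he le_rfl, Nat.sub_self]
  ring

lemma localCohomologyLength_eq_natCast_iff {i l : ℕ} :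
    localCohomologyLength R M i = (l : WithBot ℕ∞) ↔ Module.length R (Hm R i M) = l := by
  rw [localCohomologyLength, moduleLength_eq_natCast_iff, length_localCohomology]

lemma FinLC.localCohomologyLength_eq {s : ℕ} (h : FinLC R s M) {i : ℕ} (hi : i < s) :
    localCohomologyLength R M i = (lcLen R i M : WithBot ℕ∞) :=
  localCohomologyLength_eq_natCast_iff.mpr (coe_len (h i hi)).symm

lemma FinLC.of_localCohomologyLength_eq {s : ℕ} {h : ℕ → ℕ}
    (hh : ∀ i, i < s → localCohomologyLength R M i = (h i : WithBot ℕ∞)) : FinLC R s M :=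
  fun i hi => by
    rw [localCohomologyLength_eq_natCast_iff.mp (hh i hi)]
    exact ENat.natCast_ne_top _

lemma lcLen_eq_of_localCohomologyLength_eq {i l : ℕ}
    (h : localCohomologyLength R M i = (l : WithBot ℕ∞)) : lcLen R i M = l := by
  rw [lcLen, len, localCohomologyLength_eq_natCast_iff.mp h, ENat.toNat_natCast]

lemma par_of_isParameterIdealFor {s : ℕ} {Q : Ideal R}
    (h : IsParameterIdealFor M s Q) : Par s Q M := by
  obtain ⟨⟨x, hx, rfl⟩, l, hl⟩ := h
  have hle : Ideal.span (Set.range x) = Ideal.ofList (List.ofFn x) := by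
    rw [Ideal.ofList]
    congr 1
    ext y
    simp [List.mem_ofFn]
  refine ⟨?_, ?_, List.ofFn x, by simp, fun y hy => ?_, hle ▸ le_rfl⟩
  · rw [Ideal.span_le]
    rintro _ ⟨i, rfl⟩
    exact hx i
  · obtain ⟨k, hk⟩ := exists_pow_smul_top_eq_bot (len_eq_of_moduleLength_eq hl).1
    refine ⟨k, fun u hu => ?_⟩
    rw [← map_smul_top_of_surjective _ (Submodule.mkQ _) (Submodule.mkQ_surjective _)] at hk
    exact (Submodule.Quotient.mk_eq_zero _).mp
      ((Submodule.mem_bot R).mp (hk.le (Submodule.mem_map_of_mem hu)))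
  · rw [hle]
    exact Ideal.subset_span hy

lemma isParameterIdealFor_ofList {s : ℕ} {l : List R} (hl : l.length = s)
    (h : Par s (Ideal.ofList l) M) : IsParameterIdealFor M s (Ideal.ofList l) := by
  subst hl
  have h1 := h.length_ne_top 1
  rw [pow_one] at h1
  refine ⟨⟨l.get, fun i => h.le (Ideal.subset_span (l.get_mem i)), ?_⟩, _, moduleLength_eq_len h1⟩
  rw [Ideal.ofList]
  congr 1
  ext y
  simp [List.mem_iff_get]

lemma sum_choose_eq_sumI {t : ℕ} (h : ℕ → ℕ) (h0 : h 0 = 0) :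
    ∑ i ∈ range (t + 1), (t.choose i : ℤ) * h i = sumI t fun i => h (i + 1) := by
  rw [sum_range_succ', h0, sumI]
  push_cast
  simp

lemma sum_Icc_choose_eq_sumE {t : ℕ} (h : ℕ → ℕ) :
    ∑ i ∈ Icc 1 (t + 1), (t.choose (i - 1) : ℤ) * h i = sumE t fun i => h (i + 1) := by
  rw [sumE, ← Finset.Ico_succ_right_eq_Icc, sum_Ico_eq_sum_range]
  push_cast
  refine sum_congr (by simp) fun i _ => ?_
  rw [add_comm 1 i, Nat.add_sub_cancel]

lemma std_iff_of_isBuchsbaumModule {t : ℕ} (hM : TorsionFree R M)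
    (h : IsBuchsbaumModule R M (t + 2)) {Q : Ideal R} (hQ : IsParameterIdealFor M (t + 2) Q) :
    FinLC R (t + 2) M ∧ Std (t + 1) Q M := by
  obtain ⟨e, l, k, he, hl, hk, heq⟩ := h Q hQ
  have hP := par_of_isParameterIdealFor hQ
  have hk' : ∀ i < t + 2, lcLen R i M = k i := fun i hi =>
    lcLen_eq_of_localCohomologyLength_eq (hk i hi)
  refine ⟨FinLC.of_localCohomologyLength_eq hk, ?_⟩
  have h0 : k 0 = 0 := by rw [← hk' 0 (by omega), lcLen_zero hM]
  rw [Nat.add_sub_assoc (by omega), sum_choose_eq_sumI k h0,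
    mult_eq_of_hasHilbertCoeffsMod hP he] at heq
  rw [Std, defect, (len_eq_of_moduleLength_eq hl).2]
  refine heq.trans ?_
  rw [sumI_congr fun i hi => ?_]
  exact (hk' (i + 1) (by omega)).symm

lemma isBuchsbaumModule_of_std {t : ℕ} (hM : TorsionFree R M)
    (h : ∀ Q : Ideal R, IsParameterIdealFor M (t + 2) Q →
      FinLC R (t + 2) M ∧ Std (t + 1) Q M) : IsBuchsbaumModule R M (t + 2) := by
  intro Q hQ
  obtain ⟨hfin, hstd⟩ := h Q hQ
  have hP := par_of_isParameterIdealFor hQ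
  have h1 := hP.length_ne_top 1
  rw [pow_one] at h1
  have he := hasHilbertCoeffsMod_coeff hP
  refine ⟨_, _, fun i => lcLen R i M, he, moduleLength_eq_len h1,
    fun i hi => hfin.localCohomologyLength_eq hi, ?_⟩
  refine Eq.trans ?_ (sum_choose_eq_sumI (t := t + 1) _ (lcLen_zero hM)).symm
  rw [mult_eq_of_hasHilbertCoeffsMod hP he]
  exact hstd

end Statement

end ChernBuchsbaum

/-- **Ghezzi–Goto–Hong–Ozeki–Phuong–Vasconcelos, Theorem 5.4**.  Let `(R,m)` be a
Noetherian local ring and `M` a finitely generated unmixed `R`-module of dimension `s ≥ 2`.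
Then `M` is Buchsbaum iff `e₁(Q,M)` is constant, independent of the parameter ideal `Q` for
`M`; and in that case `e₁(Q,M) = -∑_{i=1}^{s-1} C(s-2,i-1)·λ(Hⁱ_m(M))` for every parameter
ideal `Q` for `M`. -/
theorem buchsbaum_iff_chern_constant
    {R M : Type u} [CommRing R] [IsNoetherianRing R] [IsLocalRing R]
    [AddCommGroup M] [Module R M] [Module.Finite R M]
    (s : ℕ) (hs : 2 ≤ s)
    (hdimM : ringKrullDim (R ⧸ Module.annihilator R M) = s)
    (hunmixed : IsUnmixedModule R M s) :
    (IsBuchsbaumModule R M s ↔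
      ∃ c : ℤ, ∀ Q : Ideal R, IsParameterIdealFor M s Q →
        ∀ e : ℕ → ℤ, HasHilbertCoeffsMod M Q s e → e 1 = c) ∧
    (IsBuchsbaumModule R M s →
      ∀ Q : Ideal R, IsParameterIdealFor M s Q →
        ∀ e : ℕ → ℤ, HasHilbertCoeffsMod M Q s e →
          ∃ h : ℕ → ℕ, (∀ i, i < s → localCohomologyLength R M i = (h i : WithBot ℕ∞)) ∧
            e 1 = -∑ i ∈ Finset.Icc 1 (s - 1), ((s - 2).choose (i - 1) : ℤ) * h i) := by
  open ChernBuchsbaum in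
  obtain ⟨t, rfl⟩ : ∃ t, s = t + 2 := ⟨s - 2, by omega⟩
  have hM : TorsionFree R M := torsionFree_of_unmixed (by omega) hunmixed
  have hchern : IsBuchsbaumModule R M (t + 2) → ∀ Q : Ideal R, IsParameterIdealFor M (t + 2) Q →
      ∀ e : ℕ → ℤ, HasHilbertCoeffsMod M Q (t + 2) e → e 1 = -sumE t (lcShift R M) := by
    intro h Q hQ e he
    obtain ⟨hfin, hstd⟩ := std_iff_of_isBuchsbaumModule hM h hQ
    have hP := par_of_isParameterIdealFor hQ
    rw [chern_eq_of_hasHilbertCoeffsMod hP he, hstd.chern_eq t hfin hM hP]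
  refine ⟨⟨fun h => ⟨_, hchern h⟩, fun ⟨c, hc⟩ => isBuchsbaumModule_of_std hM fun Q hQ => ?_⟩,
    fun h Q hQ e he => ?_⟩
  · have hP := par_of_isParameterIdealFor hQ
    have hc' : ∀ Q : Ideal R, IsParameterIdealFor M (t + 2) Q →
        coeff (t + 2) Q M (t + 1) = -c := fun Q hQ => by
      have hP := par_of_isParameterIdealFor hQ
      have he := hasHilbertCoeffsMod_coeff hP
      rw [← hc Q hQ _ he, chern_eq_of_hasHilbertCoeffsMod hP he, neg_neg]
    have hfin : FinLC R (t + 2) M := finLC_of_unmixed (c := -c) hunmixed hP fun l hl hl' =>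
      hc' _ (isParameterIdealFor_ofList hl hl')
    refine ⟨hfin, std_of_chern_eq t hfin hM hP ?_⟩
    obtain ⟨Q', -, hP', hstd⟩ := exists_std (t + 1) hfin hM hP 0
    rw [hc' Q hQ, ← hstd.chern_eq t hfin hM hP']
    obtain ⟨l, hl, hlQ, hle⟩ := hP'.gen
    have heq := le_antisymm (smul_top_mono (ofList_le hlQ)) hle
    have hPl : Par (t + 2) (Ideal.ofList l) M :=
      ⟨(ofList_le hlQ).trans hP'.le, heq ▸ hP'.pow, l, hl, fun y hy => Ideal.subset_span hy,
        le_rfl⟩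
    rw [← hc' _ (isParameterIdealFor_ofList hl hPl), coeff_eq_of_smul_eq heq]
  · obtain ⟨hfin, -⟩ := std_iff_of_isBuchsbaumModule hM h hQ
    refine ⟨fun i => lcLen R i M, fun i hi => hfin.localCohomologyLength_eq hi, ?_⟩
    rw [hchern h Q hQ e he, Nat.add_sub_cancel, show t + 2 - 1 = t + 1 by omega]
    exact congrArg _ (sum_Icc_choose_eq_sumE (t := t) fun i => lcLen R i M).symm
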